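/- arXiv:1411.6844 — 6 statements merged into one kernel-verified Lean document; each statement's English description precedes it below -/
import Mathlib

section
/- Let K ⊆ L be a field extension such that K is p-closed in L, i.e. K(p) ∩ L = K, where K(p) is the compositum of all Galois extensions of K of p-power degree inside a fixed separable closure. If w is a valuation on L extending uniquely to L(p), then the restriction v of w to K extends uniquely to K(p). -/
/-- The inclusion ring homomorphism between two subfields `K ≤ L` of a field. -/
def sfIncl {Ω : Type*} [Field Ω] {K L : Subfield Ω} (h : K ≤ L) : K →+* L where
  toFun x := ⟨x.1, h x.2⟩
  map_one' := rfl
  map_mul' _ _ := rfl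
  map_zero' := rfl
  map_add' _ _ := rfl

/-- The compositum `K(p)` of all Galois extensions of `K` of `p`-power degree inside an
extension field `Ω` (to be taken separably/algebraically closed). -/
@[irreducible] noncomputable def pClosure (p : ℕ) (K : Type*) [Field K]
    (Ω : Type*) [Field Ω] [Algebra K Ω] : IntermediateField K Ω :=
  ⨆ N ∈ {N : IntermediateField K Ω |
      IsGalois K N ∧ FiniteDimensional K N ∧ ∃ k : ℕ, Module.finrank K N = p ^ k}, N

open Polynomial in
/-- The coefficients of a product of linear factors `X - r` lie in any subring containing all
the `r`. -/
theorem Subring.coeff_multiset_prod_X_sub_C_mem {R : Type*} [CommRing R] (S : Subring R)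
    (s : Multiset R) (hs : ∀ r ∈ s, r ∈ S) (k : ℕ) :
    ((s.map fun r => X - C r).prod).coeff k ∈ S := by
  have h : (s.map fun r => X - C r).prod ∈ Polynomial.lifts S.subtype := by
    refine multiset_prod_mem _ fun f hf => ?_
    obtain ⟨r, hr, rfl⟩ := Multiset.mem_map.mp hf
    exact (lifts_iff_liftsRing _ _).mpr <| sub_mem
      ((lifts_iff_liftsRing _ _).mp (X_mem_lifts _))
      ((lifts_iff_liftsRing _ _).mp (C_mem_lifts S.subtype ⟨r, hs r hr⟩))
  obtain ⟨y, hy⟩ := (lifts_iff_coeff_lifts _).mp h k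
  exact hy ▸ y.2

open Polynomial in
/-- If all `r` have valuation less than one, then so do the non-leading coefficients of the
product of the linear factors `X - r`. -/
theorem Valuation.coeff_multiset_prod_X_sub_C_lt_one {R Γ : Type*} [CommRing R]
    [LinearOrderedCommGroupWithZero Γ] (v : Valuation R Γ) (s : Multiset R)
    (hs : ∀ r ∈ s, v r < 1) (k : ℕ) (hk : k < s.card) :
    v (((s.map fun r => X - C r).prod).coeff k) < 1 := by
  induction s using Multiset.induction generalizing k with
  | empty => simp at hk
  | cons a s ih =>
    have ha : v a < 1 := hs a (Multiset.mem_cons_self a s)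
    have hs' : ∀ r ∈ s, v r < 1 := fun r hr => hs r (Multiset.mem_cons_of_mem hr)
    have hle (j : ℕ) : v (((s.map fun r => X - C r).prod).coeff j) ≤ 1 :=
      Subring.coeff_multiset_prod_X_sub_C_mem v.integer s (fun r hr => (hs' r hr).le) j
    have hmul (j : ℕ) : v (a * ((s.map fun r => X - C r).prod).coeff j) < 1 := by
      rw [map_mul]
      exact mul_lt_one_of_lt_of_le ha (hle j)
    rw [Multiset.map_cons, Multiset.prod_cons, sub_mul, coeff_sub, coeff_C_mul]
    refine v.map_sub_lt ?_ (hmul k)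
    cases k with
    | zero => simp
    | succ k =>
      rw [coeff_X_mul]
      exact ih hs' k (by simpa using hk)

instance pClosure_normal (p : ℕ) (K Ω : Type*) [Field K] [Field Ω] [Algebra K Ω] :
    Normal K (pClosure p K Ω) := by
  unfold pClosure
  rw [iSup_subtype']
  have (N : {N : IntermediateField K Ω |
      IsGalois K N ∧ FiniteDimensional K N ∧ ∃ k : ℕ, Module.finrank K N = p ^ k}) :
      Normal K (N : IntermediateField K Ω) := N.2.1.to_normal
  exact IntermediateField.normal_iSup K Ω _

section Tower

open Polynomial IntermediateField

variable {p : ℕ} {K L Ω : Type*} [Field K] [Field L] [Field Ω]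
  [Algebra K L] [Algebra K Ω] [Algebra L Ω] [IsScalarTower K L Ω]

/-- If every element of `L` lying in the normal extension `N` of `K` comes from `K`, then
elements of `N` have the same minimal polynomial over `K` and over `L`. -/
theorem minpoly_map_eq_of_normal (N : IntermediateField K Ω) [Normal K N]
    (hN : ∀ x : L, algebraMap L Ω x ∈ N → x ∈ (algebraMap K L).range)
    {x : Ω} (hx : x ∈ N) : (minpoly K x).map (algebraMap K L) = minpoly L x := by
  have hxK : IsIntegral K x :=
    (isIntegral_algebraMap_iff N.val.injective).mpr (Normal.isIntegral ‹_› (⟨x, hx⟩ : N))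
  have hxL : IsIntegral L x := hxK.tower_top
  have hsN : ((minpoly K x).map (algebraMap K N)).Splits := by
    have := Normal.splits ‹Normal K N› (⟨x, hx⟩ : N)
    rwa [← minpoly.algebraMap_eq N.val.injective] at this
  have hdvd : (minpoly L x).map (algebraMap L Ω) ∣ (minpoly K x).map (algebraMap K Ω) := by
    rw [IsScalarTower.algebraMap_eq K L Ω, ← Polynomial.map_map]
    exact Polynomial.map_dvd _ (minpoly.dvd_map_of_isScalarTower K L x)
  have hne : (minpoly K x).map (algebraMap K Ω) ≠ 0 := ((minpoly.monic hxK).map _).ne_zero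
  have hsΩ : ((minpoly K x).map (algebraMap K Ω)).Splits := by
    rw [IsScalarTower.algebraMap_eq K N Ω, ← Polynomial.map_map]
    exact hsN.map _
  have hroots : ∀ r ∈ ((minpoly L x).map (algebraMap L Ω)).roots, r ∈ N.toSubfield.toSubring := by
    intro r hr
    have hr' := Multiset.mem_of_le (Polynomial.roots.le_of_dvd hne hdvd) hr
    rw [IsScalarTower.algebraMap_eq K N Ω, ← Polynomial.map_map, hsN.roots_map] at hr'
    obtain ⟨y, -, rfl⟩ := Multiset.mem_map.mp hr'
    exact y.2
  have hlift : minpoly L x ∈ lifts (algebraMap K L) := by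
    refine (lifts_iff_coeff_lifts _).mpr fun k => hN _ ?_
    have := Subring.coeff_multiset_prod_X_sub_C_mem _ _ hroots k
    rwa [← (hsΩ.of_dvd hne hdvd).eq_prod_roots_of_monic ((minpoly.monic hxL).map _),
      coeff_map] at this
  obtain ⟨q, hq, -, hqm⟩ := lifts_and_natDegree_eq_and_monic hlift (minpoly.monic hxL)
  rw [← hq, ← minpoly.unique K x hqm]
  · rw [← aeval_map_algebraMap L, hq, minpoly.aeval]
  · intro q' hm h0
    rw [← degree_map q (algebraMap K L), ← degree_map q' (algebraMap K L), hq]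
    exact minpoly.min L x (hm.map _) (by rwa [aeval_map_algebraMap])

/-- If `K` is `p`-closed in `L`, then `K(p) ⊆ L(p)`. -/
theorem pClosure_le_restrictScalars [IsAlgClosed Ω]
    (hKL : ∀ x : L, algebraMap L Ω x ∈ pClosure p K Ω → x ∈ (algebraMap K L).range) :
    pClosure p K Ω ≤ (pClosure p L Ω).restrictScalars K := by
  conv_lhs => unfold pClosure
  refine iSup₂_le fun N ⟨hgal, hfin, k, hk⟩ => ?_
  have hNK : N ≤ pClosure p K Ω := by
    unfold pClosure
    exact le_iSup₂_of_le N ⟨hgal, hfin, k, hk⟩ le_rfl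
  obtain ⟨a, ha⟩ := Field.exists_primitive_element K N
  have hNa : N = K⟮(a : Ω)⟯ := by
    have := congrArg (IntermediateField.map N.val) ha
    rw [adjoin_map, Set.image_singleton, ← AlgHom.fieldRange_eq_map, fieldRange_val] at this
    exact this.symm
  have hmin : (minpoly K (a : Ω)).map (algebraMap K L) = minpoly L (a : Ω) :=
    minpoly_map_eq_of_normal N (fun x hx => hKL x (hNK hx)) a.2
  have haK : IsIntegral K (a : Ω) :=
    (isIntegral_algebraMap_iff N.val.injective).mpr (Algebra.IsIntegral.isIntegral a)
  have haL : IsIntegral L (a : Ω) := haK.tower_top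
  have hKaLa : K⟮(a : Ω)⟯ ≤ L⟮(a : Ω)⟯.restrictScalars K := by
    rw [adjoin_simple_le_iff]
    exact mem_adjoin_simple_self L (a : Ω)
  have hsep : (minpoly L (a : Ω)).Separable := by
    rw [← hmin]
    have ha_sep : IsSeparable K (a : Ω) :=
      (Algebra.IsSeparable.isSeparable K a).map N.val N.val.injective
    exact Polynomial.Separable.map ha_sep
  have hsN : ((minpoly K (a : Ω)).map (algebraMap K N)).Splits := by
    have := Normal.splits hgal.to_normal a
    rwa [← minpoly.algebraMap_eq N.val.injective] at this
  have hroot : adjoin L ((minpoly L (a : Ω)).rootSet Ω) = L⟮(a : Ω)⟯ := by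
    refine le_antisymm (adjoin_le_iff.mpr fun r hr => ?_) ?_
    · classical
      refine hKaLa (hNa ▸ ?_)
      rw [rootSet_def, Finset.mem_coe, Multiset.mem_toFinset, aroots_def, ← hmin,
        Polynomial.map_map, ← IsScalarTower.algebraMap_eq, IsScalarTower.algebraMap_eq K N Ω,
        ← Polynomial.map_map, hsN.roots_map] at hr
      obtain ⟨y, -, rfl⟩ := Multiset.mem_map.mp hr
      exact y.2
    · rw [adjoin_simple_le_iff]
      refine subset_adjoin _ _ ((mem_rootSet_of_ne (minpoly.ne_zero haL)).mpr (minpoly.aeval _ _))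
  have hsplit : (minpoly L (a : Ω)).IsSplittingField L L⟮(a : Ω)⟯ :=
    hroot ▸ adjoin_rootSet_isSplittingField (IsAlgClosed.splits _)
  have hLp : L⟮(a : Ω)⟯ ≤ pClosure p L Ω := by
    unfold pClosure
    refine le_iSup₂_of_le _ ⟨IsGalois.of_separable_splitting_field hsep,
      adjoin.finiteDimensional haL, k, ?_⟩ le_rfl
    rw [adjoin.finrank haL, ← hmin, natDegree_map, ← adjoin.finrank haK, ← hNa, hk]
  exact hNa.le.trans (hKaLa.trans hLp)

end Tower

section UniqueExtension

open Polynomial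

variable {L M : Type*} [Field L] [Field M] [Algebra L M] {W : ValuationSubring M}

/-- The unique extension of a valuation ring to a normal extension is stable under conjugation. -/
theorem ValuationSubring.comap_algEquiv_eq_of_unique
    (hW : ∀ W' : ValuationSubring M,
      W'.comap (algebraMap L M) = W.comap (algebraMap L M) → W' = W)
    (σ : M ≃ₐ[L] M) : W.comap (σ : M →+* M) = W := by
  refine hW _ ?_
  ext x
  simp [ValuationSubring.mem_comap]

theorem ValuationSubring.valuation_lt_one_iff_inv_notMem (W : ValuationSubring M) {x : M}
    (hx : x ≠ 0) : W.valuation x < 1 ↔ x⁻¹ ∉ W := by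
  rw [← W.valuation_le_one_iff, not_le, map_inv₀, one_lt_inv₀]
  exact zero_lt_iff.mpr ((_root_.map_ne_zero _).mpr hx)

variable [Normal L M]

theorem ValuationSubring.exists_conj_of_mem_roots_minpoly
    {x y : M} (hy : y ∈ ((minpoly L x).map (algebraMap L M)).roots) :
    ∃ σ : M ≃ₐ[L] M, σ x = y := by
  refine minpoly.exists_algEquiv_of_root' (Algebra.IsAlgebraic.isAlgebraic _) ?_
  simpa [IsRoot, eval_map_algebraMap] using (isRoot_of_mem_roots hy)

theorem ValuationSubring.coeff_minpoly_mem_of_unique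
    (hW : ∀ W' : ValuationSubring M,
      W'.comap (algebraMap L M) = W.comap (algebraMap L M) → W' = W)
    {x : M} (hx : x ∈ W) (k : ℕ) : algebraMap L M ((minpoly L x).coeff k) ∈ W := by
  have hm := (minpoly.monic (Normal.isIntegral ‹Normal L M› x)).map (algebraMap L M)
  rw [← coeff_map, (Normal.splits ‹Normal L M› x).eq_prod_roots_of_monic hm]
  refine Subring.coeff_multiset_prod_X_sub_C_mem W.toSubring _ (fun y hy => ?_) k
  obtain ⟨σ, rfl⟩ := exists_conj_of_mem_roots_minpoly hy
  rw [← comap_algEquiv_eq_of_unique hW σ] at hx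
  exact hx

theorem ValuationSubring.valuation_coeff_minpoly_lt_one_of_unique
    (hW : ∀ W' : ValuationSubring M,
      W'.comap (algebraMap L M) = W.comap (algebraMap L M) → W' = W)
    {x : M} (hx : W.valuation x < 1) {k : ℕ} (hk : k < (minpoly L x).natDegree) :
    W.valuation (algebraMap L M ((minpoly L x).coeff k)) < 1 := by
  have hm := (minpoly.monic (Normal.isIntegral ‹Normal L M› x)).map (algebraMap L M)
  have hs := Normal.splits ‹Normal L M› x
  rw [← coeff_map, hs.eq_prod_roots_of_monic hm]
  refine Valuation.coeff_multiset_prod_X_sub_C_lt_one _ _ (fun y hy => ?_) k ?_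
  · obtain ⟨σ, rfl⟩ := exists_conj_of_mem_roots_minpoly hy
    rcases eq_or_ne x 0 with rfl | h0
    · simp
    rw [valuation_lt_one_iff_inv_notMem _ (by simpa using h0), ← map_inv₀]
    rw [valuation_lt_one_iff_inv_notMem _ h0, ← comap_algEquiv_eq_of_unique hW σ] at hx
    exact hx
  · rwa [← hs.natDegree_eq_card_roots, natDegree_map]

end UniqueExtension

open Polynomial in
/-- A root of a monic polynomial with coefficients in a valuation ring lies in that ring. -/
theorem ValuationSubring.mem_of_monic_of_coeff_mem {K N : Type*} [Field K] [Field N] [Algebra K N]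
    (V : ValuationSubring N) {f : K[X]} (hf : f.Monic)
    (hc : ∀ k, algebraMap K N (f.coeff k) ∈ V) {x : N} (hx : aeval x f = 0) : x ∈ V := by
  have hlift : f.map (algebraMap K N) ∈ lifts V.subtype :=
    (lifts_iff_coeff_lifts _).mpr fun k => ⟨⟨_, hc k⟩, (coeff_map _ k).symm⟩
  obtain ⟨q, hq, -, hqm⟩ := lifts_and_natDegree_eq_and_monic hlift (hf.map _)
  have hint : IsIntegral V x := ⟨q, hqm, by
    
    rw [← eval_map]
    exact (congrArg (eval x) hq).trans ((eval_map_algebraMap f x).trans hx)⟩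
  obtain ⟨y, rfl⟩ := IsIntegrallyClosed.isIntegral_iff.mp hint
  exact y.2

open Polynomial in
/-- A root of a monic polynomial whose lower coefficients have valuation less than one has
valuation less than one. -/
theorem Valuation.lt_one_of_monic_of_coeff_lt_one {K N Γ : Type*} [Field K] [Field N] [Algebra K N]
    [LinearOrderedCommGroupWithZero Γ]
    (v : Valuation N Γ) {f : K[X]} (hf : f.Monic)
    (hc : ∀ k < f.natDegree, v (algebraMap K N (f.coeff k)) < 1) {x : N}
    (hx : aeval x f = 0) : v x < 1 := by
  by_contra! h
  rw [aeval_eq_sum_range, Finset.sum_range_succ, hf.coeff_natDegree, one_smul] at hx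
  have hlt : v (∑ i ∈ Finset.range f.natDegree, f.coeff i • x ^ i) < v (x ^ f.natDegree) := by
    refine v.map_sum_lt' ?_ fun i hi => ?_
    · rw [map_pow]
      exact pow_pos (zero_lt_one.trans_le h) _
    · rw [Algebra.smul_def, map_mul, map_pow, map_pow]
      have hi' := Finset.mem_range.mp hi
      calc _ < 1 * v x ^ i := mul_lt_mul_of_pos_right (hc i hi') (pow_pos (zero_lt_one.trans_le h) _)
        _ ≤ _ := by rw [one_mul]; exact pow_le_pow_right₀ h hi'.le
  rw [← neg_eq_iff_add_eq_zero.mpr hx, Valuation.map_neg] at hlt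
  exact hlt.false

/-- if `K` is `p`-closed in `L`, i.e. `K(p) ∩ L = K`, and `w` is a valuation on
`L` extending uniquely to `L(p)` (i.e. `w` is `p`-henselian), then the restriction `v` of `w`
to `K` extends uniquely to `K(p)`. All fields are taken inside a fixed algebraically closed
field `Ω`. -/
theorem pHenselian_restriction (p : ℕ) (hp : p.Prime)
    (Ω : Type*) [Field Ω] [IsAlgClosed Ω]
    (K L : Subfield Ω) (hKL : K ≤ L)
    (hclosed : ∀ x : Ω, x ∈ pClosure p K Ω → x ∈ L → x ∈ K)
    (w : ValuationSubring L)
    (hw : ∃! W : ValuationSubring (pClosure p L Ω),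
      W.comap (algebraMap L (pClosure p L Ω)) = w) :
    ∃! V : ValuationSubring (pClosure p K Ω),
      V.comap (algebraMap K (pClosure p K Ω)) = w.comap (sfIncl hKL) := by
  let : Algebra K L := (sfIncl hKL).toAlgebra
  have : IsScalarTower K L Ω := .of_algebraMap_eq fun _ => rfl
  have hKL' : ∀ x : L, algebraMap L Ω x ∈ pClosure p K Ω → x ∈ (algebraMap K L).range :=
    fun x hx => ⟨⟨x, hclosed x hx x.2⟩, rfl⟩
  have hle : ∀ x : Ω, x ∈ pClosure p K Ω → x ∈ pClosure p L Ω :=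
    fun x hx => pClosure_le_restrictScalars hKL' hx
  obtain ⟨W, hWw, hWu⟩ := hw
  let ι : pClosure p K Ω →+* pClosure p L Ω :=
    (pClosure p K Ω).val.toRingHom.codRestrict (pClosure p L Ω).toSubfield fun x => hle x x.2
  have hW : ∀ W' : ValuationSubring (pClosure p L Ω), W'.comap (algebraMap L (pClosure p L Ω)) =
      W.comap (algebraMap L (pClosure p L Ω)) → W' = W := fun W' h => hWu W' (h.trans hWw)
  have hmin (x : pClosure p K Ω) :
      (minpoly K x).map (sfIncl hKL) = minpoly L (ι x) := by
    have h := minpoly_map_eq_of_normal (pClosure p K Ω) hKL' x.2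
    have h1 : minpoly K (x : Ω) = minpoly K x :=
      minpoly.algebraMap_eq (pClosure p K Ω).val.injective x
    have h2 : minpoly L (x : Ω) = minpoly L (ι x) :=
      minpoly.algebraMap_eq (pClosure p L Ω).val.injective (ι x)
    rw [h1, h2] at h
    exact h
  have hmonic (x : pClosure p K Ω) : (minpoly K x).Monic :=
    minpoly.monic (Normal.isIntegral inferInstance x)
  have hcoeff (x : pClosure p K Ω) (k : ℕ) :
      algebraMap L (pClosure p L Ω) (sfIncl hKL ((minpoly K x).coeff k)) =
        algebraMap L (pClosure p L Ω) ((minpoly L (ι x)).coeff k) := by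
    rw [← hmin, Polynomial.coeff_map]
  have hdeg (x : pClosure p K Ω) : (minpoly K x).natDegree = (minpoly L (ι x)).natDegree := by
    rw [← hmin, Polynomial.natDegree_map]
  have hmem (V : ValuationSubring (pClosure p K Ω))
      (hV : V.comap (algebraMap K (pClosure p K Ω)) = w.comap (sfIncl hKL)) (a : K) :
      algebraMap K (pClosure p K Ω) a ∈ V ↔
        algebraMap L (pClosure p L Ω) (sfIncl hKL a) ∈ W := by
    rw [← ValuationSubring.mem_comap, hV, ← hWw]
    rfl
  refine ⟨W.comap ι, by rw [← hWw]; rfl, fun V hV => ?_⟩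
  ext x
  rw [ValuationSubring.mem_comap]
  constructor
  · intro hx
    by_contra hxW
    have hx0 : x ≠ 0 := by
      rintro rfl
      exact hxW (by simp [zero_mem])
    have hval : W.valuation (ι x⁻¹) < 1 := by
      rw [W.valuation_lt_one_iff_inv_notMem (by simpa using hx0), map_inv₀, inv_inv]
      exact hxW
    have hlt : V.valuation x⁻¹ < 1 := by
      refine V.valuation.lt_one_of_monic_of_coeff_lt_one (hmonic x⁻¹) (fun k hk => ?_)
        (minpoly.aeval K x⁻¹)
      have := ValuationSubring.valuation_coeff_minpoly_lt_one_of_unique hW hval (hdeg x⁻¹ ▸ hk)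
      rw [← hcoeff] at this
      rcases eq_or_ne ((minpoly K x⁻¹).coeff k) 0 with h0 | h0
      · simp [h0]
      rw [ValuationSubring.valuation_lt_one_iff_inv_notMem _ (by simpa using h0), ← map_inv₀,
        ← map_inv₀, ← hmem V hV, map_inv₀] at this
      exact (V.valuation_lt_one_iff_inv_notMem (by simpa using h0)).mpr this
    rw [V.valuation_lt_one_iff_inv_notMem (inv_ne_zero hx0), inv_inv] at hlt
    exact hlt hx
  · intro hx
    refine V.mem_of_monic_of_coeff_mem (hmonic x) (fun k => ?_) (minpoly.aeval K x)
    rw [hmem V hV, hcoeff]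
    exact ValuationSubring.coeff_minpoly_mem_of_unique hW hx k
end

section
/- Let (K,v) be a valued field. If every polynomial g = T^m + T^{m−1} + Σ_{i=0}^{m−2} a_i T^i ∈ K[T] with m ≤ n! and all a_i in the maximal ideal m_v has a zero x ∈ O_v with x + 1 ∈ m_v, then v extends uniquely to every Galois extension N of K with [N:K] ≤ n. -/
open Polynomial

namespace ValuationSubring

variable {K N : Type*} [Field K] [Field N] [Algebra K N]

theorem mul_mem_nonunits (W : ValuationSubring N) {a b : N} (ha : a ∈ W)
    (hb : b ∈ W.nonunits) : a * b ∈ W.nonunits := by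
  rw [mem_nonunits_iff] at hb ⊢
  rw [map_mul]
  exact mul_lt_one_of_nonneg_of_lt_one_right ((W.valuation_le_one_iff a).2 ha) zero_le hb

theorem algebraMap_mem_nonunits_iff {v : ValuationSubring K} {W : ValuationSubring N}
    (h : W.comap (algebraMap K N) = v) {a : K} :
    algebraMap K N a ∈ W.nonunits ↔ a ∈ v.nonunits := by
  subst h
  simp [mem_nonunits_iff_or]

theorem coeff_prod_X_sub_C_mem_nonunits (W : ValuationSubring N) (s : Multiset N)
    (hs : ∀ r ∈ s, r ∈ W.nonunits) {i : ℕ} (hi : i < s.card) :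
    (s.map (fun r ↦ X - C r)).prod.coeff i ∈ W.nonunits := by
  rw [Multiset.prod_X_sub_C_coeff s hi.le]
  refine W.mul_mem_nonunits (pow_mem (W.neg_mem _ W.one_mem) _) ?_
  have hc : 0 < s.card - i := by omega
  generalize s.card - i = k at hc
  unfold Multiset.esymm
  refine multiset_sum_mem _ fun a ha ↦ ?_
  obtain ⟨t, ht, rfl⟩ := Multiset.mem_map.1 ha
  obtain ⟨hts, rfl⟩ := Multiset.mem_powersetCard.1 ht
  obtain ⟨r, hr⟩ := Multiset.card_pos_iff_exists_mem.1 hc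
  obtain ⟨u, rfl⟩ := Multiset.exists_cons_of_mem hr
  rw [Multiset.prod_cons, mul_comm]
  refine W.mul_mem_nonunits (multiset_prod_mem _ fun x hx ↦ ?_)
    (hs _ (Multiset.mem_of_le hts (by simp)))
  exact nonunits_subset (hs _ (Multiset.mem_of_le hts (by simp [hx])))

theorem isIntegral_of_forall_mem (v : ValuationSubring K) {z : N}
    (hz : ∀ V : ValuationSubring N, v ≤ V.comap (algebraMap K N) → z ∈ V) :
    IsIntegral v z := by
  let R := (integralClosure v N).toSubring
  have : IsIntegrallyClosedIn R N :=
    inferInstanceAs (IsIntegrallyClosedIn (integralClosure v N) N)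
  suffices z ∈ R from this
  rw [R.eq_iInf_of_isIntegrallyClosedIn]
  simp only [Subring.mem_iInf]
  rintro ⟨V, hV⟩
  exact hz V fun a ha ↦ hV ((integralClosure v N).algebraMap_mem ⟨a, ha⟩)

theorem mem_of_isIntegral {v : ValuationSubring K} {W : ValuationSubring N}
    (h : v ≤ W.comap (algebraMap K N)) {z : N} (hz : IsIntegral v z) : z ∈ W := by
  obtain ⟨p, hp, hpz⟩ := hz
  have : IsIntegral W z := by
    refine ⟨p.map (((algebraMap K N).comp v.subtype).codRestrict W.toSubring
      fun a ↦ h a.2), hp.map _, ?_⟩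
    rw [eval₂_map]
    exact hpz
  obtain ⟨w, rfl⟩ := IsIntegrallyClosed.algebraMap_eq_of_integral this
  exact w.2

theorem exists_polynomial_coeff_eq_one (v : ValuationSubring K) {x : N} (hx : IsIntegral K x) :
    ∃ (p : K[X]), aeval x p = 0 ∧ (∀ i, p.coeff i ∈ v) ∧ ∃ k, p.coeff k = 1 := by
  have hne : (minpoly K x) ≠ 0 := minpoly.ne_zero hx
  obtain ⟨k, hk, hmax⟩ := (minpoly K x).support.exists_max_image
    (fun i ↦ v.valuation ((minpoly K x).coeff i)) (support_nonempty.2 hne)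
  have hk0 : (minpoly K x).coeff k ≠ 0 := mem_support_iff.1 hk
  refine ⟨C ((minpoly K x).coeff k)⁻¹ * minpoly K x, by simp, fun i ↦ ?_, k, by simp [hk0]⟩
  rw [← valuation_le_one_iff, coeff_C_mul, map_mul, map_inv₀]
  by_cases hi : i ∈ (minpoly K x).support
  · rw [inv_mul_le_one₀ (by simpa [zero_lt_iff] using hk0)]
    exact hmax i hi
  · simp [notMem_support_iff.1 hi]

theorem exists_isIntegral_mul_eq [Algebra.IsAlgebraic K N] {v : ValuationSubring K}
    {W : ValuationSubring N} (h : W.comap (algebraMap K N) = v) {x : N} (hx : x ∈ W) :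
    ∃ z : N, IsIntegral v z ∧ IsIntegral v (z * x) ∧ z ∉ W.nonunits := by
  classical
  rcases eq_or_ne x 0 with rfl | hx0
  · exact ⟨1, isIntegral_one, by simpa using isIntegral_zero, by simp [mem_nonunits_iff]⟩
  obtain ⟨p, hpx, hpv, k₀, hk₀⟩ := v.exists_polynomial_coeff_eq_one
    (Algebra.IsIntegral.isIntegral (R := K) x)
  have hk₀' : p.coeff k₀ ∉ v.nonunits := by simp [hk₀, mem_nonunits_iff]
  have hle : ∀ i, p.coeff i ∉ v.nonunits → i ≤ p.natDegree := fun i hi ↦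
    le_natDegree_of_ne_zero fun h0 ↦ hi (h0 ▸ v.nonunits.zero_mem)
  let P : ℕ → Prop := fun i ↦ p.coeff i ∉ v.nonunits
  let k := Nat.findGreatest P p.natDegree
  have hk : p.coeff k ∉ v.nonunits := Nat.findGreatest_spec (P := P) (hle _ hk₀') hk₀'
  have hgt : ∀ i, k < i → p.coeff i ∈ v.nonunits := fun i hi ↦ by
    by_contra hc
    exact (Nat.le_findGreatest (P := P) (hle i hc) hc).not_gt hi
  obtain ⟨d, hd⟩ : ∃ d, p.natDegree = k + d := Nat.exists_eq_add_of_le (hle k hk)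
  let z := ∑ i ∈ Finset.range (d + 1), algebraMap K N (p.coeff (k + i)) * x ^ i
  have hsum : ∑ i ∈ Finset.range k, algebraMap K N (p.coeff i) * x ^ i + z * x ^ k = 0 := by
    rw [aeval_eq_sum_range, hd, add_assoc, Finset.sum_range_add] at hpx
    rw [← hpx, Finset.sum_mul]
    simp only [Algebra.smul_def, pow_add]
    congr 1
    exact Finset.sum_congr rfl fun i _ ↦ by ring
  have hz : z = -∑ i ∈ Finset.range k, algebraMap K N (p.coeff i) * x⁻¹ ^ (k - i) := by
    rw [← mul_left_inj' (pow_ne_zero k hx0), eq_neg_of_add_eq_zero_right hsum, neg_mul, neg_inj,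
      Finset.sum_mul]
    refine Finset.sum_congr rfl fun i hi ↦ ?_
    have hi' : k = i + (k - i) := by have := Finset.mem_range.1 hi; omega
    nth_rw 2 [hi']
    rw [pow_add, inv_pow]
    field_simp
  have hzx : z * x = -∑ i ∈ Finset.range k, algebraMap K N (p.coeff i) * x⁻¹ ^ (k - i - 1) := by
    rw [hz, neg_mul, Finset.sum_mul]
    congr 1
    refine Finset.sum_congr rfl fun i hi ↦ ?_
    have hi' : k - i = (k - i - 1) + 1 := by have := Finset.mem_range.1 hi; omega
    nth_rw 1 [hi']
    rw [pow_succ, mul_assoc, mul_assoc, inv_mul_cancel₀ hx0, mul_one]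
  refine ⟨z, ?_, ?_, fun hzW ↦ hk ?_⟩
  · refine v.isIntegral_of_forall_mem fun V hV ↦ ?_
    rcases V.mem_or_inv_mem x with hxV | hxV
    · exact sum_mem fun i _ ↦ V.mul_mem _ _ (hV (hpv _)) (pow_mem hxV _)
    · rw [hz]
      exact V.neg_mem _ (sum_mem fun i _ ↦ V.mul_mem _ _ (hV (hpv _)) (pow_mem hxV _))
  · refine v.isIntegral_of_forall_mem fun V hV ↦ ?_
    rcases V.mem_or_inv_mem x with hxV | hxV
    · exact V.mul_mem _ _ (sum_mem fun i _ ↦ V.mul_mem _ _ (hV (hpv _)) (pow_mem hxV _)) hxV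
    · rw [hzx]
      exact V.neg_mem _ (sum_mem fun i _ ↦ V.mul_mem _ _ (hV (hpv _)) (pow_mem hxV _))
  · rw [← algebraMap_mem_nonunits_iff h]
    have hz' : z = ∑ i ∈ Finset.range d, algebraMap K N (p.coeff (k + (i + 1))) * x ^ (i + 1)
        + algebraMap K N (p.coeff k) := by
      simp [z, Finset.sum_range_succ']
    rw [eq_sub_of_add_eq' hz'.symm]
    refine sub_mem hzW (sum_mem fun i _ ↦ ?_)
    rw [mul_comm]
    exact W.mul_mem_nonunits (pow_mem hx _)
      ((algebraMap_mem_nonunits_iff h).2 (hgt _ (by omega)))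

theorem exists_comap_algebraMap_eq (v : ValuationSubring K) :
    ∃ W : ValuationSubring N, W.comap (algebraMap K N) = v := by
  obtain ⟨W, hW, hloc⟩ := IsLocalRing.exists_factor_valuationRing
    ((algebraMap K N).comp v.subtype)
  refine ⟨W, le_antisymm (fun a ha ↦ ?_) fun a ha ↦ hW ⟨a, ha⟩⟩
  rcases v.mem_or_inv_mem a with h | h
  · exact h
  rcases eq_or_ne a 0 with rfl | h0
  · exact zero_mem _
  have hu : IsUnit (⟨a⁻¹, h⟩ : v) := by
    refine hloc.map_nonunit _ (IsUnit.of_mul_eq_one ⟨algebraMap K N a, ha⟩ (Subtype.ext ?_))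
    change algebraMap K N a⁻¹ * algebraMap K N a = 1
    rw [← map_mul, inv_mul_cancel₀ h0, map_one]
  obtain ⟨b, hb⟩ := hu.exists_right_inv
  have hb' : a⁻¹ * (b : K) = 1 := congrArg Subtype.val hb
  rw [inv_mul_eq_one₀ h0] at hb'
  exact hb' ▸ b.2

/-- `v` has roots for the polynomials `T ^ m + T ^ (m - 1) + ⋯` of degree `m ≤ d` whose remaining
coefficients are nonunits. -/
def HasSpecialRoots (v : ValuationSubring K) (d : ℕ) : Prop :=
  ∀ (g : K[X]) (m : ℕ), 1 ≤ m → m ≤ d → g.Monic → g.natDegree = m → g.coeff (m - 1) = 1 →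
    (∀ i, i + 2 ≤ m → g.coeff i ∈ v.nonunits) → ∃ x : K, g.IsRoot x

theorem HasSpecialRoots.exists_root {v : ValuationSubring K} {d : ℕ} (hv : v.HasSpecialRoots d)
    {f : K[X]} (hf : f.Monic) (hd : f.natDegree ≤ d) (hpos : 1 ≤ f.natDegree)
    (htop : f.coeff (f.natDegree - 1) + 1 ∈ v.nonunits)
    (hlow : ∀ i, i + 2 ≤ f.natDegree → f.coeff i ∈ v.nonunits) : ∃ x : K, f.IsRoot x := by
  set a := f.coeff (f.natDegree - 1) with ha
  have hau : a ∉ v.nonunits := fun h ↦ by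
    have := sub_mem htop h
    simp [mem_nonunits_iff] at this
  have ha0 : a ≠ 0 := fun h ↦ hau (h ▸ v.nonunits.zero_mem)
  have hinv : a⁻¹ ∈ v := by
    by_contra h
    exact hau (v.mem_nonunits_iff_or.2 (.inr h))
  obtain ⟨x, hx⟩ := hv (f.scaleRoots a⁻¹) f.natDegree hpos hd
    ((monic_scaleRoots_iff _).2 hf) (natDegree_scaleRoots _ _)
    (by rw [coeff_scaleRoots, Nat.sub_sub_self hpos, pow_one, ← ha, mul_inv_cancel₀ ha0])
    (fun i hi ↦ by
      rw [coeff_scaleRoots, mul_comm]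
      exact v.mul_mem_nonunits (pow_mem hinv _) (hlow i hi))
  refine ⟨a * x, ?_⟩
  have := scaleRoots_eval_mul (f.scaleRoots a⁻¹) x a
  rwa [← scaleRoots_mul, inv_mul_cancel₀ ha0, scaleRoots_one, hx.eq_zero, mul_zero] at this

theorem HasSpecialRoots.mem_range_algebraMap [IsGalois K N] [FiniteDimensional K N]
    {v : ValuationSubring K} (hv : v.HasSpecialRoots (Module.finrank K N))
    {W : ValuationSubring N} (h : W.comap (algebraMap K N) = v) {y : N}
    (hy : y - 1 ∈ W.nonunits) (hconj : ∀ σ : Gal(N/K), σ y ≠ y → σ y ∈ W.nonunits) :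
    y ∈ (algebraMap K N).range := by
  have hyint : IsIntegral K y := Algebra.IsIntegral.isIntegral y
  have hmonic := minpoly.monic hyint
  set f := minpoly K y with hf
  obtain ⟨s, hs⟩ := Multiset.exists_cons_of_mem (a := y) (s := f.aroots N)
    ((mem_aroots).2 ⟨minpoly.ne_zero hyint, minpoly.aeval K y⟩)
  have hsplit : (f.map (algebraMap K N)).Splits := Normal.splits inferInstance y
  have hnodup : (f.aroots N).Nodup :=
    nodup_roots (Separable.map (Algebra.IsSeparable.isSeparable K y))
  rw [hs, Multiset.nodup_cons] at hnodup
  have hsW : ∀ r ∈ s, r ∈ W.nonunits := fun r hr ↦ by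
    have hr' : r ∈ f.aroots N := hs ▸ Multiset.mem_cons_of_mem hr
    obtain ⟨σ, rfl⟩ := minpoly.exists_algEquiv_of_root'
      (Algebra.IsAlgebraic.isAlgebraic (R := K) y) ((mem_aroots).1 hr').2
    exact hconj σ fun he ↦ hnodup.1 (he ▸ hr)
  have hprod : f.map (algebraMap K N) = (X - C y) * (s.map fun r ↦ X - C r).prod := by
    have := hsplit.eq_prod_roots_of_monic (hmonic.map _)
    rwa [← aroots, hs, Multiset.map_cons, Multiset.prod_cons] at this
  set q := (s.map fun r ↦ X - C r).prod with hq
  have hqdeg : q.natDegree = s.card := natDegree_multiset_prod_X_sub_C_eq_card s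
  have hqmonic : q.Monic := monic_multisetProd_X_sub_C s
  have hqcoeff : ∀ i < s.card, q.coeff i ∈ W.nonunits := fun i hi ↦
    W.coeff_prod_X_sub_C_mem_nonunits s hsW hi
  have hqtop : q.coeff s.card = 1 := hqdeg ▸ hqmonic
  have hdeg : f.natDegree = s.card + 1 := by
    rw [← hmonic.natDegree_map (algebraMap K N), hprod,
      (monic_X_sub_C y).natDegree_mul hqmonic, natDegree_X_sub_C, hqdeg, add_comm]
  have hyW : y ∈ W := by
    simpa using W.add_mem _ _ (nonunits_subset hy) W.one_mem
  have hcoeff : ∀ i, i < s.card → algebraMap K N (f.coeff i) ∈ W.nonunits := fun i hi ↦ by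
    rw [← coeff_map, hprod, sub_mul, coeff_sub, coeff_C_mul]
    refine sub_mem ?_ (W.mul_mem_nonunits hyW (hqcoeff i hi))
    cases i with
    | zero => simp
    | succ i => rw [coeff_X_mul]; exact hqcoeff i (by omega)
  obtain ⟨x, hx⟩ := hv.exists_root hmonic (minpoly.natDegree_le y) (by omega)
    (by
      rw [← algebraMap_mem_nonunits_iff h, map_add, map_one, ← coeff_map, hprod, hdeg,
        Nat.add_sub_cancel, sub_mul, coeff_sub, coeff_C_mul, hqtop]
      have hX : (X * q).coeff s.card ∈ W.nonunits := by
        rcases hc : s.card with _ | c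
        · simp
        · rw [coeff_X_mul]; exact hqcoeff c (by omega)
      have := sub_mem hX hy
      convert this using 1
      ring)
    (fun i hi ↦ (algebraMap_mem_nonunits_iff h).1 (hcoeff i (by omega)))
  exact minpoly.mem_range_of_degree_eq_one K y
    (degree_eq_one_of_irreducible_of_root (minpoly.irreducible hyint) hx)

/-- The center on the integral closure of `v` of a valuation ring `W` lying above `v`. -/
def centerIntegralClosure {v : ValuationSubring K} {W : ValuationSubring N}
    (h : W.comap (algebraMap K N) = v) : Ideal (integralClosure v N) where
  carrier := {b | (b : N) ∈ W.nonunits}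
  add_mem' := fun ha hb ↦ W.nonunits.add_mem ha hb
  zero_mem' := W.nonunits.zero_mem
  smul_mem' := fun c _ hb ↦ W.mul_mem_nonunits (mem_of_isIntegral h.ge c.2) hb

section Center

variable {v : ValuationSubring K} {W : ValuationSubring N} (h : W.comap (algebraMap K N) = v)

theorem mem_centerIntegralClosure {b : integralClosure v N} :
    b ∈ centerIntegralClosure h ↔ (b : N) ∈ W.nonunits := Iff.rfl

instance isPrime_centerIntegralClosure : (centerIntegralClosure h).IsPrime := by
  rw [Ideal.isPrime_iff]
  refine ⟨fun ht ↦ ?_, fun {b c} hbc ↦ ?_⟩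
  · have := (Ideal.eq_top_iff_one _).1 ht
    simp [mem_centerIntegralClosure, mem_nonunits_iff] at this
  · by_contra! hc
    simp only [mem_centerIntegralClosure, mem_nonunits_iff, not_lt] at hbc hc
    rw [MulMemClass.coe_mul, map_mul] at hbc
    exact hbc.not_ge (one_le_mul hc.1 hc.2)

theorem under_centerIntegralClosure :
    (centerIntegralClosure h).under v = IsLocalRing.maximalIdeal v := by
  ext a
  rw [← coe_mem_nonunits_iff, ← algebraMap_mem_nonunits_iff h]
  rfl

theorem le_of_centerIntegralClosure_eq [Algebra.IsAlgebraic K N] {W' : ValuationSubring N}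
    (h' : W'.comap (algebraMap K N) = v)
    (heq : centerIntegralClosure h = centerIntegralClosure h') : W ≤ W' := by
  intro x hx
  obtain ⟨z, hz, hzx, hzW⟩ := exists_isIntegral_mul_eq h hx
  have hzW' : z ∉ W'.nonunits := fun hc ↦
    hzW (heq.ge (show (⟨z, hz⟩ : integralClosure v N) ∈ centerIntegralClosure h' from hc))
  simp only [mem_nonunits_iff_or, not_or, not_not] at hzW'
  have := W'.mul_mem _ _ hzW'.2 (mem_of_isIntegral h'.ge hzx)
  rwa [inv_mul_cancel_left₀ hzW'.1] at this

end Center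

open scoped Pointwise in
theorem HasSpecialRoots.eq_of_comap_eq [IsGalois K N] [FiniteDimensional K N]
    {v : ValuationSubring K} (hv : v.HasSpecialRoots (Module.finrank K N))
    {W W' : ValuationSubring N} (h : W.comap (algebraMap K N) = v)
    (h' : W'.comap (algebraMap K N) = v) : W = W' := by
  classical
  let B := integralClosure v N
  have : IsFractionRing B N := integralClosure.isFractionRing_of_finite_extension K N
  let := IsIntegralClosure.MulSemiringAction v K N B
  have := Algebra.isInvariant_of_isGalois v K N B
  have hcoe : ∀ (σ : Gal(N/K)) (b : B), ((σ • b : B) : N) = σ b :=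
    fun σ b ↦ algebraMap_galRestrict_apply v σ b
  have : SMulCommClass Gal(N/K) v B := ⟨fun σ a b ↦ map_smul (galRestrict v K N B σ) a b⟩
  let P : Ideal B := centerIntegralClosure h
  have hmax : ∀ σ : Gal(N/K), (σ • P).IsMaximal := fun σ ↦ by
    have : (σ • P).IsPrime := Ideal.IsPrime.smul σ
    refine Ideal.isMaximal_of_isIntegral_of_isMaximal_comap (R := v) _ ?_
    rw [← Ideal.under_def, Ideal.under_smul, under_centerIntegralClosure]
    infer_instance
  have hPmax : P.IsMaximal := by simpa using hmax 1
  have hfix : ∀ σ : Gal(N/K), σ • P = P := by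
    have hsup : P ⊔ ⨅ σ ∈ Finset.univ.filter fun σ : Gal(N/K) ↦ σ • P ≠ P, σ • P = ⊤ :=
      Ideal.sup_iInf_eq_top fun σ hσ ↦
        hPmax.coprime_of_ne (hmax σ) (Finset.mem_filter.1 hσ).2.symm
    obtain ⟨p, hp, x, hx, hpx⟩ := Submodule.mem_sup.1 ((Ideal.eq_top_iff_one _).1 hsup)
    simp only [Ideal.mem_iInf, Finset.mem_filter, Finset.mem_univ, true_and] at hx
    let Z := MulAction.stabilizer Gal(N/K) P
    let y : B := ∏ σ : Z, σ • x
    have hyZ : ∀ σ ∈ Z, σ • y = y := fun σ hσ ↦ Finset.smul_prod_perm (G := Z) x ⟨σ, hσ⟩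
    have hy1 : y - 1 ∈ P := by
      rw [← Ideal.Quotient.mk_eq_mk_iff_sub_mem, map_prod, map_one]
      refine Finset.prod_eq_one fun σ _ ↦ ?_
      rw [← map_one (Ideal.Quotient.mk P), Ideal.Quotient.mk_eq_mk_iff_sub_mem]
      have hx1 : x - 1 ∈ P := by
        rw [← hpx, sub_add_cancel_right]
        exact P.neg_mem hp
      have := Ideal.smul_mem_pointwise_smul (σ : Gal(N/K)) _ _ hx1
      rwa [smul_sub, smul_one, MulAction.mem_stabilizer_iff.1 σ.2] at this
    have hyP : ∀ σ ∉ Z, σ • y ∈ P := fun σ hσ ↦ by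
      rw [← Ideal.mem_inv_pointwise_smul_iff]
      have hdvd : x ∣ y := by
        simpa using Finset.dvd_prod_of_mem (fun σ : Z ↦ σ • x) (Finset.mem_univ 1)
      refine Ideal.mem_of_dvd _ hdvd (hx _ fun hc ↦ hσ ?_)
      rw [← inv_inv σ]
      exact inv_mem (MulAction.mem_stabilizer_iff.2 hc)
    obtain ⟨a, ha⟩ := hv.mem_range_algebraMap h (y := y) hy1 fun σ hσ ↦ by
      rw [← hcoe]
      exact hyP σ fun hc ↦ hσ (by rw [← hcoe, hyZ σ hc])
    intro σ
    by_contra hσ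
    have hσy : σ • y = y := Subtype.ext (by rw [hcoe, ← ha, AlgEquiv.commutes])
    have := sub_mem (hσy ▸ hyP σ hσ) hy1
    rw [sub_sub_cancel] at this
    exact hPmax.ne_top ((Ideal.eq_top_iff_one _).2 this)
  obtain ⟨σ, hσ⟩ := Algebra.IsInvariant.exists_smul_of_under_eq v B Gal(N/K) P
    (centerIntegralClosure h')
    ((under_centerIntegralClosure h).trans (under_centerIntegralClosure h').symm)
  rw [hfix] at hσ
  exact le_antisymm (le_of_centerIntegralClosure_eq h h' hσ.symm)
    (le_of_centerIntegralClosure_eq h' h hσ)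

end ValuationSubring

/-- let `(K, v)` be a valued field (`v : ValuationSubring K`, maximal ideal
given by `v.nonunits`).  If every polynomial `g = T^m + T^{m-1} + Σ_{i=0}^{m-2} a_i T^i`
with `m ≤ n!` and all `a_i` in the maximal ideal of `v` has a zero `x ∈ O_v` with
`x + 1` in the maximal ideal, then `v` extends uniquely to every Galois extension `N` of
`K` of degree at most `n`. -/
theorem unique_extension_of_special_polynomials_have_roots
    (n : ℕ) {K : Type*} [Field K] (v : ValuationSubring K)
    (hpoly : ∀ (g : Polynomial K) (m : ℕ), 1 ≤ m → m ≤ n.factorial →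
      g.Monic → g.natDegree = m → g.coeff (m - 1) = 1 →
      (∀ i, i + 2 ≤ m → g.coeff i ∈ v.nonunits) →
      ∃ x : K, x ∈ v ∧ g.IsRoot x ∧ (x + 1) ∈ v.nonunits) :
    ∀ (N : Type*) [Field N] [Algebra K N] [IsGalois K N] [FiniteDimensional K N],
      Module.finrank K N ≤ n →
      ∃! W : ValuationSubring N, W.comap (algebraMap K N) = v := by
  intro N _ _ _ _ hN
  have hv : v.HasSpecialRoots (Module.finrank K N) := fun g m hm hmd hg hdeg htop hlow ↦
    (hpoly g m hm (hmd.trans (hN.trans n.self_le_factorial)) hg hdeg htop hlow).imp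
      fun _ hx ↦ hx.2.1
  obtain ⟨W, hW⟩ := v.exists_comap_algebraMap_eq (N := N)
  exact ⟨W, hW, fun _ hW' ↦ hv.eq_of_comap_eq hW' hW⟩
end

section
/- Let (K,v) be a valued field and n ∈ ℕ. If v extends uniquely to every Galois extension N of K with [N:K] ≤ n!, then (K,v) is n≤-henselian: every monic f ∈ O_v[T] of degree at most n whose reduction has a simple zero a in the residue field admits a zero in O_v reducing to a. -/
/-- A valued field `(K, O)` is `n≤`-henselian if every monic polynomial over `O` of degree
at most `n` whose reduction has a simple zero in the residue field admits a root in `O`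
lifting that zero. -/
def NLeHenselian (n : ℕ) {K : Type*} [Field K] (O : ValuationSubring K) : Prop :=
  ∀ f : Polynomial O, f.Monic → f.natDegree ≤ n →
    ∀ a : IsLocalRing.ResidueField O,
      (f.map (IsLocalRing.residue O)).IsRoot a →
      ¬ (Polynomial.derivative (f.map (IsLocalRing.residue O))).IsRoot a →
      ∃ x : O, f.IsRoot x ∧ IsLocalRing.residue O x = a

open Polynomial in
/-- The splitting field of a separable polynomial has degree at most `(natDegree p)!`. -/
theorem Polynomial.Separable.finrank_splittingField_le {K : Type*} [Field K] {p : K[X]}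
    (hp : p.Separable) :
    Module.finrank K p.SplittingField ≤ p.natDegree.factorial := by
  have : Fact ((p.map (algebraMap K p.SplittingField)).Splits) := ⟨SplittingField.splits p⟩
  rw [← Gal.card_of_separable hp]
  have hcard : Nat.card (p.rootSet p.SplittingField) ≤ p.natDegree := by
    rw [Nat.card_coe_set_eq]
    exact ncard_rootSet_le p _
  calc Nat.card p.Gal ≤ Nat.card (Equiv.Perm (p.rootSet p.SplittingField)) :=
        Nat.card_le_card_of_injective _ (Gal.galActionHom_injective p p.SplittingField)
    _ = (Nat.card (p.rootSet p.SplittingField)).factorial := Nat.card_perm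
    _ ≤ _ := Nat.factorial_le hcard

open Polynomial in
/-- A monic polynomial over a domain whose image under a ring hom has a root is divisible by an
irreducible monic polynomial with the same property. -/
theorem Polynomial.Monic.exists_irreducible_dvd_isRoot {A k : Type*} [CommRing A] [IsDomain A]
    [CommRing k] [IsDomain k] (φ : A →+* k) {f : A[X]} (hf : f.Monic) {a : k}
    (ha : (f.map φ).IsRoot a) :
    ∃ g : A[X], g.Monic ∧ Irreducible g ∧ g ∣ f ∧ (g.map φ).IsRoot a := by
  classical
  have hex : ∃ m, ∃ g : A[X], g.Monic ∧ g ∣ f ∧ (g.map φ).IsRoot a ∧ g.natDegree = m :=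
    ⟨_, f, hf, dvd_rfl, ha, rfl⟩
  obtain ⟨g, hg, hgf, hga, hgd⟩ := Nat.find_spec hex
  have hmin : ∀ p : A[X], p.Monic → p ∣ g → (p.map φ).IsRoot a → g.natDegree ≤ p.natDegree :=
    fun p hp hpg hpa => hgd ▸ Nat.find_min' hex ⟨p, hp, hpg.trans hgf, hpa, rfl⟩
  refine ⟨g, hg, hg.irreducible_iff_natDegree.2 ⟨?_, ?_⟩, hgf, hga⟩
  · rintro rfl
    simp at hga
  · intro p q hp hq hpq
    have hdeg : p.natDegree + q.natDegree = g.natDegree := by rw [← hpq, hp.natDegree_mul hq]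
    have hroot : (p.map φ).IsRoot a ∨ (q.map φ).IsRoot a := by
      rw [← hpq, Polynomial.map_mul] at hga
      exact root_mul.1 hga
    rcases hroot with h | h
    · have := hmin p hp (hpq ▸ dvd_mul_right p q) h
      right; omega
    · have := hmin q hq (hpq ▸ dvd_mul_left q p) h
      left; omega

open Polynomial in
/-- Two roots of a polynomial over a domain with the same image under `ρ` agree, if the
derivative does not vanish there. -/
theorem Polynomial.IsRoot.eq_of_map_eq {B k : Type*} [CommRing B] [IsDomain B] [CommRing k]
    (ρ : B →+* k) {g : B[X]} {r s : B} (hr : g.IsRoot r) (hs : g.IsRoot s) (hrs : ρ r = ρ s)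
    (hd : ¬ (derivative (g.map ρ)).IsRoot (ρ r)) : r = s := by
  by_contra hne
  obtain ⟨q, rfl⟩ := dvd_iff_isRoot.2 hr
  have hq : q.IsRoot s := by
    have : (s - r) * q.eval s = 0 := by simpa using hs
    exact (mul_eq_zero.1 this).resolve_left (sub_ne_zero.2 (Ne.symm hne))
  have hq' : (q.map ρ).eval (ρ s) = 0 := by
    rw [eval_map_apply, hq.eq_zero, map_zero]
  apply hd
  simp [derivative_mul, hrs, hq']

open Polynomial in
/-- A root of a monic polynomial with coefficients in a valuation subring lies in it. -/
theorem ValuationSubring.mem_of_isRoot_map {N : Type*} [Field N] (W : ValuationSubring N)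
    {g : W[X]} (hg : g.Monic) {r : N} (hr : (g.map W.subtype).IsRoot r) : r ∈ W := by
  have hint : IsIntegral W r := ⟨g, hg, by rw [← hr.eq_zero, eval_map]; rfl⟩
  obtain ⟨y, rfl⟩ := IsIntegrallyClosed.isIntegral_iff.1 hint
  exact y.2

open Polynomial IsLocalRing in
/-- If a monic polynomial over a valuation ring splits over the field, then every root of its
reduction lifts to a root. -/
theorem ValuationSubring.exists_isRoot_residue_eq {N : Type*} [Field N] (W : ValuationSubring N)
    {g : W[X]} (hg : g.Monic) (hs : (g.map W.subtype).Splits) {a : ResidueField W}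
    (ha : (g.map (residue W)).IsRoot a) : ∃ r : W, g.IsRoot r ∧ residue W r = a := by
  obtain ⟨b, rfl⟩ := residue_surjective a
  have hb : W.valuation (g.eval b : W) < 1 := by
    rw [IsRoot, eval_map_apply, residue_eq_zero_iff] at ha
    exact (W.valuation_lt_one_iff _).1 ha
  have hprod : ((g.eval b : W) : N) =
      ((g.map W.subtype).roots.map ((b : N) - ·)).prod := by
    rw [← hs.eval_eq_prod_roots_of_monic (hg.map _)]
    exact (eval_map_apply W.subtype b).symm
  have hex : ∃ r ∈ (g.map W.subtype).roots, W.valuation ((b : N) - r) < 1 := by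
    by_contra! hall
    refine hb.ne ?_
    rw [hprod, map_multiset_prod, Multiset.map_map]
    refine Multiset.prod_eq_one fun x hx => ?_
    obtain ⟨r, hr, rfl⟩ := Multiset.mem_map.1 hx
    refine le_antisymm ((W.valuation_le_one_iff _).2 ?_) (hall r hr)
    exact sub_mem b.2 (W.mem_of_isRoot_map hg (isRoot_of_mem_roots hr))
  obtain ⟨r, hr, hbr⟩ := hex
  have hr' := isRoot_of_mem_roots hr
  lift r to W using W.mem_of_isRoot_map hg hr'
  refine ⟨r, ?_, ?_⟩
  · exact hr'.of_map (f := W.subtype) Subtype.val_injective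
  · rw [eq_comm, ← sub_eq_zero, ← map_sub, residue_eq_zero_iff]
    exact (W.valuation_lt_one_iff _).2 hbr

open Polynomial IsLocalRing in
/-- If `W` is the only valuation subring of the Galois extension `N` above `v`, and the monic
polynomial `g` over `v` splits in `N`, then simple roots of the reduction of `g` lift to `v`. -/
theorem ValuationSubring.exists_isRoot_of_existsUnique_comap {K N : Type*} [Field K] [Field N]
    [Algebra K N] [IsGalois K N] [FiniteDimensional K N] (v : ValuationSubring K)
    (hv : ∃! W : ValuationSubring N, W.comap (algebraMap K N) = v) {g : v[X]} (hg : g.Monic)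
    (hs : ((g.map v.subtype).map (algebraMap K N)).Splits) {a : ResidueField v}
    (ha : (g.map (residue v)).IsRoot a) (hd : ¬ (derivative (g.map (residue v))).IsRoot a) :
    ∃ x : v, g.IsRoot x ∧ residue v x = a := by
  obtain ⟨W, rfl, huniq⟩ := hv
  have hσ (σ : N ≃ₐ[K] N) : W.comap (σ : N →+* N) = W := by
    refine huniq _ ?_
    ext x
    simp [ValuationSubring.mem_comap]
  let φ : W.comap (algebraMap K N) →+* W :=
    ((algebraMap K N).comp (W.comap (algebraMap K N)).subtype).codRestrict W.toSubring fun x => x.2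
  have : IsLocalHom φ := by
    refine ⟨fun x hx => ?_⟩
    obtain ⟨y, hy⟩ := hx.exists_right_inv
    have hy' : algebraMap K N x * y = 1 := congrArg Subtype.val hy
    have hx0 : (x : K) ≠ 0 := by
      intro h
      simp [h] at hy'
    refine IsUnit.of_mul_eq_one ⟨(x : K)⁻¹, ?_⟩ (Subtype.ext (mul_inv_cancel₀ hx0))
    rw [ValuationSubring.mem_comap, map_inv₀, inv_eq_of_mul_eq_one_right hy']
    exact y.2
  have hres : (residue W).comp φ = (ResidueField.map φ).comp (residue _) := rfl
  have hmap : (g.map φ).map (residue W) = (g.map (residue _)).map (ResidueField.map φ) := by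
    rw [Polynomial.map_map, Polynomial.map_map, hres]
  have hsW : ((g.map φ).map W.subtype).Splits := by
    rw [Polynomial.map_map] at hs ⊢
    exact hs
  obtain ⟨r, hr, hra⟩ := W.exists_isRoot_residue_eq (hg.map φ) hsW (a := ResidueField.map φ a)
    (by rw [hmap]; exact ha.map)
  have hdW : ¬ (derivative ((g.map φ).map (residue W))).IsRoot (residue W r) := by
    rw [hmap, hra, derivative_map, IsRoot, eval_map_apply, map_eq_zero]
    exact hd
  have hfix (σ : N ≃ₐ[K] N) : σ r = r := by
    have hmem (z : N) : σ z ∈ W ↔ z ∈ W := by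
      conv_rhs => rw [← hσ σ]
      rfl
    let s : W := ⟨σ r, (hmem _).2 r.2⟩
    obtain ⟨b, rfl⟩ := residue_surjective a
    have hbr : φ b - r ∈ maximalIdeal W := by
      rw [← residue_eq_zero_iff, map_sub, hra, sub_eq_zero]
      rfl
    have hbs : φ b - s ∈ maximalIdeal W := by
      rw [← coe_mem_nonunits_iff, mem_nonunits_iff_or] at hbr ⊢
      have heq : ((φ b - s : W) : N) = σ ((φ b - r : W) : N) := by
        change algebraMap K N b - σ r = σ (algebraMap K N b - r)
        rw [map_sub, AlgEquiv.commutes]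
      rwa [heq, ← map_inv₀, hmem, map_eq_zero]
    have hsroot : (g.map φ).IsRoot s := by
      have hcomp : (σ : N →+* N).comp (W.subtype.comp φ) = W.subtype.comp φ :=
        RingHom.ext fun c => σ.commutes c
      refine IsRoot.of_map (f := W.subtype) ?_ Subtype.val_injective
      have hN : (g.map φ).eval₂ W.subtype (W.subtype r) = 0 := by
        rw [eval₂_at_apply, hr.eq_zero, map_zero]
      rw [eval₂_map] at hN
      have hσN := congrArg (σ : N →+* N) hN
      rw [hom_eval₂, hcomp, map_zero] at hσN
      rw [IsRoot, eval_map, eval₂_map]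
      exact hσN
    have hrs : residue W r = residue W s := by
      rw [← residue_eq_zero_iff, map_sub, sub_eq_zero] at hbr hbs
      rw [← hbr, hbs]
    exact (congrArg Subtype.val (hr.eq_of_map_eq (residue W) hsroot hrs hdW)).symm
  obtain ⟨x, hx⟩ := (IsGalois.mem_range_algebraMap_iff_fixed (r : N)).2 hfix
  let y : W.comap (algebraMap K N) := ⟨x, by rw [ValuationSubring.mem_comap, hx]; exact r.2⟩
  have hy : φ y = r := Subtype.ext hx
  have hφ : Function.Injective φ := fun p q h =>
    Subtype.ext ((algebraMap K N).injective (congrArg Subtype.val h))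
  refine ⟨y, ?_, ?_⟩
  · rw [← hy] at hr
    exact hr.of_map hφ
  · apply (ResidueField.map φ).injective
    rw [← hra, ← hy]
    rfl

/-- if a valuation `v` on `K` extends uniquely to every Galois extension of
`K` of degree at most `n!`, then `(K, v)` is `n≤`-henselian. -/
theorem nLeHenselian_of_unique_extension
    (n : ℕ) {K : Type} [Field K] (v : ValuationSubring K)
    (hext : ∀ (N : Type) [Field N] [Algebra K N] [IsGalois K N] [FiniteDimensional K N],
      Module.finrank K N ≤ n.factorial →
      ∃! W : ValuationSubring N, W.comap (algebraMap K N) = v) :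
    NLeHenselian n v := by
  intro f hf hfn a ha hd
  obtain ⟨g, hg, hirr, ⟨q, rfl⟩, hga⟩ := hf.exists_irreducible_dvd_isRoot _ ha
  have hgd : ¬ (Polynomial.derivative (g.map (IsLocalRing.residue v))).IsRoot a := by
    intro h
    apply hd
    rw [Polynomial.map_mul, Polynomial.derivative_mul, Polynomial.IsRoot, Polynomial.eval_add,
      Polynomial.eval_mul, Polynomial.eval_mul, h.eq_zero, hga.eq_zero]
    ring
  have hirrK : Irreducible (g.map v.subtype) :=
    (hg.irreducible_iff_irreducible_map_fraction_map (K := K)).1 hirr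
  have hsep : (g.map v.subtype).Separable := by
    rw [Polynomial.separable_iff_derivative_ne_zero hirrK, Polynomial.derivative_map]
    intro h
    have h0 : Polynomial.derivative g = 0 :=
      (Polynomial.map_eq_zero_iff Subtype.val_injective).1 h
    simp [Polynomial.derivative_map, h0] at hgd
  have hgn : g.natDegree ≤ n := by
    have hq : q.Monic := hg.of_mul_monic_left hf
    rw [hg.natDegree_mul hq] at hfn
    omega
  have := IsGalois.of_separable_splitting_field (F := K) (E := (g.map v.subtype).SplittingField)
    hsep
  have hdeg : Module.finrank K (g.map v.subtype).SplittingField ≤ n.factorial :=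
    hsep.finrank_splittingField_le.trans <| Nat.factorial_le <|
      Polynomial.natDegree_map_le.trans hgn
  obtain ⟨x, hx, hxa⟩ := v.exists_isRoot_of_existsUnique_comap (hext _ hdeg) hg
    (Polynomial.SplittingField.splits _) hga hgd
  exact ⟨x, Polynomial.root_mul_right_of_isRoot _ hx, hxa⟩
end

section
/- If a field K admits two independent nontrivial henselian valuations v and w (i.e. they have no common nontrivial coarsening), then K is separably closed. -/
open Polynomial IsLocalRing

theorem Polynomial.degree_sum_range_C_mul_X_pow_lt {R : Type*} [Semiring R] (n : ℕ) (a : ℕ → R) :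
    (∑ i ∈ Finset.range n, C (a i) * X ^ i).degree < (n : WithBot ℕ) := by
  rw [degree_lt_iff_coeff_zero]
  intro m hm
  simp [finsetSum_coeff, coeff_C_mul, coeff_X_pow, Nat.not_lt.2 hm]

/-- Newton's form of Hensel's lemma: an approximate root `r` of `f` such that `f(r)` is a multiple
of `f'(r)²` by an element of the maximal ideal can be refined to a root. -/
theorem HenselianLocalRing.exists_root_of_eval_eq_sq_mul {R : Type*} [CommRing R]
    [HenselianLocalRing R] (f : R[X]) (r t : R) (ht : t ∈ maximalIdeal R)
    (h : f.eval r = f.derivative.eval r ^ 2 * t) : ∃ x, f.eval x = 0 := by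
  set s := f.derivative.eval r with hs
  set n := f.natDegree
  set a := (taylor r f).coeff with ha
  have ha0 : a 0 = s ^ 2 * t := by rw [ha, taylor_coeff_zero, h]
  have ha1 : a 1 = s := by rw [ha, taylor_coeff_one]
  let S : R[X] := ∑ j ∈ Finset.range (n + 1), C (a (j + 2) * s ^ j * t ^ j) * X ^ (n - j)
  have hSdeg : S.natDegree ≤ n := by
    refine natDegree_sum_le_of_forall_le _ _ fun j _ => ?_
    exact (natDegree_C_mul_X_pow_le _ _).trans (Nat.sub_le _ _)
  -- The reciprocal polynomial of `z ↦ f (r + s t z) / (s² t)`.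
  let Q : R[X] := X ^ (n + 2) + (X ^ (n + 1) + C t * S)
  have hQ : Q.Monic := by
    refine monic_X_pow_add (degree_le_natDegree.trans_lt (Nat.cast_lt.2 ?_))
    refine (natDegree_add_le_of_degree_le (n := n + 1) (natDegree_X_pow_le _) ?_).trans_lt
      (Nat.lt_succ_self _)
    exact (natDegree_C_mul_le _ _).trans (hSdeg.trans (Nat.le_succ _))
  have hQeval : Q.eval (-1) ∈ maximalIdeal R := by
    have : Q.eval (-1) = t * S.eval (-1) := by
      simp only [Q, eval_add, eval_mul, eval_pow, eval_X, eval_C]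
      ring
    rw [this]
    exact Ideal.mul_mem_right _ _ ht
  have hQder : IsUnit (Q.derivative.eval (-1)) := by
    have : Q.derivative.eval (-1) = (-1) ^ (n + 1) + t * S.derivative.eval (-1) := by
      simp only [Q, derivative_add, derivative_mul, derivative_X_pow, derivative_C, eval_add,
        eval_mul, eval_pow, eval_X, eval_C, Nat.cast_add, Nat.cast_one, Nat.cast_ofNat,
        Nat.add_sub_cancel, zero_mul, zero_add,
        show n + 2 - 1 = n + 1 from rfl]
      ring
    rw [this]
    by_contra hnu
    have h1 : (-1 : R) ^ (n + 1) ∈ maximalIdeal R := by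
      have h2 := (mem_maximalIdeal _).2 hnu
      exact (Ideal.add_mem_iff_left _ (Ideal.mul_mem_right _ _ ht)).1 h2
    exact (mem_maximalIdeal _).1 h1 (isUnit_one.neg.pow _)
  obtain ⟨u, hu, hu1⟩ := HenselianLocalRing.is_henselian Q hQ (-1) hQeval hQder
  have huu : IsUnit u := by
    by_contra hnu
    have h2 := Ideal.sub_mem _ ((mem_maximalIdeal u).2 hnu) hu1
    rw [sub_sub_cancel] at h2
    exact (mem_maximalIdeal _).1 h2 isUnit_one.neg
  obtain ⟨z, hz⟩ := huu.exists_right_inv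
  refine ⟨s * t * z + r, ?_⟩
  have hdeg : (taylor r f).natDegree < n + 3 := by
    rw [natDegree_taylor]; omega
  rw [← taylor_eval, eval_eq_sum_range' hdeg, ← ha, Finset.sum_range_succ', Finset.sum_range_succ',
    ha0, ha1]
  have hS : S.eval u * z ^ n = ∑ j ∈ Finset.range (n + 1), a (j + 2) * s ^ j * t ^ j * z ^ j := by
    simp only [S, eval_finsetSum, eval_mul, eval_C, eval_pow, eval_X, Finset.sum_mul]
    refine Finset.sum_congr rfl fun j hj => ?_
    have hjn : j ≤ n := Nat.lt_succ_iff.1 (Finset.mem_range.1 hj)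
    obtain ⟨m, hm⟩ := Nat.exists_eq_add_of_le hjn
    have huz : u ^ m * z ^ m = 1 := by rw [← mul_pow, hz, one_pow]
    rw [hm, Nat.add_sub_cancel_left, pow_add]
    linear_combination (a (j + 2) * s ^ j * t ^ j * z ^ j) * huz
  have hQu : u ^ (n + 2) + (u ^ (n + 1) + t * S.eval u) = 0 := by
    simpa [Q, IsRoot] using hu
  have huz : u ^ n * z ^ n = 1 := by rw [← mul_pow, hz, one_pow]
  have hsum : ∑ j ∈ Finset.range (n + 1), a (j + 1 + 1) * (s * t * z) ^ (j + 1 + 1)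
      = s ^ 2 * t ^ 2 * z ^ 2 * (S.eval u * z ^ n) := by
    rw [hS, Finset.mul_sum]
    refine Finset.sum_congr rfl fun j _ => ?_
    ring
  have key : 1 + z + t * z ^ 2 * (S.eval u * z ^ n) = 0 := by
    have h1 : u ^ (n + 2) * z ^ (n + 2) = 1 := by rw [← mul_pow, hz, one_pow]
    have h2 : u ^ (n + 1) * z ^ (n + 1) = 1 := by rw [← mul_pow, hz, one_pow]
    linear_combination z ^ (n + 2) * hQu - h1 - z * h2
  rw [hsum]
  linear_combination s ^ 2 * t * key

/-- If no proper overring contains both `v` and `w`, then no nonzero multiple of `v` is contained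
in a multiple of `w`. -/
theorem ValuationSubring.exists_mem_smul_notMem_smul {K : Type*} [Field K]
    (v w : ValuationSubring K) (hw : ∃ x : K, x ∉ w)
    (hindep : ∀ u : ValuationSubring K, v ≤ u → w ≤ u → ∀ x : K, x ∈ u)
    {e : K} (he : e ≠ 0) : ∃ y ∈ v, e * y ∉ w := by
  by_contra! hcon
  let T : Subring K :=
    { carrier := {x | ∀ j, (∀ a ∈ v, j * a ∈ w) → ∀ a ∈ v, x * j * a ∈ w}
      mul_mem' := by
        intro x y hx hy j hj a ha
        rw [mul_assoc x y j]
        exact hx _ (hy j hj) a ha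
      one_mem' := by
        intro j hj a ha
        simpa using hj a ha
      add_mem' := by
        intro x y hx hy j hj a ha
        rw [add_mul, add_mul]
        exact w.add_mem _ _ (hx j hj a ha) (hy j hj a ha)
      zero_mem' := by
        intro j hj a ha
        simp
      neg_mem' := by
        intro x hx j hj a ha
        rw [neg_mul, neg_mul]
        exact w.neg_mem _ (hx j hj a ha) }
  have hvT : v.toSubring ≤ T := by
    intro x hx j hj a ha
    rw [mul_comm x j, mul_assoc]
    exact hj _ (v.mul_mem _ _ hx ha)
  have hwT : w.toSubring ≤ T := by
    intro x hx j hj a ha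
    rw [mul_assoc]
    exact w.mul_mem _ _ hx (hj a ha)
  obtain ⟨x, hx⟩ := hw
  have hmem : x * e⁻¹ ∈ T := hindep (ValuationSubring.ofLE v T hvT) hvT hwT (x * e⁻¹)
  have := hmem e hcon 1 v.one_mem
  rw [mul_assoc x, inv_mul_cancel₀ he] at this
  exact hx (by simpa using this)

/-- Weak approximation for two independent valuations. -/
theorem ValuationSubring.exists_approx {K : Type*} [Field K]
    (v w : ValuationSubring K) (hv : ∃ x : K, x ∉ v) (hw : ∃ x : K, x ∉ w)
    (hindep : ∀ u : ValuationSubring K, v ≤ u → w ≤ u → ∀ x : K, x ∈ u)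
    (a b : K) {e : K} (he : e ≠ 0) :
    ∃ z : K, ∃ q ∈ v, z = a + e * q ∧ w.valuation (z - b) < 1 := by
  rcases eq_or_ne b a with rfl | hba
  · exact ⟨b, 0, v.zero_mem, by simp, by simp⟩
  obtain ⟨x, hx⟩ := hv
  have hx0 : x ≠ 0 := by rintro rfl; exact hx v.zero_mem
  have hxv : v.valuation x⁻¹ < 1 := by
    rw [map_inv₀]
    exact inv_lt_one_of_one_lt₀ (not_le.1 fun h => hx ((v.valuation_le_one_iff x).1 h))
  have hc : b - a ≠ 0 := sub_ne_zero.2 hba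
  -- `e'` has valuation smaller than both `1` and `e / (b - a)`.
  obtain ⟨e', he'0, he', m, hm, hme⟩ : ∃ e' : K, e' ≠ 0 ∧ v.valuation e' < 1 ∧
      ∃ m ∈ v, (b - a) * e' = e * m := by
    have hxm : x⁻¹ ∈ v := (v.valuation_le_one_iff _).1 hxv.le
    rcases v.mem_or_inv_mem (e / (b - a)) with h | h
    · refine ⟨x⁻¹ * (e / (b - a)), by positivity, ?_, x⁻¹, hxm, by field_simp⟩
      rw [map_mul]
      exact mul_lt_one_of_lt_of_le hxv ((v.valuation_le_one_iff _).2 h)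
    · exact ⟨x⁻¹, by positivity, hxv, x⁻¹ * (e / (b - a))⁻¹, v.mul_mem _ _ hxm h, by field_simp⟩
  obtain ⟨l, hl0, hl1, hlc⟩ : ∃ l : K, l ≠ 0 ∧ 1 ≤ w.valuation l ∧
      w.valuation (b - a) ≤ w.valuation l := by
    rcases le_total (w.valuation (b - a)) 1 with h | h
    · exact ⟨1, one_ne_zero, by simp, by simpa using h⟩
    · exact ⟨b - a, hc, h, le_rfl⟩
  obtain ⟨p, hp, hpw⟩ := v.exists_mem_smul_notMem_smul w hw hindep (div_ne_zero he'0 hl0)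
  set y := e' * p with hy
  have hyv : v.valuation y < 1 := by
    rw [hy, map_mul]
    exact mul_lt_one_of_lt_of_le he' ((v.valuation_le_one_iff _).2 hp)
  have hyl : w.valuation l < w.valuation y := by
    have h1 : 1 < w.valuation (e' / l * p) :=
      not_le.1 fun h => hpw ((w.valuation_le_one_iff _).1 h)
    have h2 : y = e' / l * p * l := by rw [hy]; field_simp
    rw [h2, map_mul]
    exact lt_mul_of_one_lt_left ((Valuation.pos_iff _).2 hl0) h1
  have h1y : v.valuation (1 + y) = 1 := v.valuation.map_one_add_of_lt hyv
  have hyne : 1 + y ≠ 0 := by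
    intro h
    rw [h, map_zero] at h1y
    exact zero_ne_one h1y
  have hy1 : w.valuation 1 < w.valuation y := by
    rw [map_one]
    exact hl1.trans_lt hyl
  have hwy : w.valuation (1 + y) = w.valuation y := w.valuation.map_add_eq_of_lt_right hy1
  refine ⟨a + (b - a) * (y / (1 + y)), m * p * (1 + y)⁻¹, ?_, ?_, ?_⟩
  · refine v.mul_mem _ _ (v.mul_mem _ _ hm hp) ((v.valuation_le_one_iff _).1 ?_)
    rw [map_inv₀, h1y, inv_one]
  · rw [hy, ← mul_assoc, ← mul_assoc, ← hme]
    ring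
  · have : a + (b - a) * (y / (1 + y)) - b = -((b - a) / (1 + y)) := by
      field_simp
      ring
    rw [this, Valuation.map_neg, map_div₀, hwy]
    exact (div_lt_one₀ ((Valuation.pos_iff _).2 hl0 |>.trans hyl)).2 (hlc.trans_lt hyl)

/-- Over two independent nontrivial henselian valuation rings `v` and `w`, a monic polynomial over
`v` of degree at least `2` that is separable over the fraction field has a root: it is `v`-close to
a polynomial with a simple root modulo the maximal ideal of `w`. -/
theorem ValuationSubring.exists_root_of_bezout {K : Type*} [Field K] (v w : ValuationSubring K)
    [HenselianLocalRing v] [HenselianLocalRing w]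
    (hv : ∃ x : K, x ∉ v) (hw : ∃ x : K, x ∉ w)
    (hindep : ∀ u : ValuationSubring K, v ≤ u → w ≤ u → ∀ x : K, x ∈ u)
    (f A B : v[X]) (d : v) (hd : d ≠ 0) (hf : f.Monic) (hn : 2 ≤ f.natDegree)
    (hbez : A * f + B * derivative f = C d) : ∃ x, f.eval x = 0 := by
  obtain ⟨x, hx⟩ := id hv
  have hx0 : x ≠ 0 := by rintro rfl; exact hx v.zero_mem
  have hxv : v.valuation x⁻¹ < 1 := by
    rw [map_inv₀]
    exact inv_lt_one_of_one_lt₀ (not_le.1 fun h => hx ((v.valuation_le_one_iff x).1 h))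
  let t : v := ⟨x⁻¹, (v.valuation_le_one_iff _).1 hxv.le⟩
  have ht : t ∈ maximalIdeal v := (v.valuation_lt_one_iff t).2 hxv
  have ht0 : t ≠ 0 := fun h => inv_ne_zero hx0 (congrArg Subtype.val h)
  have he : ((d ^ 2 * t : v) : K) ≠ 0 := by
    simpa using mul_ne_zero (pow_ne_zero 2 hd) ht0
  choose z q hqv hz hzw using fun i : ℕ =>
    v.exists_approx w hv hw hindep (f.coeff i : K) (if i = 1 then 1 else 0) he
  have hz1 : w.valuation (z 1) = 1 := by
    have h1 := hzw 1
    rw [if_pos rfl] at h1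
    have := w.valuation.map_one_add_of_lt h1
    rwa [add_sub_cancel] at this
  have hz' : ∀ i ≠ 1, w.valuation (z i) < 1 := by
    intro i hi
    simpa [hi] using hzw i
  have hzmem : ∀ i, z i ∈ w := by
    intro i
    rw [← w.valuation_le_one_iff]
    by_cases hi : i = 1
    · rw [hi, hz1]
    · exact (hz' i hi).le
  set n := f.natDegree with hn_def
  let g : w[X] := X ^ n + ∑ i ∈ Finset.range n, C (⟨z i, hzmem i⟩ : w) * X ^ i
  have hg : g.Monic := monic_X_pow_add (degree_sum_range_C_mul_X_pow_lt n _)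
  have hgcoeff : ∀ i < n, g.coeff i = ⟨z i, hzmem i⟩ := by
    intro i hi
    simp [g, coeff_X_pow, hi.ne, finsetSum_coeff, coeff_C_mul, hi]
  have hg0 : g.eval 0 ∈ maximalIdeal w := by
    rw [← coeff_zero_eq_eval_zero, hgcoeff 0 (by omega)]
    exact (w.valuation_lt_one_iff _).2 (hz' 0 zero_ne_one)
  have hg1 : IsUnit (g.derivative.eval 0) := by
    rw [← coeff_zero_eq_eval_zero, coeff_derivative, hgcoeff (0 + 1) (by omega)]
    simpa using (w.valuation_eq_one_iff _).2 hz1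
  obtain ⟨ρ, hρ, -⟩ := HenselianLocalRing.is_henselian g hg 0 hg0 hg1
  have hρK : (ρ : K) ^ n + ∑ i ∈ Finset.range n, z i * (ρ : K) ^ i = 0 := by
    have := congrArg (algebraMap w K) hρ
    simpa [g, eval_finsetSum] using this
  let H : v[X] := ∑ i ∈ Finset.range n, C (⟨q i, hqv i⟩ : v) * X ^ i
  have hHdeg : (C (d ^ 2 * t) * H).degree < f.degree := by
    rw [degree_eq_natDegree hf.ne_zero, ← smul_eq_C_mul]
    exact (degree_smul_le _ _).trans_lt (degree_sum_range_C_mul_X_pow_lt _ _)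
  have hG : aeval (ρ : K) (f + C (d ^ 2 * t) * H) = 0 := by
    rw [← hρK]
    conv_lhs => rw [hf.as_sum]
    simp only [H, map_add, map_mul, map_sum, aeval_C, aeval_X, map_pow, Finset.mul_sum, add_assoc,
      ← Finset.sum_add_distrib, ← hn_def]
    congr 1
    refine Finset.sum_congr rfl fun i _ => ?_
    rw [hz i]
    change (f.coeff i : K) * _ + (d : K) ^ 2 * (t : K) * (q i * _) = _
    push_cast
    ring
  have hint : IsIntegral v (ρ : K) := ⟨_, hf.add_of_left hHdeg, hG⟩
  obtain ⟨r, hr⟩ := IsIntegrallyClosed.isIntegral_iff.1 hint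
  rw [← hr, aeval_algebraMap_apply, map_eq_zero_iff _ (IsFractionRing.injective v K)] at hG
  have hfr : f.eval r = -(d ^ 2 * t * H.eval r) := by
    have : f.eval r + d ^ 2 * t * H.eval r = 0 := by simpa using hG
    linear_combination this
  have hbr : A.eval r * f.eval r + B.eval r * (derivative f).eval r = d := by
    simpa using congrArg (eval r) hbez
  -- It follows that the derivative of `f` at `r` divides `d`.
  have hunit : IsUnit (1 + A.eval r * (d * t * H.eval r)) := by
    by_contra hnu
    have hm : A.eval r * (d * t * H.eval r) ∈ maximalIdeal v :=
      Ideal.mul_mem_left _ _ (Ideal.mul_mem_right _ _ (Ideal.mul_mem_left _ _ ht))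
    exact (mem_maximalIdeal _).1 ((Ideal.add_mem_iff_left _ hm).1 ((mem_maximalIdeal _).2 hnu))
      isUnit_one
  obtain ⟨k, hk⟩ := hunit.exists_right_inv
  have hd' : d = (derivative f).eval r * (B.eval r * k) := by
    rw [hfr] at hbr
    linear_combination (-d) * hk - k * hbr
  refine HenselianLocalRing.exists_root_of_eval_eq_sq_mul f r
    (t * -((B.eval r * k) ^ 2 * H.eval r)) (Ideal.mul_mem_right _ _ ht) ?_
  rw [hfr]
  linear_combination (-(t * H.eval r)) * (d + (derivative f).eval r * (B.eval r * k)) * hd'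

/-- if a field `K` admits two independent nontrivial henselian valuations
(i.e. they have no common nontrivial coarsening: every common coarsening is the trivial
valuation ring `K` itself), then `K` is separably closed. -/
theorem sepClosed_of_two_independent_henselian
    {K : Type*} [Field K] (v w : ValuationSubring K)
    [HenselianLocalRing v] [HenselianLocalRing w]
    (hv : ∃ x : K, x ∉ v) (hw : ∃ x : K, x ∉ w)
    (hindep : ∀ u : ValuationSubring K, v ≤ u → w ≤ u → ∀ x : K, x ∈ u) :
    IsSepClosed K := by
  rw [← IsSepClosed.separableClosure_eq_bot_iff (F := K) (E := AlgebraicClosure K), eq_bot_iff]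
  intro x hx
  have halg : IsAlgebraic v x :=
    (IsFractionRing.isAlgebraic_iff v K (AlgebraicClosure K)).2 (Algebra.IsAlgebraic.isAlgebraic x)
  obtain ⟨d, hd, hint⟩ := halg.exists_integral_multiple
  set y := d • x with hy
  have hyx : y = algebraMap K (AlgebraicClosure K) d * x := by
    rw [hy, Algebra.smul_def]; rfl
  have hysep : y ∈ separableClosure K (AlgebraicClosure K) := by
    rw [hyx]
    exact mul_mem (algebraMap_mem _ _) hx
  have hmin : minpoly K y = (minpoly v y).map (algebraMap v K) :=
    minpoly.isIntegrallyClosed_eq_field_fractions' K hint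
  have hsep : (minpoly K y).Separable := mem_separableClosure_iff.1 hysep
  suffices hyK : y ∈ (⊥ : IntermediateField K (AlgebraicClosure K)) by
    have hd' : algebraMap K (AlgebraicClosure K) d ≠ 0 := by simpa using hd
    have : x = (algebraMap K (AlgebraicClosure K) d)⁻¹ * y := by
      rw [hyx, inv_mul_cancel_left₀ hd']
    rw [this]
    exact mul_mem (inv_mem (algebraMap_mem _ _)) hyK
  have hmon := minpoly.monic hint
  rw [IntermediateField.mem_bot]
  change y ∈ (algebraMap K (AlgebraicClosure K)).range
  rw [← minpoly.natDegree_eq_one_iff]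
  have hpos := minpoly.natDegree_pos (hint.tower_top (A := K))
  by_contra hne
  have hn : 2 ≤ (minpoly v y).natDegree := by
    rw [← hmon.natDegree_map (algebraMap v K), ← hmin]; omega
  obtain ⟨a, b, hab⟩ := hsep
  obtain ⟨c, hc, hA⟩ := IsLocalization.integerNormalization_spec (nonZeroDivisors v) a
  obtain ⟨e, he, hB⟩ := IsLocalization.integerNormalization_spec (nonZeroDivisors v) b
  set A := IsLocalization.integerNormalization (nonZeroDivisors v) a
  set B := IsLocalization.integerNormalization (nonZeroDivisors v) b
  have hinj : Function.Injective (algebraMap v K) := IsFractionRing.injective v K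
  obtain ⟨r, hr⟩ := v.exists_root_of_bezout w hv hw hindep (minpoly v y) (C e * A) (C c * B) (c * e)
    (mul_ne_zero (nonZeroDivisors.ne_zero hc) (nonZeroDivisors.ne_zero he)) hmon hn (by
      apply map_injective _ hinj
      rw [hmin, derivative_map] at hab
      simp only [Polynomial.map_add, Polynomial.map_mul, map_C, hA, hB, map_mul]
      rw [algebra_compatible_smul K c, algebra_compatible_smul K e, smul_eq_C_mul, smul_eq_C_mul]
      linear_combination C (algebraMap v K c) * C (algebraMap v K e) * hab)
  have hroot : (minpoly K y).IsRoot (algebraMap v K r) := by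
    rw [hmin]
    exact IsRoot.map hr
  exact hne (natDegree_eq_of_degree_eq_some
    (degree_eq_one_of_irreducible_of_root (minpoly.irreducible hint.tower_top) hroot))
end

section
/- Let K be a field and let v₂ be a henselian valuation on K whose residue field is separably closed, and v₁ a henselian valuation on K whose residue field is not separably closed. Then O_{v₂} ⊊ O_{v₁}, i.e. v₂ is strictly finer than v₁, unless K is separably closed. -/
namespace Polynomial

theorem Monic.separable_of_separable_map_residue {R : Type*} [CommRing R] [IsLocalRing R]
    {f : R[X]} (hf : f.Monic) (hs : (f.map (IsLocalRing.residue R)).Separable) :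
    f.Separable := by
  have hm := hf.map (IsLocalRing.residue R)
  have hle : (derivative (f.map (IsLocalRing.residue R))).natDegree ≤
      (derivative f).natDegree := by
    rw [derivative_map]
    exact natDegree_map_le
  obtain ⟨k, hk⟩ := Nat.exists_eq_add_of_le hle
  rw [separable_def, ← isUnit_resultant_iff_isCoprime hf]
  rw [separable_def, ← isUnit_resultant_iff_isCoprime hm] at hs
  refine isUnit_of_map_unit (IsLocalRing.residue R) _ ?_
  rw [← resultant_map_map, ← derivative_map, hk, resultant_add_right_deg _ _ _ _ _ le_rfl,
    ← hf.natDegree_map (IsLocalRing.residue R), hm.coeff_natDegree, one_pow, one_mul]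
  exact hs

end Polynomial

namespace ValuationSubring

open Polynomial IsLocalRing

variable {K : Type*} [Field K]

theorem exists_isRoot_of_eval₂_eq_zero (v : ValuationSubring K) {f : v[X]} (hf : f.Monic)
    {x : K} (hx : f.eval₂ v.subtype x = 0) : ∃ a : v, f.IsRoot a := by
  have hint : IsIntegral v x := ⟨f, hf, hx⟩
  obtain ⟨a, rfl⟩ := IsIntegrallyClosed.isIntegral_iff.mp hint
  refine ⟨a, v.subtype_injective ?_⟩
  rw [map_zero, ← hx]
  exact (eval₂_at_apply v.subtype a).symm

theorem isSepClosed_residueField_of_le {v w : ValuationSubring K} [HenselianLocalRing w]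
    (hvw : v ≤ w) [IsSepClosed (ResidueField w)] : IsSepClosed (ResidueField v) := by
  refine IsSepClosed.of_exists_root _ fun p hp hirr hsep => ?_
  obtain ⟨f, rfl, -, hf⟩ := lifts_and_natDegree_eq_and_monic
    (mem_lifts_of_surjective residue_surjective p) hp
  have hfs := hf.separable_of_separable_map_residue hsep
  let i : v →+* w := inclusion v w hvw
  have hdeg : ((f.map i).map (residue w)).degree ≠ 0 := by
    rw [((hf.map i).degree_map _), hf.degree_map, ← hf.degree_map (residue v)]
    exact hirr.degree_pos.ne'
  obtain ⟨b, hb⟩ := IsSepClosed.exists_root _ hdeg hfs.map.map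
  obtain ⟨b, rfl⟩ := residue_surjective b
  have hb' : (f.map i).eval b ∈ maximalIdeal w := by
    rw [← residue_eq_zero_iff, ← eval_map_apply]
    exact hb
  have hd : IsUnit ((derivative (f.map i)).eval b) := by
    rw [← residue_ne_zero_iff_isUnit, ← eval_map_apply, ← derivative_map]
    exact hfs.map.map.eval₂_derivative_ne_zero (RingHom.id _) hb
  obtain ⟨c, hc, -⟩ := HenselianLocalRing.is_henselian _ (hf.map i) b hb' hd
  obtain ⟨a, ha⟩ := v.exists_isRoot_of_eval₂_eq_zero hf (x := c) <| by
    have : (f.map i).eval₂ w.subtype c = 0 := by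
      rw [← w.subtype_apply, eval₂_at_apply, hc.eq_zero, map_zero]
    rwa [eval₂_map] at this
  exact ⟨residue v a, by rw [eval_map_apply, ha.eq_zero, map_zero]⟩

theorem exists_mem_valuation_sub_one_lt_one {v w : ValuationSubring K}
    (hvw : ¬ v ≤ w) (hwv : ¬ w ≤ v) :
    ∃ e : K, e ∈ v ∧ e ∈ w ∧ v.valuation (e - 1) < 1 ∧ w.valuation e < 1 := by
  obtain ⟨x, hxv, hxw⟩ := SetLike.not_le_iff_exists.mp hvw
  obtain ⟨y, hyw, hyv⟩ := SetLike.not_le_iff_exists.mp hwv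
  rw [← valuation_le_one_iff] at hxv hyw
  rw [← valuation_le_one_iff, not_le] at hxw hyv
  have hy : y ≠ 0 := by
    rintro rfl
    simp at hyv
  have htv : v.valuation (x / y) < 1 := by
    rw [map_div₀]
    exact (div_lt_one₀ (zero_lt_one.trans hyv)).mpr (hxv.trans_lt hyv)
  have htw : 1 < w.valuation (x / y) := by
    rw [map_div₀]
    exact (one_lt_div₀ (zero_lt_iff.mpr (by simpa using hy))).mpr (hyw.trans_lt hxw)
  have hsv : v.valuation (1 + x / y) = 1 := Valuation.map_one_add_of_lt _ htv
  have hsw : w.valuation (1 + x / y) = w.valuation (x / y) :=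
    by
    rw [Valuation.map_add_eq_of_lt_right]
    rwa [map_one]
  have hs : 1 + x / y ≠ 0 := by
    intro h
    simp [h] at hsv
  have hew : w.valuation (1 + x / y)⁻¹ < 1 := by
    rw [map_inv₀, hsw]
    exact inv_lt_one_of_one_lt₀ htw
  refine ⟨(1 + x / y)⁻¹, ?_, ?_, ?_, hew⟩
  · rw [← valuation_le_one_iff, map_inv₀, hsv, inv_one]
  · exact (valuation_le_one_iff _ _).mp hew.le
  · have : (1 + x / y)⁻¹ - 1 = -((x / y) / (1 + x / y)) := by
      rw [eq_neg_iff_add_eq_zero, inv_eq_one_div, sub_add_eq_add_sub, ← add_div, div_self hs,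
        sub_self]
    rwa [this, Valuation.map_neg, map_div₀, hsv, div_one]

theorem exists_mem_valuation_sub_lt_one {v w : ValuationSubring K}
    (hvw : ¬ v ≤ w) (hwv : ¬ w ≤ v) {a : K} (ha : a ∈ v) :
    ∃ b : K, b ∈ v ∧ b ∈ w ∧ v.valuation (b - a) < 1 := by
  obtain ⟨e, -, -, hev, hew⟩ := exists_mem_valuation_sub_one_lt_one hvw hwv
  by_cases haw : a ∈ w
  · exact ⟨a, ha, haw, by simp⟩
  rw [← valuation_le_one_iff] at ha
  rw [← valuation_le_one_iff, not_le] at haw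
  rcases ha.lt_or_eq with ha | ha
  · exact ⟨0, v.zero_mem, w.zero_mem, by simpa [Valuation.map_neg] using ha⟩
  have ha0 : a ≠ 0 := by
    rintro rfl
    simp at ha
  set s := a⁻¹ + (1 - e) with hs
  have hsv : v.valuation s = 1 := by
    rw [hs, Valuation.map_add_eq_of_lt_left, map_inv₀, ha, inv_one]
    rwa [map_inv₀, ha, inv_one, Valuation.map_sub_swap]
  have hsw : w.valuation s = 1 := by
    have h : w.valuation (a⁻¹ - e) < 1 :=
      Valuation.map_sub_lt _ (by rw [map_inv₀]; exact inv_lt_one_of_one_lt₀ haw) hew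
    rw [hs, show a⁻¹ + (1 - e) = 1 + (a⁻¹ - e) by ring]
    exact Valuation.map_one_add_of_lt _ h
  have hs0 : s ≠ 0 := by
    intro h
    simp [h] at hsv
  refine ⟨s⁻¹, ?_, ?_, ?_⟩
  · rw [← valuation_le_one_iff, map_inv₀, hsv, inv_one]
  · rw [← valuation_le_one_iff, map_inv₀, hsw, inv_one]
  · have h : s⁻¹ - a = a * (e - 1) * s⁻¹ := by
      have : a * s = 1 + a * (1 - e) := by rw [hs, mul_add, mul_inv_cancel₀ ha0]
      field_simp
      linear_combination -this
    rwa [h, map_mul, map_mul, map_inv₀, ha, hsv, inv_one, one_mul, mul_one]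

theorem isSepClosed_residueField_of_not_le {v w : ValuationSubring K} [HenselianLocalRing w]
    (hvw : ¬ v ≤ w) (hwv : ¬ w ≤ v) : IsSepClosed (ResidueField v) := by
  refine IsSepClosed.of_exists_root _ fun p hp hirr _ => ?_
  let B : Subring K := v.toSubring ⊓ w.toSubring
  let i : B →+* v := Subring.inclusion inf_le_left
  let j : B →+* w := Subring.inclusion inf_le_right
  have hi : Function.Surjective ((residue v).comp i) := by
    intro y
    obtain ⟨a, rfl⟩ := residue_surjective y
    obtain ⟨b, hbv, hbw, hb⟩ := exists_mem_valuation_sub_lt_one hvw hwv a.2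
    refine ⟨⟨b, hbv, hbw⟩, ?_⟩
    rw [← sub_eq_zero, RingHom.comp_apply, ← map_sub, residue_eq_zero_iff, valuation_lt_one_iff]
    exact hb
  obtain ⟨e, he1, he2⟩ : ∃ e : B, residue v (i e) = 1 ∧ residue w (j e) = 0 := by
    obtain ⟨e, hev, hew, h1, h2⟩ := exists_mem_valuation_sub_one_lt_one hvw hwv
    refine ⟨⟨e, hev, hew⟩, ?_, ?_⟩
    · rw [← sub_eq_zero, ← map_one (residue v), ← map_sub, residue_eq_zero_iff,
        valuation_lt_one_iff]
      exact h1
    · rw [residue_eq_zero_iff, valuation_lt_one_iff]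
      exact h2
  obtain ⟨f, rfl, -, hf⟩ := lifts_and_natDegree_eq_and_monic (mem_lifts_of_surjective hi p) hp
  obtain ⟨n, hn⟩ : ∃ n, f.natDegree = n + 1 := by
    refine Nat.exists_eq_succ_of_ne_zero ?_
    rw [← hf.natDegree_map ((residue v).comp i)]
    exact hirr.natDegree_pos.ne'
  let g : B[X] := X ^ (n + 1) - X ^ n
  -- `h` reduces to `p` modulo `v` and to `X ^ (n + 1) - X ^ n` modulo `w`
  let h : B[X] := g + C e * (f - g)
  have hg : g.Monic := monic_X_pow_sub (by simpa using mod_cast n.lt_succ_self)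
  have hgn : g.degree = (n + 1 : ℕ) := by
    rw [degree_sub_eq_left_of_degree_lt] <;> simp only [degree_X_pow]
    exact mod_cast n.lt_succ_self
  have hfn : f.degree = (n + 1 : ℕ) := by rw [degree_eq_natDegree hf.ne_zero, hn]
  have hlt : (f - g).degree < g.degree := by
    rw [← neg_sub, degree_neg]
    exact degree_sub_lt_left (hgn.trans hfn.symm) hg.ne_zero
      (by rw [hf.leadingCoeff, hg.leadingCoeff])
  have hle : (C e * (f - g)).degree ≤ (f - g).degree := by
    rw [← smul_eq_C_mul]
    exact degree_smul_le e _
  have hh : h.Monic := hg.add_of_left (hle.trans_lt hlt)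
  have hhv : (h.map i).map (residue v) = f.map ((residue v).comp i) := by
    simp [h, Polynomial.map_map, he1]
  have hhw : (h.map j).map (residue w) = X ^ (n + 1) - X ^ n := by
    simp [h, g, he2]
  have h0 : (h.map j).eval 1 ∈ maximalIdeal w := by
    rw [← residue_eq_zero_iff, ← eval_map_apply, hhw]
    simp
  have h1 : IsUnit ((derivative (h.map j)).eval 1) := by
    rw [← residue_ne_zero_iff_isUnit, ← eval_map_apply, ← derivative_map, hhw]
    simp [derivative_X_pow]
  obtain ⟨c, hc, -⟩ := HenselianLocalRing.is_henselian _ (hh.map j) 1 h0 h1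
  obtain ⟨a, ha⟩ := v.exists_isRoot_of_eval₂_eq_zero (hh.map i) (x := c) <| by
    have : (h.map j).eval₂ w.subtype c = 0 := by
      rw [← w.subtype_apply, eval₂_at_apply, hc.eq_zero, map_zero]
    rw [eval₂_map] at this ⊢
    exact this
  exact ⟨residue v a, by rw [← hhv, eval_map_apply, ha.eq_zero, map_zero]⟩

end ValuationSubring

/-- on a field `K` which is not separably closed, any henselian valuation
`v₂` with separably closed residue field is strictly finer than any henselian valuation
`v₁` whose residue field is not separably closed: `O_{v₂} ⊊ O_{v₁}`. -/
theorem H2_strictly_finer_than_H1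
    {K : Type*} [Field K] (hK : ¬ IsSepClosed K)
    (v₁ v₂ : ValuationSubring K)
    [HenselianLocalRing v₁] [HenselianLocalRing v₂]
    (h₁ : ¬ IsSepClosed (IsLocalRing.ResidueField v₁))
    (h₂ : IsSepClosed (IsLocalRing.ResidueField v₂)) :
    v₂ < v₁ := by
  have h₁₂ : ¬ v₁ ≤ v₂ := fun h => h₁ (ValuationSubring.isSepClosed_residueField_of_le h)
  by_contra h
  exact h₁ (ValuationSubring.isSepClosed_residueField_of_not_le h₁₂ fun h' => h ⟨h', h₁₂⟩)
end

section
/- Let K be a field of characteristic zero whose canonical henselian valuation v_K has separably closed residue field of characteristic zero (v_K ∈ H₂(K)). Then no proper refinement of v_K is ∅-definable in the language of rings. -/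
open FirstOrder

attribute [local instance] FirstOrder.Ring.compatibleRingOfRing

section ValuationPolynomial

open Polynomial

variable {L Γ : Type*} [Field L] [LinearOrderedCommGroupWithZero Γ] (ν : Valuation L Γ)

theorem Valuation.le_one_of_root {p : L[X]} (h : ∀ i, ν (p.coeff i) ≤ 1)
    (hl : ν p.leadingCoeff = 1) {t : L} (ht : p.eval t = 0) : ν t ≤ 1 := by
  by_contra! h1
  have h0 : (0 : Γ) < ν t := zero_lt_one.trans h1
  have key : ν (∑ i ∈ Finset.range p.natDegree, p.coeff i * t ^ i) < ν t ^ p.natDegree := by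
    refine ν.map_sum_lt (pow_ne_zero _ h0.ne') fun i hi => ?_
    rw [map_mul, map_pow]
    calc ν (p.coeff i) * ν t ^ i ≤ 1 * ν t ^ i := by gcongr; exact h i
      _ = ν t ^ i := one_mul _
      _ < ν t ^ p.natDegree := pow_lt_pow_right₀ h1 (Finset.mem_range.1 hi)
  rw [eval_eq_sum_range, Finset.sum_range_succ, add_eq_zero_iff_eq_neg] at ht
  rw [ht, Valuation.map_neg, map_mul, map_pow, coeff_natDegree, hl, one_mul] at key
  exact key.false

theorem Valuation.lt_one_of_root {p : L[X]} (h : ∀ i < p.natDegree, ν (p.coeff i) < 1)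
    (hl : ν p.leadingCoeff = 1) {t : L} (ht : p.eval t = 0) : ν t < 1 := by
  by_contra! h1
  have h0 : (0 : Γ) < ν t := zero_lt_one.trans_le h1
  have key : ν (∑ i ∈ Finset.range p.natDegree, p.coeff i * t ^ i) < ν t ^ p.natDegree := by
    refine ν.map_sum_lt (pow_ne_zero _ h0.ne') fun i hi => ?_
    rw [map_mul, map_pow]
    calc ν (p.coeff i) * ν t ^ i < 1 * ν t ^ i :=
          mul_lt_mul_of_pos_right (h i (Finset.mem_range.1 hi)) (pow_pos h0 i)
      _ = ν t ^ i := one_mul _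
      _ ≤ ν t ^ p.natDegree := pow_le_pow_right₀ h1 (Finset.mem_range.1 hi).le
  rw [eval_eq_sum_range, Finset.sum_range_succ, add_eq_zero_iff_eq_neg] at ht
  rw [ht, Valuation.map_neg, map_mul, map_pow, coeff_natDegree, hl, one_mul] at key
  exact key.false

theorem Valuation.coeff_prod_X_sub_C_le_one (s : Multiset L) (hs : ∀ r ∈ s, ν r ≤ 1) (i : ℕ) :
    ν ((s.map fun r => X - C r).prod.coeff i) ≤ 1 := by
  induction s using Multiset.induction_on generalizing i with
  | empty => simp only [Multiset.map_zero, Multiset.prod_zero, coeff_one]; split_ifs <;> simp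
  | cons r s ih =>
    have ih' := ih fun x hx => hs x (Multiset.mem_cons_of_mem hx)
    have hr : ν (r * (s.map fun r => X - C r).prod.coeff i) ≤ 1 := by
      rw [map_mul]; exact mul_le_one₀ (hs r (Multiset.mem_cons_self r s)) zero_le (ih' i)
    rw [Multiset.map_cons, Multiset.prod_cons, sub_mul, coeff_sub, coeff_C_mul]
    refine (ν.map_sub _ _).trans (max_le ?_ hr)
    cases i with
    | zero => simp
    | succ i => rw [coeff_X_mul]; exact ih' i

theorem Valuation.coeff_prod_X_sub_C_lt_one (s : Multiset L) (hs : ∀ r ∈ s, ν r < 1) (i : ℕ)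
    (hi : i < s.card) : ν ((s.map fun r => X - C r).prod.coeff i) < 1 := by
  induction s using Multiset.induction_on generalizing i with
  | empty => simp at hi
  | cons r s ih =>
    have hs' : ∀ x ∈ s, ν x < 1 := fun x hx => hs x (Multiset.mem_cons_of_mem hx)
    have hr : ν (r * (s.map fun r => X - C r).prod.coeff i) < 1 := by
      rw [map_mul]
      exact mul_lt_one_of_lt_of_le (hs r (Multiset.mem_cons_self r s))
        (ν.coeff_prod_X_sub_C_le_one s (fun x hx => (hs' x hx).le) i)
    rw [Multiset.map_cons, Multiset.prod_cons, sub_mul, coeff_sub, coeff_C_mul]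
    refine (ν.map_sub _ _).trans_lt (max_lt ?_ hr)
    cases i with
    | zero => simp
    | succ i =>
      rw [coeff_X_mul]
      exact ih hs' i (by simpa using hi)

theorem Valuation.finite_eval_lt_one {p : L[X]} (h : ∀ i, ν (p.coeff i) ≤ 1)
    (h1 : ∃ i, ν (p.coeff i) = 1) {c : ℕ → L} (hc : ∀ m, ν (c m) ≤ 1)
    (hcc : ∀ m n, m ≠ n → ν (c m - c n) = 1) : {m | ν (p.eval (c m)) ≠ 1}.Finite := by
  classical
  let O := ν.valuationSubring
  have hO : ν.Integers O := valuationSubring.integers ν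
  have hu (a : O) : IsUnit a ↔ ν a = 1 := hO.isUnit_iff_valuation_eq_one
  obtain ⟨q, rfl⟩ : ∃ q : O[X], q.map O.subtype = p := by
    refine (mem_lifts _).1 ((lifts_iff_coeff_lifts _).2 fun i => ⟨⟨_, h i⟩, rfl⟩)
  have hq : q.map (IsLocalRing.residue O) ≠ 0 := by
    obtain ⟨i, hi⟩ := h1
    intro h0
    have := congrArg (fun r => r.coeff i) h0
    simp only [coeff_map, coeff_zero, IsLocalRing.residue_eq_zero_iff,
      IsLocalRing.mem_maximalIdeal, mem_nonunits_iff, hu] at this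
    exact this (by simpa using hi)
  let d : ℕ → O := fun m => ⟨c m, hc m⟩
  have hinj : Function.Injective fun m => IsLocalRing.residue O (d m) := by
    intro m n hmn
    by_contra hne
    have : IsLocalRing.residue O (d m - d n) = 0 := by rw [_root_.map_sub]; exact sub_eq_zero.2 hmn
    rw [IsLocalRing.residue_eq_zero_iff, IsLocalRing.mem_maximalIdeal, mem_nonunits_iff, hu] at this
    exact this (hcc m n hne)
  refine ((Finset.finite_toSet (q.map (IsLocalRing.residue O)).roots.toFinset).preimage
    hinj.injOn).subset fun m hm => ?_
  simp only [Set.mem_preimage, Finset.mem_coe, Multiset.mem_toFinset, mem_roots hq, IsRoot.def]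
  rw [eval_map, eval₂_at_apply, IsLocalRing.residue_eq_zero_iff, IsLocalRing.mem_maximalIdeal,
    mem_nonunits_iff, hu]
  intro h2
  apply hm
  have : (q.map O.subtype).eval (c m) = O.subtype (q.eval (d m)) := by
    rw [eval_map, ← eval₂_at_apply]; rfl
  rw [this]; exact h2

theorem Valuation.exists_smul_primitive {p : L[X]} (hp : p ≠ 0) :
    ∃ a : L, a ≠ 0 ∧ (∀ i, ν ((C a * p).coeff i) ≤ 1) ∧ ∃ i, ν ((C a * p).coeff i) = 1 := by
  obtain ⟨j, hj, hmax⟩ := p.support.exists_max_image (fun i => ν (p.coeff i))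
    (support_nonempty.2 hp)
  have hj0 : p.coeff j ≠ 0 := mem_support_iff.1 hj
  refine ⟨(p.coeff j)⁻¹, inv_ne_zero hj0, fun i => ?_, j, ?_⟩
  · rw [coeff_C_mul, map_mul, map_inv₀]
    by_cases hi : i ∈ p.support
    · exact inv_mul_le_one_of_le₀ (hmax i hi) zero_le
    · rw [notMem_support_iff.1 hi]; simp
  · rw [coeff_C_mul, inv_mul_cancel₀ hj0, map_one]

end ValuationPolynomial

section AlgebraicExtension

open Polynomial

variable {A L Γ : Type*} [Field A] [Field L] [Algebra A L] [LinearOrderedCommGroupWithZero Γ]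

theorem Valuation.exists_pow_eq_of_isAlgebraic (ν : Valuation L Γ) {z : L} (hz : z ≠ 0)
    (hA : IsAlgebraic A z) : ∃ d : ℕ, d ≠ 0 ∧ ∃ a : A, ν z ^ d = ν (algebraMap A L a) := by
  obtain ⟨p, hp, hpz⟩ := hA
  have key : ∃ i j, i < j ∧ p.coeff i ≠ 0 ∧ p.coeff j ≠ 0 ∧
      ν (algebraMap A L (p.coeff i) * z ^ i) = ν (algebraMap A L (p.coeff j) * z ^ j) := by
    obtain ⟨i, hi, hmax⟩ := p.support.exists_max_image
      (fun i => ν (algebraMap A L (p.coeff i) * z ^ i)) (support_nonempty.2 hp)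
    have hi0 := mem_support_iff.1 hi
    have hne : ν (algebraMap A L (p.coeff i) * z ^ i) ≠ 0 := by
      rw [Valuation.ne_zero_iff]
      exact mul_ne_zero ((_root_.map_ne_zero _).2 hi0) (pow_ne_zero _ hz)
    by_cases hex : ∃ j ∈ p.support, j ≠ i ∧
        ν (algebraMap A L (p.coeff i) * z ^ i) ≤ ν (algebraMap A L (p.coeff j) * z ^ j)
    · obtain ⟨j, hj, hji, hle⟩ := hex
      have he := le_antisymm hle (hmax j hj)
      rcases lt_or_gt_of_ne hji with h | h
      · exact ⟨j, i, h, mem_support_iff.1 hj, hi0, he.symm⟩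
      · exact ⟨i, j, h, hi0, mem_support_iff.1 hj, he⟩
    · push Not at hex
      rw [aeval_eq_sum_range, ← sum_over_range' p (f := fun n a => a • z ^ n) (by simp) _
        (Nat.lt_succ_self _), sum_def, ← Finset.add_sum_erase _ _ hi] at hpz
      have h2 : ν (∑ x ∈ p.support.erase i, p.coeff x • z ^ x) <
          ν (algebraMap A L (p.coeff i) * z ^ i) := by
        refine ν.map_sum_lt hne fun j hj => ?_
        rw [Algebra.smul_def]
        exact hex j (Finset.mem_of_mem_erase hj) (Finset.ne_of_mem_erase hj)
      rw [add_eq_zero_iff_neg_eq, Algebra.smul_def] at hpz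
      rw [← hpz, Valuation.map_neg] at h2
      exact absurd h2 (lt_irrefl _)
  obtain ⟨i, j, hij, hi, hj, he⟩ := key
  refine ⟨j - i, by omega, p.coeff i / p.coeff j, ?_⟩
  have hj' : ν (algebraMap A L (p.coeff j)) ≠ 0 := by
    rw [Valuation.ne_zero_iff]; exact (_root_.map_ne_zero _).2 hj
  have hz' : ν z ^ i ≠ 0 := pow_ne_zero _ ((ν.ne_zero_iff).2 hz)
  rw [map_div₀, map_div₀, eq_div_iff hj']
  apply mul_right_cancel₀ hz'
  rw [map_mul, map_mul, map_pow, map_pow] at he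
  rw [he, mul_right_comm, ← pow_add, Nat.sub_add_cancel hij.le, mul_comm]

theorem Valuation.exists_root_inv_sub_natCast (ν : Valuation L Γ)
    (hnat : ∀ n : ℕ, n ≠ 0 → ν (n : L) = 1) {x : L} (hA : IsAlgebraic A x) :
    ∃ c : ℕ, x ≠ c ∧ ∃ q : A[X], (∀ i, ν (algebraMap A L (q.coeff i)) ≤ 1) ∧
      ν (algebraMap A L q.leadingCoeff) = 1 ∧ aeval (x - c)⁻¹ q = 0 := by
  obtain ⟨p₀, hp₀, hpx⟩ := hA
  obtain ⟨a, ha, hle, hone⟩ := (ν.comap (algebraMap A L)).exists_smul_primitive hp₀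
  set p := C a * p₀ with hp
  have hpx : aeval x p = 0 := by rw [hp, map_mul, hpx, mul_zero]
  have hnatA : ∀ n : ℕ, n ≠ 0 → ν.comap (algebraMap A L) (n : A) = 1 := fun n hn => by
    rw [Valuation.comap_apply, map_natCast]; exact hnat n hn
  have hnat_le : ∀ n : ℕ, ν.comap (algebraMap A L) (n : A) ≤ 1 := fun n => by
    rcases eq_or_ne n 0 with rfl | hn
    · simp
    · exact (hnatA n hn).le
  have hfin := (ν.comap (algebraMap A L)).finite_eval_lt_one hle hone
    (c := fun n => (n : A)) hnat_le (fun m n hmn => by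
      rcases lt_or_gt_of_ne hmn with h | h
      · rw [Valuation.map_sub_swap, ← Nat.cast_sub h.le]
        exact hnatA _ (by omega)
      · rw [← Nat.cast_sub h.le]
        exact hnatA _ (by omega))
  obtain ⟨c, hc⟩ := hfin.infinite_compl.nonempty
  have hc : ν (algebraMap A L (p.eval (c : A))) = 1 := by simpa using hc
  have hpc : p.eval (c : A) ≠ 0 := by
    intro h0; rw [h0] at hc; simp at hc
  have hxc : x ≠ c := by
    rintro rfl
    rw [← map_natCast (algebraMap A L), aeval_algebraMap_apply, coe_aeval_eq_eval] at hpx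
    exact hpc ((map_eq_zero _).1 hpx)
  have hle' : ∀ i, ν (algebraMap A L ((taylor (c : A) p).coeff i)) ≤ 1 := by
    let O := (ν.comap (algebraMap A L)).integer
    obtain ⟨P, hP⟩ : ∃ P : O[X], P.map O.subtype = p :=
      (mem_lifts _).1 ((lifts_iff_coeff_lifts _).2 fun i => ⟨⟨_, hle i⟩, rfl⟩)
    intro i
    have : taylor (c : A) p = (taylor (c : O) P).map O.subtype := by
      rw [map_taylor, hP, map_natCast]
    rw [this, coeff_map]
    exact ((taylor (c : O) P).coeff i).2
  refine ⟨c, hxc, (taylor (c : A) p).reverse, fun i => ?_, ?_, ?_⟩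
  · rw [coeff_reverse]; exact hle' _
  · rw [reverse_leadingCoeff, trailingCoeff_eq_coeff_zero, taylor_coeff_zero, hc]
    rwa [taylor_coeff_zero]
  · let := invertibleOfNonzero (sub_ne_zero.2 hxc)
    rw [← invOf_eq_inv, aeval_def, eval₂_reverse_eq_zero_iff, taylor_apply, eval₂_comp]
    simpa [aeval_def] using hpx

theorem exists_algEquiv_valuation_eq [IsGalois A L] (ν₁ ν₂ : Valuation L Γ)
    (hnat : ∀ n : ℕ, n ≠ 0 → ν₁ (n : L) = 1)
    (h : ∀ a : A, ν₁ (algebraMap A L a) = ν₂ (algebraMap A L a)) :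
    ∃ σ : Gal(L/A), ∀ z, ν₂ (σ z) = ν₁ z := by
  classical
  have halg (x : L) : IsAlgebraic A x := Algebra.IsAlgebraic.isAlgebraic x
  have hroot₁ {q : A[X]} (hq : ∀ i, ν₁ (algebraMap A L (q.coeff i)) ≤ 1)
      (hl : ν₁ (algebraMap A L q.leadingCoeff) = 1) {t : L} (ht : aeval t q = 0) : ν₁ t ≤ 1 :=
    ν₁.le_one_of_root (p := q.map (algebraMap A L)) (by simpa using hq) (by simpa using hl)
      (by rwa [eval_map_algebraMap])
  have hroot₂ {q : A[X]} (hq : ∀ i, ν₁ (algebraMap A L (q.coeff i)) ≤ 1)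
      (hl : ν₁ (algebraMap A L q.leadingCoeff) = 1) {t : L} (ht : aeval t q = 0) : ν₂ t ≤ 1 :=
    ν₂.le_one_of_root (p := q.map (algebraMap A L)) (by simpa [h] using hq) (by simpa [h] using hl)
      (by rwa [eval_map_algebraMap])
  have hunit (u : L) (hu : ν₁ u = 1) (hle : ∀ σ : Gal(L/A), ν₂ (σ u) ≤ 1) :
      ∃ σ : Gal(L/A), ν₂ (σ u) = 1 := by
    by_contra! hne
    have hlt : ν₁ u < 1 := by
      have hmonic := minpoly.monic (halg u).isIntegral
      refine ν₁.lt_one_of_root (p := (minpoly A u).map (algebraMap A L)) (fun i hi => ?_)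
        (by simp [hmonic]) (by rw [eval_map_algebraMap, minpoly.aeval])
      rw [coeff_map, h, ← coeff_map]
      have hsplit := Normal.splits (F := A) (K := L) inferInstance u
      have hprod := hsplit.eq_prod_roots_of_monic (hmonic.map _)
      rw [hsplit.natDegree_eq_card_roots] at hi
      rw [hprod]
      refine ν₂.coeff_prod_X_sub_C_lt_one _ (fun r hr => ?_) i hi
      have hr' : aeval r (minpoly A u) = 0 := by
        rw [← eval_map_algebraMap]; exact (mem_roots'.1 hr).2
      obtain ⟨σ, rfl⟩ := minpoly.exists_algEquiv_of_root' (halg u) hr'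
      exact lt_of_le_of_ne (hle σ) (hne σ)
    exact hlt.ne hu
  have hfinite (T : Finset L) (hT : ∀ x ∈ T, ν₁ x ≤ 1) :
      ∃ σ : Gal(L/A), ∀ x ∈ T, ν₂ (σ x) ≤ 1 := by
    choose c hc q hq hl hroot using fun x : L => ν₁.exists_root_inv_sub_natCast hnat (halg x)
    have hc_le (x : L) : ν₁ (c x : L) ≤ 1 := by
      rcases eq_or_ne (c x) 0 with h0 | h0
      · simp [h0]
      · exact (hnat _ h0).le
    have h2 (x : L) (σ : Gal(L/A)) : ν₂ (σ (x - c x)⁻¹) ≤ 1 := by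
      refine hroot₂ (hq x) (hl x) ?_
      rw [← AlgEquiv.coe_toAlgHom, aeval_algHom_apply, hroot, map_zero]
    have h1 (x : L) (hx : ν₁ x ≤ 1) : ν₁ (x - c x)⁻¹ = 1 := by
      refine le_antisymm (hroot₁ (hq x) (hl x) (hroot x)) ?_
      rw [map_inv₀, one_le_inv₀ ((ν₁.pos_iff).2 (sub_ne_zero.2 (hc x)))]
      exact (ν₁.map_sub _ _).trans (max_le hx (hc_le x))
    have hprod_le (T' : Finset L) (σ : Gal(L/A)) : ν₂ (σ (∏ x ∈ T', (x - c x)⁻¹)) ≤ 1 := by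
      rw [map_prod, map_prod]
      exact Finset.prod_induction _ (· ≤ 1) (fun _ _ => mul_le_one') le_rfl fun x _ => h2 x σ
    obtain ⟨σ, hσ⟩ := hunit (∏ x ∈ T, (x - c x)⁻¹)
      (by rw [map_prod]; exact Finset.prod_eq_one fun x hx => h1 x (hT x hx)) (hprod_le T)
    refine ⟨σ, fun x hx => ?_⟩
    have hx1 : ν₂ (σ (x - c x)⁻¹) = 1 := by
      rw [← Finset.mul_prod_erase T _ hx, map_mul, map_mul] at hσ
      refine le_antisymm (h2 x σ) (le_of_not_gt fun hlt => ?_)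
      exact (mul_lt_one_of_lt_of_le hlt (hprod_le _ σ)).ne hσ
    rw [map_inv₀, map_inv₀, inv_eq_one] at hx1
    have hcx : ν₂ (c x : L) ≤ 1 := by
      rw [← map_natCast (algebraMap A L), ← h, map_natCast]; exact hc_le x
    have : σ x = σ (x - c x) + c x := by rw [map_sub, map_natCast]; ring
    rw [this]
    exact (ν₂.map_add _ _).trans (max_le hx1.le hcx)
  have hcompact : ∃ σ : Gal(L/A), ∀ x, ν₁ x ≤ 1 → ν₂ (σ x) ≤ 1 := by
    let : TopologicalSpace L := ⊥
    have : DiscreteTopology L := ⟨rfl⟩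
    have : ContinuousSMul Gal(L/A) L := continuousSMul_iff_stabilizer_isOpen.2
      fun x => stabilizer_isOpen_of_isIntegral x
    let Z : {x : L // ν₁ x ≤ 1} → Set Gal(L/A) := fun x => {σ | ν₂ (σ x) ≤ 1}
    have hne : (⋂ x, Z x).Nonempty := by
      refine CompactSpace.iInter_nonempty (fun x => ?_) fun T => ?_
      · have hcont : Continuous fun σ : Gal(L/A) => σ • (x : L) :=
          continuous_id.smul continuous_const
        exact (isClosed_discrete {y : L | ν₂ y ≤ 1}).preimage hcont
      · obtain ⟨σ, hσ⟩ := hfinite (T.map (Function.Embedding.subtype _)) fun x hx => by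
          obtain ⟨y, -, rfl⟩ := Finset.mem_map.1 hx
          exact y.2
        exact ⟨σ, Set.mem_iInter₂.2 fun y hy => hσ y (Finset.mem_map.2 ⟨y, hy, rfl⟩)⟩
    obtain ⟨σ, hσ⟩ := hne
    exact ⟨σ, fun x hx => Set.mem_iInter.1 hσ ⟨x, hx⟩⟩
  obtain ⟨σ, hσ⟩ := hcompact
  refine ⟨σ, fun z => ?_⟩
  rcases eq_or_ne z 0 with rfl | hz
  · simp
  obtain ⟨d, hd, a, ha⟩ := ν₁.exists_pow_eq_of_isAlgebraic hz (halg z)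
  have ha0 : ν₁ (algebraMap A L a) ≠ 0 := ha ▸ pow_ne_zero _ ((ν₁.ne_zero_iff).2 hz)
  have hu : ν₁ (z ^ d / algebraMap A L a) = 1 := by
    rw [map_div₀, map_pow, ha, div_self ha0]
  have h1 := hσ _ hu.le
  have h2 := hσ (z ^ d / algebraMap A L a)⁻¹ (by rw [map_inv₀, hu, inv_one])
  rw [map_inv₀, map_inv₀] at h2
  have hz2 : 0 < ν₂ (σ (z ^ d / algebraMap A L a)) := by
    rw [Valuation.pos_iff, _root_.map_ne_zero]
    intro h0; rw [h0] at hu; simp at hu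
  have h3 := le_antisymm h1 ((inv_le_one₀ hz2).1 h2)
  rw [map_div₀, map_div₀, map_pow, map_pow, AlgEquiv.commutes, ← h, ← ha,
    div_eq_one_iff_eq (ha.symm ▸ ha0)] at h3
  exact (pow_left_inj₀ zero_le zero_le hd).1 h3

end AlgebraicExtension

section HenselianInvariance

open Polynomial

variable {O K E Γ : Type*} [CommRing O] [Field K] [Field E] [Algebra O K] [Algebra K E]
  [LinearOrderedCommGroupWithZero Γ] {ν : Valuation E Γ}

theorem Valuation.exists_root_of_henselianLocalRing [HenselianLocalRing O]
    (hO : (ν.comap (algebraMap K E)).Integers O) {P : K[X]} (hP : P.Monic)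
    (hle : ∀ i, ν (algebraMap K E (P.coeff i)) ≤ 1) {a : K} (ha : ν (algebraMap K E a) ≤ 1)
    (heval : ν (aeval (algebraMap K E a) P) < 1)
    (hder : ν (aeval (algebraMap K E a) (derivative P)) = 1) :
    ∃ b : K, aeval (algebraMap K E b) P = 0 ∧ ν (algebraMap K E b - algebraMap K E a) < 1 := by
  obtain ⟨Q, rfl, -, hQ⟩ := lifts_and_degree_eq_and_monic
    ((lifts_iff_coeff_lifts _).2 fun i => hO.exists_of_le_one (hle i)) hP
  obtain ⟨a, rfl⟩ := hO.exists_of_le_one ha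
  have hlt (x : O) : x ∈ IsLocalRing.maximalIdeal O ↔
      ν (algebraMap K E (algebraMap O K x)) < 1 := by
    rw [IsLocalRing.mem_maximalIdeal, mem_nonunits_iff, hO.isUnit_iff_valuation_eq_one]
    exact (lt_iff_le_and_ne.trans (and_iff_right (hO.map_le_one x))).symm
  have hev (R : O[X]) (x : O) : aeval (algebraMap K E (algebraMap O K x)) (R.map (algebraMap O K))
      = algebraMap K E (algebraMap O K (R.eval x)) := by
    rw [aeval_algebraMap_apply, coe_aeval_eq_eval, eval_map, eval₂_at_apply]
  rw [hev] at heval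
  rw [derivative_map, hev] at hder
  obtain ⟨b, hb, hba⟩ := HenselianLocalRing.is_henselian Q hQ a ((hlt _).2 heval)
    (hO.isUnit_iff_valuation_eq_one.2 hder)
  refine ⟨algebraMap O K b, ?_, ?_⟩
  · rw [hev, hb, map_zero, map_zero]
  · rw [hlt] at hba
    simpa using hba

theorem Valuation.finite_sub_natCast_ne_one (hnat : ∀ n : ℕ, n ≠ 0 → ν (n : E) = 1) {x : E}
    (hx : ν x ≤ 1) : {n : ℕ | ν (x - n) ≠ 1}.Finite := by
  refine Set.Subsingleton.finite fun m hm n hn => ?_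
  have hle (n : ℕ) : ν (x - n) ≤ 1 := by
    refine (ν.map_sub _ _).trans (max_le hx ?_)
    rcases eq_or_ne n 0 with rfl | h0
    · simp
    · exact (hnat n h0).le
  have hlt : ν ((x - n) - (x - m)) < 1 := (ν.map_sub _ _).trans_lt
    (max_lt (lt_of_le_of_ne (hle n) hn) (lt_of_le_of_ne (hle m) hm))
  by_contra hne
  rcases lt_or_gt_of_ne hne with h | h
  · rw [sub_sub_sub_cancel_left, Valuation.map_sub_swap, ← Nat.cast_sub h.le,
      hnat _ (by omega)] at hlt
    exact hlt.false
  · rw [sub_sub_sub_cancel_left, ← Nat.cast_sub h.le, hnat _ (by omega)] at hlt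
    exact hlt.false

/-- A valuation on a Galois extension of `K` whose restriction to `K` is henselian of residue
characteristic zero is invariant under the Galois group. -/
theorem Valuation.algEquiv_apply_le_one [HenselianLocalRing O] [IsGalois K E]
    (hO : (ν.comap (algebraMap K E)).Integers O) (hnat : ∀ n : ℕ, n ≠ 0 → ν (n : E) = 1)
    (σ : Gal(E/K)) {y : E} (hy : ν y ≤ 1) : ν (σ y) ≤ 1 := by
  classical
  let s : Finset E := ((minpoly K y).aroots E).toFinset
  have hys : y ∈ s := by
    rw [Multiset.mem_toFinset, mem_aroots]
    exact ⟨minpoly.ne_zero (Algebra.IsIntegral.isIntegral y), minpoly.aeval _ _⟩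
  have hσs (τ : Gal(E/K)) {t : E} (ht : t ∈ s) : τ t ∈ s := by
    rw [Multiset.mem_toFinset, mem_aroots] at ht ⊢
    exact ⟨ht.1, by rw [← AlgEquiv.coe_toAlgHom, aeval_algHom_apply, ht.2, map_zero]⟩
  let T : Finset E := {t ∈ s | ν t ≤ 1}
  have hTs : T ⊆ s := Finset.filter_subset _ _
  obtain ⟨c, hc⟩ : ∃ c : ℕ, ∀ t ∈ T, ν (t - c) = 1 := by
    have hfin : (⋃ t ∈ T, {n : ℕ | ν (t - n) ≠ 1}).Finite := T.finite_toSet.biUnion fun t ht =>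
      ν.finite_sub_natCast_ne_one hnat (Finset.mem_filter.1 ht).2
    obtain ⟨c, hc⟩ := hfin.infinite_compl.nonempty
    exact ⟨c, by simpa using hc⟩
  have hcle : ν (c : E) ≤ 1 := by
    rcases eq_or_ne c 0 with h0 | h0
    · simp [h0]
    · exact (hnat _ h0).le
  let z : E → E := fun t => (t - c)⁻¹
  have hzT : ∀ t ∈ T, ν (z t) = 1 := fun t ht => by simp only [z, map_inv₀, hc t ht, inv_one]
  have hzlt : ∀ t ∈ s, t ∉ T → ν (z t) < 1 := fun t ht htT => by
    have h1 : 1 < ν t := by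
      by_contra! h; exact htT (Finset.mem_filter.2 ⟨ht, h⟩)
    simp only [z, map_inv₀]
    rw [ν.map_sub_eq_of_lt_left (hcle.trans_lt h1)]
    exact inv_lt_one_of_one_lt₀ h1
  have hzle : ∀ t ∈ s, ν (z t) ≤ 1 := fun t ht => by
    by_cases h : t ∈ T
    · exact (hzT t h).le
    · exact (hzlt t ht h).le
  let θ : Finset E → E := fun U => ∏ t ∈ U, z t
  let S : Finset (Finset E) := s.powersetCard T.card
  have hTS : T ∈ S := Finset.mem_powersetCard.2 ⟨hTs, rfl⟩
  have hθT : ν (θ T) = 1 := by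
    simp only [θ, map_prod]; exact Finset.prod_eq_one hzT
  have hθlt : ∀ U ∈ S, U ≠ T → ν (θ U) < 1 := fun U hU hUT => by
    obtain ⟨hUs, hcard⟩ := Finset.mem_powersetCard.1 hU
    obtain ⟨t, htU, htT⟩ : ∃ t ∈ U, t ∉ T := by
      by_contra! h
      exact hUT (Finset.eq_of_subset_of_card_le h hcard.ge)
    simp only [θ, map_prod]
    rw [← Finset.mul_prod_erase U _ htU]
    refine mul_lt_one_of_lt_of_le (hzlt t (hUs htU) htT) ?_
    exact Finset.prod_induction _ (· ≤ 1) (fun _ _ => mul_le_one') le_rfl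
      fun x hx => hzle x (hUs (Finset.mem_of_mem_erase hx))
  have hθle : ∀ U ∈ S, ν (θ U) ≤ 1 := fun U hU => by
    by_cases h : U = T
    · rw [h, hθT]
    · exact (hθlt U hU h).le
  have himg (τ : Gal(E/K)) {U : Finset E} (hU : U ∈ S) : U.image τ ∈ S := by
    obtain ⟨hUs, hcard⟩ := Finset.mem_powersetCard.1 hU
    refine Finset.mem_powersetCard.2 ⟨?_, ?_⟩
    · exact Finset.image_subset_iff.2 fun t ht => hσs τ (hUs ht)
    · rw [Finset.card_image_of_injective _ τ.injective, hcard]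
  have hθσ (τ : Gal(E/K)) (U : Finset E) : τ (θ U) = θ (U.image τ) := by
    simp only [θ]
    rw [map_prod, Finset.prod_image τ.injective.injOn]
    exact Finset.prod_congr rfl fun t _ => by simp [z]
  have hSimg (τ : Gal(E/K)) : S.image (fun U => U.image τ) = S := by
    refine Finset.eq_of_subset_of_card_le (Finset.image_subset_iff.2 fun U hU => himg τ hU) ?_
    rw [Finset.card_image_of_injective _ (Finset.image_injective τ.injective)]
  let P : E[X] := ∏ U ∈ S, (X - C (θ U))
  have hPσ (τ : Gal(E/K)) : P.map (τ : E →+* E) = P := by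
    simp only [P]
    rw [Polynomial.map_prod]
    conv_rhs => rw [← hSimg τ, Finset.prod_image (Finset.image_injective τ.injective).injOn]
    refine Finset.prod_congr rfl fun U _ => ?_
    rw [Polynomial.map_sub, map_X, map_C, ← hθσ]
    rfl
  have hPmonic : P.Monic := monic_prod_of_monic _ _ fun U _ => monic_X_sub_C _
  obtain ⟨Q, hQP, -, hQ⟩ := lifts_and_degree_eq_and_monic (f := algebraMap K E) (p := P)
    ((lifts_iff_coeff_lifts _).2 fun i =>
      (InfiniteGalois.mem_range_algebraMap_iff_fixed _).2 fun τ => by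
        conv_rhs => rw [← hPσ τ]
        rw [coeff_map]
        rfl) hPmonic
  obtain ⟨a, ha⟩ : ∑ U ∈ S, θ U ∈ Set.range (algebraMap K E) :=
    (InfiniteGalois.mem_range_algebraMap_iff_fixed _).2 fun τ => by
      conv_rhs => rw [← hSimg τ, Finset.sum_image (Finset.image_injective τ.injective).injOn]
      rw [map_sum]
      exact Finset.sum_congr rfl fun U _ => hθσ τ U
  have haT : ν (algebraMap K E a - θ T) < 1 := by
    rw [ha, ← Finset.add_sum_erase _ _ hTS, add_sub_cancel_left]
    exact ν.map_sum_lt one_ne_zero fun U hU =>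
      hθlt U (Finset.mem_of_mem_erase hU) (Finset.ne_of_mem_erase hU)
  have ha1 : ν (algebraMap K E a) = 1 := by
    rw [← hθT]
    exact ν.map_eq_of_sub_lt (hθT.symm ▸ haT)
  have hsub {U : Finset E} (hU : U ∈ S.erase T) : ν (algebraMap K E a - θ U) = 1 := by
    rw [ν.map_sub_eq_of_lt_left, ha1]
    rw [ha1]
    exact hθlt U (Finset.mem_of_mem_erase hU) (Finset.ne_of_mem_erase hU)
  have hsuble {U : Finset E} (hU : U ∈ S) : ν (algebraMap K E a - θ U) ≤ 1 :=
    (ν.map_sub _ _).trans (max_le ha1.le (hθle U hU))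
  have hprodlt {R : Finset (Finset E)} (hR : R ⊆ S) (hT : T ∈ R) :
      ν (∏ U ∈ R, (algebraMap K E a - θ U)) < 1 := by
    rw [← Finset.mul_prod_erase _ _ hT, map_mul]
    refine mul_lt_one_of_lt_of_le haT ?_
    rw [map_prod]
    exact Finset.prod_induction _ (· ≤ 1) (fun _ _ => mul_le_one') le_rfl
      fun U hU => hsuble (hR (Finset.mem_of_mem_erase hU))
  obtain ⟨b, hb, hba⟩ := Valuation.exists_root_of_henselianLocalRing hO hQ (fun i => by
      rw [← coeff_map, hQP]
      have := ν.coeff_prod_X_sub_C_le_one (S.val.map θ) (fun r hr => by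
        obtain ⟨U, hU, rfl⟩ := Multiset.mem_map.1 hr
        exact hθle U hU) i
      rwa [Multiset.map_map] at this) ha1.le
    (by
      rw [← eval_map_algebraMap, hQP, eval_prod]
      simpa using hprodlt subset_rfl hTS)
    (by
      rw [← eval_map_algebraMap, ← derivative_map, hQP, derivative_prod_finset,
        ← Finset.add_sum_erase _ _ hTS, eval_add]
      simp only [derivative_X_sub_C, mul_one, eval_finsetSum, eval_prod, eval_sub, eval_X, eval_C]
      have h1 : ν (∏ U ∈ S.erase T, (algebraMap K E a - θ U)) = 1 := by
        rw [map_prod]; exact Finset.prod_eq_one fun U hU => hsub hU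
      rw [ν.map_add_eq_of_lt_left, h1]
      rw [h1]
      refine ν.map_sum_lt one_ne_zero fun U hU => hprodlt (Finset.erase_subset _ _) ?_
      exact Finset.mem_erase.2 ⟨(Finset.ne_of_mem_erase hU).symm, hTS⟩)
  have hbθ : algebraMap K E b = θ T := by
    rw [← eval_map_algebraMap, hQP, eval_prod, Finset.prod_eq_zero_iff] at hb
    obtain ⟨U, hU, hbU⟩ := hb
    rw [eval_sub, eval_X, eval_C, sub_eq_zero] at hbU
    by_contra hne
    have hUT : U ≠ T := by rintro rfl; exact hne hbU
    rw [hbU, Valuation.map_sub_swap, hsub (Finset.mem_erase.2 ⟨hUT, hU⟩)] at hba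
    exact hba.false
  have hTσ : T.image σ = T := by
    by_contra hne
    have := hθlt _ (himg σ hTS) hne
    rw [← hθσ, ← hbθ, AlgEquiv.commutes, hbθ, hθT] at this
    exact this.false
  have : σ y ∈ T := hTσ ▸ Finset.mem_image_of_mem σ (Finset.mem_filter.2 ⟨hys, hy⟩)
  exact (Finset.mem_filter.1 this).2

theorem Valuation.algEquiv_apply_eq [HenselianLocalRing O] [IsGalois K E]
    (hO : (ν.comap (algebraMap K E)).Integers O) (hnat : ∀ n : ℕ, n ≠ 0 → ν (n : E) = 1)
    (σ : Gal(E/K)) (y : E) : ν (σ y) = ν y := by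
  rcases eq_or_ne y 0 with rfl | hy
  · simp
  obtain ⟨d, hd, a, ha⟩ := ν.exists_pow_eq_of_isAlgebraic (A := K) hy
    (Algebra.IsAlgebraic.isAlgebraic y)
  have ha0 : ν (algebraMap K E a) ≠ 0 := ha ▸ pow_ne_zero _ ((ν.ne_zero_iff).2 hy)
  have hu : ν (y ^ d / algebraMap K E a) = 1 := by
    rw [map_div₀, map_pow, ha, div_self ha0]
  have h1 := ν.algEquiv_apply_le_one hO hnat σ hu.le
  have h2 := ν.algEquiv_apply_le_one hO hnat σ
    (y := (y ^ d / algebraMap K E a)⁻¹) (by rw [map_inv₀, hu, inv_one])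
  rw [map_inv₀, map_inv₀] at h2
  have hz2 : 0 < ν (σ (y ^ d / algebraMap K E a)) := by
    rw [Valuation.pos_iff, _root_.map_ne_zero]
    intro h0; rw [h0] at hu; simp at hu
  have h3 := le_antisymm h1 ((inv_le_one₀ hz2).1 h2)
  rw [map_div₀, map_div₀, map_pow, map_pow, AlgEquiv.commutes, ← ha,
    div_eq_one_iff_eq (ha.symm ▸ ha0)] at h3
  exact (pow_left_inj₀ zero_le zero_le hd).1 h3

theorem Valuation.exists_sub_lt_one [HenselianLocalRing O] [IsGalois K E]
    [IsAlgClosed (IsLocalRing.ResidueField O)]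
    (hO : (ν.comap (algebraMap K E)).Integers O) (hnat : ∀ n : ℕ, n ≠ 0 → ν (n : E) = 1)
    {y : E} (hy : ν y ≤ 1) : ∃ u : K, ν (y - algebraMap K E u) < 1 := by
  have h_int : IsIntegral K y := Algebra.IsIntegral.isIntegral y
  have hmin : ∀ i, ν (algebraMap K E ((minpoly K y).coeff i)) ≤ 1 := fun i => by
    have hsplit := Normal.splits (F := K) (K := E) inferInstance y
    rw [← coeff_map, hsplit.eq_prod_roots_of_monic ((minpoly.monic h_int).map _)]
    refine ν.coeff_prod_X_sub_C_le_one _ (fun r hr => ?_) i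
    have hr' : aeval r (minpoly K y) = 0 := by
      rw [← eval_map_algebraMap]; exact (mem_roots'.1 hr).2
    obtain ⟨σ, rfl⟩ := minpoly.exists_algEquiv_of_root' h_int.isAlgebraic hr'
    rwa [ν.algEquiv_apply_eq hO hnat]
  obtain ⟨q, hq, -, hqm⟩ := lifts_and_degree_eq_and_monic
    ((lifts_iff_coeff_lifts _).2 fun i => hO.exists_of_le_one (hmin i)) (minpoly.monic h_int)
  obtain ⟨s, hs⟩ := (IsLocalRing.residue_surjective (R := O)).hasRightInverse
  let ρ := IsLocalRing.residue O
  let r : O[X] := ((q.map ρ).roots.map fun a => X - C (s a)).prod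
  have hr : r.map ρ = q.map ρ := by
    rw [(IsAlgClosed.splits (q.map ρ)).eq_prod_roots_of_monic (hqm.map _)]
    simp only [r, Polynomial.map_multiset_prod, Multiset.map_map, Function.comp_def,
      Polynomial.map_sub, map_X, map_C]
    exact congrArg _ (Multiset.map_congr rfl fun a _ => by rw [hs a])
  let φ : O →+* E := (algebraMap K E).comp (algebraMap O K)
  have hlt (x : O) (hx : ρ x = 0) : ν (φ x) < 1 := by
    rw [IsLocalRing.residue_eq_zero_iff, IsLocalRing.mem_maximalIdeal, mem_nonunits_iff,
      hO.isUnit_iff_valuation_eq_one] at hx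
    exact lt_of_le_of_ne (hO.map_le_one x) hx
  have hry : ν (eval₂ φ y r) < 1 := by
    have hqy : eval₂ φ y q = 0 := by
      rw [← eval₂_map, hq]; exact minpoly.aeval K y
    have : eval₂ φ y r = eval₂ φ y (r - q) := by rw [eval₂_sub, hqy, sub_zero]
    rw [this, eval₂_eq_sum_range]
    refine ν.map_sum_lt one_ne_zero fun i _ => ?_
    rw [map_mul, map_pow]
    refine mul_lt_one_of_lt_of_le (hlt _ ?_) (pow_le_one' hy i)
    rw [coeff_sub, _root_.map_sub, ← coeff_map, ← coeff_map, hr, sub_self]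
  by_contra! hge
  refine hry.not_ge ?_
  simp only [r]
  rw [eval₂_multiset_prod, Multiset.map_map, map_multiset_prod, Multiset.map_map]
  refine Multiset.one_le_prod fun x hx => ?_
  obtain ⟨a, -, rfl⟩ := Multiset.mem_map.1 hx
  simpa [φ] using hge (algebraMap O K (s a))

theorem Valuation.exists_sub_lt [HenselianLocalRing O] [IsGalois K E]
    [IsAlgClosed (IsLocalRing.ResidueField O)]
    (hO : (ν.comap (algebraMap K E)).Integers O) (hnat : ∀ n : ℕ, n ≠ 0 → ν (n : E) = 1)
    {y : E} (hy : y ≠ 0) {g : K} (hg : ν y = ν (algebraMap K E g)) :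
    ∃ u : K, ν (y - algebraMap K E u) < ν y := by
  have hg0 : ν (algebraMap K E g) ≠ 0 := hg ▸ (ν.ne_zero_iff).2 hy
  have hg1 : algebraMap K E g ≠ 0 := (ν.ne_zero_iff).1 hg0
  obtain ⟨u, hu⟩ := ν.exists_sub_lt_one hO hnat (y := y / algebraMap K E g)
    (by rw [map_div₀, hg, div_self hg0])
  refine ⟨u * g, ?_⟩
  have : y - algebraMap K E (u * g) = (y / algebraMap K E g - algebraMap K E u) *
      algebraMap K E g := by
    rw [sub_mul, div_mul_cancel₀ _ hg1, map_mul]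
  rw [this, map_mul, hg]
  exact mul_lt_of_lt_one_left (zero_lt_iff.2 hg0) hu

theorem Valuation.exists_sub_valuation_ne [HenselianLocalRing O] [IsGalois K E]
    [IsAlgClosed (IsLocalRing.ResidueField O)]
    (hO : (ν.comap (algebraMap K E)).Integers O) (hnat : ∀ n : ℕ, n ≠ 0 → ν (n : E) = 1)
    {y : E} (hy : y ∉ Set.range (algebraMap K E)) {F : Subfield E}
    (hF : ∀ σ : Gal(E/K), σ y ∈ F) :
    ∃ c : K, algebraMap K E c ∈ F ∧
      ∀ g : K, ν (y - algebraMap K E c) ≠ ν (algebraMap K E g) := by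
  classical
  have h_int : IsIntegral K y := Algebra.IsIntegral.isIntegral y
  let s : Finset E := ((minpoly K y).aroots E).toFinset
  have hs (t : E) : t ∈ s ↔ ∃ σ : Gal(E/K), σ y = t := by
    rw [Multiset.mem_toFinset, mem_aroots, and_iff_right (minpoly.ne_zero h_int)]
    refine ⟨minpoly.exists_algEquiv_of_root' h_int.isAlgebraic, ?_⟩
    rintro ⟨σ, rfl⟩
    rw [← AlgEquiv.coe_toAlgHom, aeval_algHom_apply, minpoly.aeval, map_zero]
  have hcard : s.card ≠ 0 := Finset.card_ne_zero_of_mem ((hs y).2 ⟨1, rfl⟩)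
  have hN := hnat _ hcard
  have hN0 : (s.card : E) ≠ 0 := by
    intro h0; rw [h0] at hN; simp at hN
  have himg (τ : Gal(E/K)) : s.image τ = s := by
    refine Finset.eq_of_subset_of_card_le (Finset.image_subset_iff.2 fun t ht => ?_) ?_
    · obtain ⟨σ, rfl⟩ := (hs t).1 ht
      exact (hs _).2 ⟨τ * σ, rfl⟩
    · rw [Finset.card_image_of_injective _ τ.injective]
  obtain ⟨c, hc⟩ : (∑ t ∈ s, t) / s.card ∈ Set.range (algebraMap K E) :=
    (InfiniteGalois.mem_range_algebraMap_iff_fixed _).2 fun τ => by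
      rw [map_div₀, map_natCast, map_sum]
      conv_rhs => rw [← himg τ, Finset.sum_image τ.injective.injOn, himg τ]
  refine ⟨c, ?_, fun g hg => ?_⟩
  · rw [hc]
    refine F.div_mem (F.sum_mem fun t ht => ?_) (natCast_mem F _)
    obtain ⟨σ, rfl⟩ := (hs t).1 ht
    exact hF σ
  have hd : y - algebraMap K E c ≠ 0 := fun h0 => hy ⟨c, (sub_eq_zero.1 h0).symm⟩
  obtain ⟨u, hu⟩ := ν.exists_sub_lt hO hnat hd hg
  have hνu : ν (algebraMap K E u) = ν (y - algebraMap K E c) :=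
    ν.map_eq_of_sub_lt (by rwa [Valuation.map_sub_swap])
  have hsum : ν (∑ t ∈ s, (t - algebraMap K E c - algebraMap K E u)) <
      ν (y - algebraMap K E c) := by
    refine ν.map_sum_lt ((ν.ne_zero_iff).2 hd) fun t ht => ?_
    obtain ⟨σ, rfl⟩ := (hs t).1 ht
    have : σ y - algebraMap K E c - algebraMap K E u =
        σ (y - algebraMap K E c - algebraMap K E u) := by simp
    rwa [this, ν.algEquiv_apply_eq hO hnat]
  rw [Finset.sum_sub_distrib, Finset.sum_sub_distrib, Finset.sum_const, Finset.sum_const, hc,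
    nsmul_eq_mul, nsmul_eq_mul, mul_div_cancel₀ _ hN0, sub_self, zero_sub, Valuation.map_neg,
    map_mul, hN, one_mul, hνu] at hsum
  rw [← hc] at hsum
  exact hsum.false

end HenselianInvariance

section RationalPoints

open Polynomial

variable {O K E Γ A Ω : Type*} [CommRing O] [Field K] [Field E] [Algebra O K] [Algebra K E]
  [LinearOrderedCommGroupWithZero Γ] {ν : Valuation E Γ} [Field A] [Field Ω] [Algebra A Ω]

theorem exists_algEquiv_restrict [Normal A Ω] {i : A →+* K} {j : Ω →+* E}
    (hij : ∀ a, j (algebraMap A Ω a) = algebraMap K E (i a)) (σ : Gal(E/K)) :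
    ∃ τ : Gal(Ω/A), ∀ y, j (τ y) = σ (j y) := by
  let := i.toAlgebra
  let := j.toAlgebra
  let := ((algebraMap K E).comp i).toAlgebra
  have : IsScalarTower A K E := .of_algebraMap_eq fun _ => rfl
  have : IsScalarTower A Ω E := .of_algebraMap_eq fun a => (hij a).symm
  exact ⟨(σ.restrictScalars A).restrictNormal Ω,
    fun y => (σ.restrictScalars A).restrictNormal_commutes Ω y⟩

/-- The automorphisms of `Ω` over `A` that preserve the valuation `μ` and act trivially on the
leading terms of elements whose value lies in `V`. -/
def Valuation.leadingTermFixer (A : Type*) [Field A] [Algebra A Ω] (μ : Valuation Ω Γ)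
    (V : Set Γ) : Set Gal(Ω/A) :=
  {τ | (∀ y, μ (τ y) = μ y) ∧ ∀ y, y ≠ 0 → μ y ∈ V → μ (τ y - y) < μ y}

theorem Valuation.mul_mem_leadingTermFixer {μ : Valuation Ω Γ} {V : Set Γ} {σ τ : Gal(Ω/A)}
    (hσ : σ ∈ μ.leadingTermFixer A V) (hτ : τ ∈ μ.leadingTermFixer A V) :
    σ * τ ∈ μ.leadingTermFixer A V := by
  refine ⟨fun y => by rw [AlgEquiv.mul_apply, hσ.1, hτ.1], fun y hy hyV => ?_⟩
  rw [AlgEquiv.mul_apply, ← sub_add_sub_cancel _ (τ y) y]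
  refine μ.map_add_lt ?_ (hτ.2 y hy hyV)
  rw [← hτ.1 y]
  exact hσ.2 _ (by simpa using hy) (by rwa [hτ.1])

theorem Valuation.mem_range_iff_fixed [HenselianLocalRing O] [IsGalois K E]
    [IsAlgClosed (IsLocalRing.ResidueField O)]
    (hO : (ν.comap (algebraMap K E)).Integers O) (hnat : ∀ n : ℕ, n ≠ 0 → ν (n : E) = 1)
    [Normal A Ω] {i : A →+* K} {j : Ω →+* E}
    (hij : ∀ a, j (algebraMap A Ω a) = algebraMap K E (i a)) {z : Ω} :
    j z ∈ Set.range (algebraMap K E) ↔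
      ∀ τ ∈ (ν.comap j).leadingTermFixer A (Set.range fun g => ν (algebraMap K E g)), τ z = z := by
  classical
  set H := (ν.comap j).leadingTermFixer A (Set.range fun g => ν (algebraMap K E g))
  have of_fixed {z : Ω} (hz : ∀ τ ∈ H, τ z = z) : j z ∈ Set.range (algebraMap K E) := by
    refine (InfiniteGalois.mem_range_algebraMap_iff_fixed _).2 fun σ => ?_
    obtain ⟨τ, hτ⟩ := exists_algEquiv_restrict hij σ
    have hτH : τ ∈ H := by
      refine ⟨fun y => ?_, fun y hy hyV => ?_⟩
      · rw [Valuation.comap_apply, hτ, ν.algEquiv_apply_eq hO hnat]; rfl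
      · obtain ⟨g, hg⟩ := hyV
        obtain ⟨u, hu⟩ := ν.exists_sub_lt hO hnat (y := j y) (by simpa using hy) hg.symm
        rw [Valuation.comap_apply, Valuation.comap_apply, _root_.map_sub, hτ]
        have : σ (j y) - j y = σ (j y - algebraMap K E u) - (j y - algebraMap K E u) := by simp
        rw [this]
        exact (ν.map_sub _ _).trans_lt (max_lt (by rwa [ν.algEquiv_apply_eq hO hnat]) hu)
    rw [← hτ, hz τ hτH]
  refine ⟨fun hz => ?_, of_fixed⟩
  have h_int : IsIntegral A z := Algebra.IsIntegral.isIntegral z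
  let s : Finset Ω := ((minpoly A z).aroots Ω).toFinset.filter fun t => ∃ τ ∈ H, τ z = t
  have hs (t : Ω) : t ∈ s ↔ ∃ τ ∈ H, τ z = t := by
    simp only [s, Finset.mem_filter, Multiset.mem_toFinset, mem_aroots, and_iff_right_iff_imp]
    rintro ⟨σ, -, rfl⟩
    refine ⟨minpoly.ne_zero h_int, ?_⟩
    rw [← AlgEquiv.coe_toAlgHom, aeval_algHom_apply, minpoly.aeval, map_zero]
  have hone : (1 : Gal(Ω/A)) ∈ H :=
    ⟨fun y => rfl, fun y hy _ => by simpa [Valuation.pos_iff] using hy⟩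
  have hcard : s.card ≠ 0 := Finset.card_ne_zero_of_mem ((hs z).2 ⟨1, hone, rfl⟩)
  have hN : ν.comap j (s.card : Ω) = 1 := by rw [Valuation.comap_apply, map_natCast, hnat _ hcard]
  have hN0 : (s.card : Ω) ≠ 0 := by
    intro h0; rw [h0] at hN; simp at hN
  have himg {τ : Gal(Ω/A)} (hτ : τ ∈ H) : s.image τ = s := by
    refine Finset.eq_of_subset_of_card_le (Finset.image_subset_iff.2 fun t ht => ?_) ?_
    · obtain ⟨σ, hσ, rfl⟩ := (hs t).1 ht
      exact (hs _).2 ⟨τ * σ, Valuation.mul_mem_leadingTermFixer hτ hσ, rfl⟩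
    · rw [Finset.card_image_of_injective _ τ.injective]
  let z' : Ω := (∑ t ∈ s, t) / s.card
  have hz' (τ) (hτ : τ ∈ H) : τ z' = z' := by
    simp only [z']
    rw [map_div₀, map_natCast, map_sum]
    conv_rhs => rw [← himg hτ, Finset.sum_image τ.injective.injOn, himg hτ]
  obtain ⟨g', hg'⟩ := of_fixed hz'
  obtain ⟨g, hg⟩ := hz
  suffices h : z = z' by rw [h]; exact hz'
  by_contra hne
  have hd : z - z' ≠ 0 := sub_ne_zero.2 hne
  have hsum : ν.comap j (∑ t ∈ s, (t - z' - (z - z'))) < ν.comap j (z - z') := by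
    refine Valuation.map_sum_lt _ ((Valuation.ne_zero_iff _).2 hd) fun t ht => ?_
    obtain ⟨τ, hτ, rfl⟩ := (hs t).1 ht
    have : τ z - z' = τ (z - z') := by rw [_root_.map_sub, hz' τ hτ]
    rw [this]
    refine hτ.2 _ hd ⟨g - g', ?_⟩
    change ν (algebraMap K E (g - g')) = ν (j (z - z'))
    rw [_root_.map_sub j, _root_.map_sub (algebraMap K E), hg, hg']
  rw [Finset.sum_sub_distrib, Finset.sum_sub_distrib, Finset.sum_const, Finset.sum_const,
    nsmul_eq_mul, nsmul_eq_mul, mul_div_cancel₀ _ hN0, sub_self, zero_sub, Valuation.map_neg,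
    map_mul, hN, one_mul] at hsum
  exact hsum.false

theorem Valuation.mem_range_iff_mem_range [HenselianLocalRing O] [IsGalois K E]
    [IsAlgClosed (IsLocalRing.ResidueField O)]
    (hO : (ν.comap (algebraMap K E)).Integers O) (hnat : ∀ n : ℕ, n ≠ 0 → ν (n : E) = 1)
    [Normal A Ω] {i₁ i₂ : A →+* K} {j₁ j₂ : Ω →+* E}
    (h₁ : ∀ a, j₁ (algebraMap A Ω a) = algebraMap K E (i₁ a))
    (h₂ : ∀ a, j₂ (algebraMap A Ω a) = algebraMap K E (i₂ a))
    (hν : ∀ z, ν (j₁ z) = ν (j₂ z)) (z : Ω) :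
    j₁ z ∈ Set.range (algebraMap K E) ↔ j₂ z ∈ Set.range (algebraMap K E) := by
  have : ν.comap j₁ = ν.comap j₂ := Valuation.ext hν
  rw [ν.mem_range_iff_fixed hO hnat h₁, ν.mem_range_iff_fixed hO hnat h₂, this]

theorem Valuation.exists_forall_sub_eq [HenselianLocalRing O] [IsGalois K E]
    [IsAlgClosed (IsLocalRing.ResidueField O)]
    (hO : (ν.comap (algebraMap K E)).Integers O) (hnat : ∀ n : ℕ, n ≠ 0 → ν (n : E) = 1)
    [Normal A Ω] {i₁ i₂ : A →+* K} {j₁ j₂ : Ω →+* E}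
    (h₁ : ∀ a, j₁ (algebraMap A Ω a) = algebraMap K E (i₁ a))
    (h₂ : ∀ a, j₂ (algebraMap A Ω a) = algebraMap K E (i₂ a))
    (hν : ∀ z, ν (j₁ z) = ν (j₂ z)) (x : K) (T : Finset Ω) :
    ∃ y : K, ∀ a ∈ T, ν (algebraMap K E y - j₂ a) = ν (algebraMap K E x - j₁ a) := by
  rcases T.eq_empty_or_nonempty with rfl | hT
  · exact ⟨0, by simp⟩
  obtain ⟨a, -, hmin⟩ := T.exists_min_image (fun a => ν (algebraMap K E x - j₁ a)) hT
  obtain ⟨c, ⟨c₁, hc₁⟩, hc⟩ : ∃ c : Ω, j₁ c ∈ Set.range (algebraMap K E) ∧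
      ν (algebraMap K E x - j₁ c) ≤ ν (algebraMap K E x - j₁ a) := by
    by_cases ha : j₁ a ∈ Set.range (algebraMap K E)
    · exact ⟨a, ha, le_rfl⟩
    obtain ⟨c', ⟨c, hc⟩, hne⟩ := ν.exists_sub_valuation_ne hO hnat ha (F := j₁.fieldRange)
      fun σ => by
        obtain ⟨τ, hτ⟩ := exists_algEquiv_restrict h₁ σ
        exact ⟨τ a, hτ a⟩
    refine ⟨c, ⟨c', hc.symm⟩, ?_⟩
    by_contra! hlt
    refine hne (x - c') ?_
    rw [hc] at hlt
    rw [_root_.map_sub (algebraMap K E)]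
    refine ν.map_eq_of_sub_lt ?_
    rwa [sub_sub_sub_cancel_right, Valuation.map_sub_swap]
  obtain ⟨c₂, hc₂⟩ := (ν.mem_range_iff_mem_range hO hnat h₁ h₂ hν c).1 ⟨c₁, hc₁⟩
  replace hmin : ∀ b ∈ T, ν (algebraMap K E (x - c₁)) ≤
      ν (algebraMap K E (x - c₁) + j₁ (c - b)) := fun b hb => by
    rw [_root_.map_sub (algebraMap K E), _root_.map_sub j₁, hc₁, sub_add_sub_cancel]
    exact hc.trans (hmin b hb)
  set g := x - c₁ with hg
  obtain ⟨n, hn0, hn⟩ : ∃ n : ℕ, n ≠ 0 ∧ ∀ b ∈ T, ν (-j₂ (c - b) / algebraMap K E g) ≤ 1 →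
      ν (-j₂ (c - b) / algebraMap K E g - n) = 1 := by
    have hfin : ({0} ∪ ⋃ b ∈ T, {n : ℕ | ν (-j₂ (c - b) / algebraMap K E g) ≤ 1 ∧
        ν (-j₂ (c - b) / algebraMap K E g - n) ≠ 1}).Finite := by
      refine (Set.finite_singleton 0).union (T.finite_toSet.biUnion fun b _ => ?_)
      by_cases h : ν (-j₂ (c - b) / algebraMap K E g) ≤ 1
      · simpa only [h, true_and] using ν.finite_sub_natCast_ne_one hnat h
      · refine Set.finite_empty.subset fun n hn => h hn.1
    obtain ⟨n, hn⟩ := hfin.infinite_compl.nonempty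
    refine ⟨n, by rintro rfl; simp at hn, fun b hb hle => ?_⟩
    by_contra hne
    exact hn (Or.inr (Set.mem_biUnion hb ⟨hle, hne⟩))
  refine ⟨c₂ + n * g, fun b hb => ?_⟩
  have e₁ : algebraMap K E x - j₁ b = algebraMap K E g + j₁ (c - b) := by
    rw [hg, _root_.map_sub (algebraMap K E), _root_.map_sub j₁, hc₁, sub_add_sub_cancel]
  have e₂ : algebraMap K E (c₂ + n * g) - j₂ b = n * algebraMap K E g + j₂ (c - b) := by
    rw [_root_.map_add, hc₂, map_mul, map_natCast, _root_.map_sub j₂]; ring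
  have hng : ν (n * algebraMap K E g) = ν (algebraMap K E g) := by
    rw [map_mul, hnat n hn0, one_mul]
  have hb := hmin b hb
  rw [e₁, e₂]
  rcases lt_or_ge (ν (algebraMap K E g)) (ν (j₁ (c - b))) with hlt | hge
  · rw [ν.map_add_eq_of_lt_right hlt, ν.map_add_eq_of_lt_right (by rwa [hng, ← hν]), hν]
  · have hge₂ := hν (c - b) ▸ hge
    rw [le_antisymm ((ν.map_add _ _).trans (max_le le_rfl hge)) hb]
    rcases eq_or_ne g 0 with hg0 | hg0
    · rw [hg0, map_zero, map_zero] at hge₂ ⊢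
      simpa using hge₂
    have hg1 : algebraMap K E g ≠ 0 := (_root_.map_ne_zero _).2 hg0
    have hg2 : ν (algebraMap K E g) ≠ 0 := (ν.ne_zero_iff).2 hg1
    have := hn b ‹_› (by
      rw [map_div₀, Valuation.map_neg]
      exact div_le_one_of_le₀ hge₂ zero_le)
    have e₃ : n * algebraMap K E g + j₂ (c - b) =
        -((-j₂ (c - b) / algebraMap K E g - n) * algebraMap K E g) := by
      field_simp
      ring
    rw [e₃, Valuation.map_neg, map_mul, this, one_mul]

end RationalPoints

section BackAndForth

open Polynomial

theorem Polynomial.countable_of_countable (B : Type*) [Field B] [Countable B] : Countable B[X] :=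
  Cardinal.mk_le_aleph0_iff.1
    (cardinalMk_le_max.trans (max_le (Cardinal.mk_le_aleph0_iff.2 ‹_›) le_rfl))

theorem RingHom.exists_comp_eq_of_forall_mem_range {B K E : Type*} [Ring B] [Field K] [Field E]
    (g : K →+* E) (f : B →+* E) (h : ∀ b, f b ∈ Set.range g) :
    ∃ I : B →+* K, ∀ b, g (I b) = f b := by
  choose I hI using h
  exact ⟨{ toFun := I
           map_one' := g.injective (by simp [hI])
           map_mul' := fun a b => g.injective (by simp [hI])
           map_zero' := g.injective (by simp [hI])
           map_add' := fun a b => g.injective (by simp [hI]) }, hI⟩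

variable {K E Γ : Type*} [Field K] [Field E] [Algebra K E] [LinearOrderedCommGroupWithZero Γ]

theorem Valuation.exists_adjoin_transcendental (μ : Valuation K Γ) {B : Type} [Field B]
    [Countable B] {i₁ i₂ : B →+* K} {x y : K} (hx : ∀ p : B[X], p ≠ 0 → p.eval₂ i₁ x ≠ 0)
    (h : ∀ p : B[X], μ (p.eval₂ i₁ x) = μ (p.eval₂ i₂ y)) :
    ∃ (A' : Type) (_ : Field A') (_ : Countable A') (e : B →+* A') (i₁' i₂' : A' →+* K),
      (∀ b, i₁' (e b) = i₁ b) ∧ (∀ b, i₂' (e b) = i₂ b) ∧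
      (∀ a, μ (i₁' a) = μ (i₂' a)) ∧ ∃ b, i₁' b = x ∧ i₂' b = y := by
  have := Polynomial.countable_of_countable B
  have h₁ : Function.Injective (eval₂RingHom i₁ x) :=
    (injective_iff_map_eq_zero _).2 fun p hp => by_contra fun h0 => hx p h0 hp
  have h₂ : Function.Injective (eval₂RingHom i₂ y) :=
    (injective_iff_map_eq_zero _).2 fun p hp => by_contra fun h0 => hx p h0 <| by
      rw [← μ.zero_iff, h]
      rw [coe_eval₂RingHom] at hp
      rw [hp, map_zero]
  refine ⟨FractionRing B[X], inferInstance, ?_, (algebraMap B[X] _).comp C,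
    IsFractionRing.lift h₁, IsFractionRing.lift h₂, ?_, ?_, ?_, algebraMap B[X] _ X, ?_, ?_⟩
  · refine Function.Surjective.countable
      (f := fun p : B[X] × B[X] => algebraMap B[X] (FractionRing B[X]) p.1 /
        algebraMap B[X] (FractionRing B[X]) p.2) fun z => ?_
    obtain ⟨a, b, -, hab⟩ := IsFractionRing.div_surjective (A := B[X]) z
    exact ⟨(a, b), hab⟩
  · intro b; simp
  · intro b; simp
  · intro z
    obtain ⟨a, b, -, rfl⟩ := IsFractionRing.div_surjective (A := B[X]) z
    rw [map_div₀, map_div₀, map_div₀, map_div₀]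
    simp only [IsFractionRing.lift_algebraMap, coe_eval₂RingHom, h]
  · simp
  · simp

theorem Valuation.map_eval₂_eq_prod (ν : Valuation E Γ) {Ω : Type*} [Field Ω] [IsAlgClosed Ω]
    (j : Ω →+* E) (t : E) (q : Polynomial Ω) :
    ν (q.eval₂ j t) = ν (j q.leadingCoeff) * (q.roots.map fun r => ν (t - j r)).prod := by
  conv_lhs => rw [(IsAlgClosed.splits q).eq_prod_roots]
  rw [eval₂_mul, eval₂_C, map_mul, eval₂_multiset_prod, map_multiset_prod, Multiset.map_map,
    Multiset.map_map]
  simp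

theorem Valuation.exists_extend_embeddings {O : Type*} [CommRing O] [Algebra O K]
    [HenselianLocalRing O] [IsAlgClosed (IsLocalRing.ResidueField O)] [IsAlgClosure K E]
    [CharZero K] {ν : Valuation E Γ}
    (hO : (ν.comap (algebraMap K E)).Integers O) (hnat : ∀ n : ℕ, n ≠ 0 → ν (n : E) = 1)
    (hsat : ∀ (p : ℕ → K[X]) (g : ℕ → K),
      (∀ N, ∃ y, ∀ k < N, ν (algebraMap K E ((p k).eval y)) = ν (algebraMap K E (g k))) →
      ∃ y, ∀ k, ν (algebraMap K E ((p k).eval y)) = ν (algebraMap K E (g k)))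
    {A : Type} [Field A] [Countable A] {i₁ i₂ : A →+* K}
    (h : ∀ a, ν (algebraMap K E (i₁ a)) = ν (algebraMap K E (i₂ a))) (x : K) :
    ∃ (A' : Type) (_ : Field A') (_ : Countable A') (e : A →+* A') (i₁' i₂' : A' →+* K),
      (∀ a, i₁' (e a) = i₁ a) ∧ (∀ a, i₂' (e a) = i₂ a) ∧
      (∀ a, ν (algebraMap K E (i₁' a)) = ν (algebraMap K E (i₂' a))) ∧ ∃ b, i₁' b = x := by
  classical
  have : CharZero A := charZero_of_inj_zero fun n hn => by
    simpa using congrArg i₁ hn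
  have : IsAlgClosed E := IsAlgClosure.isAlgClosed K
  have : Algebra.IsAlgebraic K E := IsAlgClosure.isAlgebraic
  have : IsGalois K E := {}
  let Ω := AlgebraicClosure A
  have : Countable Ω := Cardinal.mk_le_aleph0_iff.1
    ((Algebra.IsAlgebraic.cardinalMk_le_max A Ω).trans
      (max_le (Cardinal.mk_le_aleph0_iff.2 ‹_›) le_rfl))
  have hlift (i : A →+* K) : ∃ j : Ω →+* E, ∀ a, j (algebraMap A Ω a) = algebraMap K E (i a) := by
    let := ((algebraMap K E).comp i).toAlgebra
    exact ⟨(IsAlgClosed.lift : Ω →ₐ[A] E), fun a =>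
      (IsAlgClosed.lift : Ω →ₐ[A] E).commutes a⟩
  obtain ⟨j₁, h₁⟩ := hlift i₁
  obtain ⟨j₂, h₂, hν⟩ : ∃ j₂ : Ω →+* E,
      (∀ a, j₂ (algebraMap A Ω a) = algebraMap K E (i₂ a)) ∧ ∀ z, ν (j₁ z) = ν (j₂ z) := by
    obtain ⟨j, hj⟩ := hlift i₂
    obtain ⟨σ, hσ⟩ := exists_algEquiv_valuation_eq (A := A) (ν.comap j₁) (ν.comap j)
      (fun n hn => by rw [Valuation.comap_apply, map_natCast, hnat n hn])
      (fun a => by rw [Valuation.comap_apply, Valuation.comap_apply, h₁, hj, h])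
    exact ⟨j.comp σ, fun a => by simp [hj], fun z => (hσ z).symm⟩
  let B : Subfield Ω := (algebraMap K E).fieldRange.comap j₁
  obtain ⟨I₁, hI₁⟩ := (algebraMap K E).exists_comp_eq_of_forall_mem_range (j₁.comp B.subtype)
    fun b => b.2
  obtain ⟨I₂, hI₂⟩ := (algebraMap K E).exists_comp_eq_of_forall_mem_range (j₂.comp B.subtype)
    fun b => (ν.mem_range_iff_mem_range hO hnat h₁ h₂ hν b).1 b.2
  let e : A →+* B := (algebraMap A Ω).codRestrict B fun a => ⟨i₁ a, (h₁ a).symm⟩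
  have he₁ (a : A) : I₁ (e a) = i₁ a := (algebraMap K E).injective ((hI₁ _).trans (h₁ a))
  have he₂ (a : A) : I₂ (e a) = i₂ a := (algebraMap K E).injective ((hI₂ _).trans (h₂ a))
  have hI (b : B) : ν (algebraMap K E (I₁ b)) = ν (algebraMap K E (I₂ b)) := by
    rw [hI₁, hI₂]; exact hν b
  by_cases hx : ∃ b, I₁ b = x
  · exact ⟨B, inferInstance, inferInstance, e, I₁, I₂, he₁, he₂, hI, hx⟩
  have heval {I : B →+* K} {j : Ω →+* E} (hI : ∀ b, algebraMap K E (I b) = j b) (t : K) (p : B[X]) :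
      algebraMap K E (p.eval₂ I t) = (p.map B.subtype).eval₂ j (algebraMap K E t) := by
    rw [hom_eval₂, eval₂_map]
    congr 1
    exact RingHom.ext hI
  have htrans (p : B[X]) (hp : p ≠ 0) : p.eval₂ I₁ x ≠ 0 := by
    intro h0
    have h0' : ν ((p.map B.subtype).eval₂ j₁ (algebraMap K E x)) = 0 := by
      rw [← heval hI₁, h0, map_zero, map_zero]
    rw [ν.map_eval₂_eq_prod, mul_eq_zero, Multiset.prod_eq_zero_iff] at h0'
    rcases h0' with h0' | h0'
    · rw [ν.zero_iff, _root_.map_eq_zero, leadingCoeff_eq_zero] at h0'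
      exact hp ((Polynomial.map_eq_zero _).1 h0')
    · obtain ⟨r, -, hr⟩ := Multiset.mem_map.1 h0'
      rw [ν.zero_iff, sub_eq_zero] at hr
      exact hx ⟨⟨r, x, hr⟩, (algebraMap K E).injective ((hI₁ _).trans hr.symm)⟩
  have := Polynomial.countable_of_countable B
  obtain ⟨f, hf⟩ := exists_surjective_nat B[X]
  obtain ⟨y, hy⟩ := hsat (fun k => (f k).map I₂) (fun k => (f k).eval₂ I₁ x) fun N => by
    obtain ⟨y, hy⟩ := ν.exists_forall_sub_eq hO hnat h₁ h₂ hν x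
      ((Finset.range N).biUnion fun k => ((f k).map B.subtype).roots.toFinset)
    refine ⟨y, fun k hk => ?_⟩
    rw [eval_map, heval hI₁, heval hI₂, ν.map_eval₂_eq_prod, ν.map_eval₂_eq_prod, hν]
    congr 2
    refine Multiset.map_congr rfl fun r hr => hy r ?_
    exact Finset.mem_biUnion.2 ⟨k, Finset.mem_range.2 hk, Multiset.mem_toFinset.2 hr⟩
  obtain ⟨A', _, _, e', i₁', i₂', he₁', he₂', hν', b, hb, -⟩ :=
    (ν.comap (algebraMap K E)).exists_adjoin_transcendental (y := y) htrans fun p => by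
      obtain ⟨k, rfl⟩ := hf p
      have := hy k
      rw [eval_map] at this
      exact this.symm
  exact ⟨A', _, ‹_›, e'.comp e, i₁', i₂', fun a => (he₁' _).trans (he₁ a),
    fun a => (he₂' _).trans (he₂ a), hν', b, hb⟩

end BackAndForth

section Ultrapower

open Filter Polynomial

variable {ι : Type*} (φ : Ultrafilter ι)

theorem Filter.Germ.exists_coe {R : Type*} (x : Germ (φ : Filter ι) R) : ∃ f : ι → R, ↑f = x :=
  x.inductionOn fun f => ⟨f, rfl⟩

theorem Filter.Germ.isUnit_coe_iff {R : Type*} [CommRing R] {f : ι → R} :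
    IsUnit (f : Germ (φ : Filter ι) R) ↔ ∀ᶠ i in φ, IsUnit (f i) := by
  constructor
  · intro h
    obtain ⟨g, hg⟩ := isUnit_iff_exists_inv.1 h
    obtain ⟨g, rfl⟩ := Germ.exists_coe φ g
    rw [← Germ.coe_mul, ← Germ.coe_one, Germ.coe_eq] at hg
    exact hg.mono fun i hi => IsUnit.of_mul_eq_one _ hi
  · intro h
    have : ∀ i, ∃ g, IsUnit (f i) → f i * g = 1 := fun i => by
      by_cases hi : IsUnit (f i)
      · obtain ⟨g, hg⟩ := isUnit_iff_exists_inv.1 hi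
        exact ⟨g, fun _ => hg⟩
      · exact ⟨0, fun h => absurd h hi⟩
    choose g hg using this
    refine IsUnit.of_mul_eq_one (g : Germ (φ : Filter ι) R) ?_
    rw [← Germ.coe_mul, ← Germ.coe_one, Germ.coe_eq]
    exact h.mono fun i hi => hg i hi

instance Filter.Germ.instIsLocalRing {R : Type*} [CommRing R] [IsLocalRing R] :
    IsLocalRing (Germ (φ : Filter ι) R) := by
  refine IsLocalRing.of_isUnit_or_isUnit_one_sub_self fun a => ?_
  obtain ⟨f, rfl⟩ := Germ.exists_coe φ a
  rw [← Germ.coe_one, ← Germ.coe_sub, isUnit_coe_iff, isUnit_coe_iff, ← Ultrafilter.eventually_or]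
  exact Eventually.of_forall fun i => IsLocalRing.isUnit_or_isUnit_one_sub_self (f i)

theorem Filter.Germ.coe_mem_maximalIdeal_iff {R : Type*} [CommRing R] [IsLocalRing R]
    {f : ι → R} : (f : Germ (φ : Filter ι) R) ∈ IsLocalRing.maximalIdeal _ ↔
      ∀ᶠ i in φ, f i ∈ IsLocalRing.maximalIdeal R := by
  simp only [IsLocalRing.mem_maximalIdeal, mem_nonunits_iff, isUnit_coe_iff,
    Ultrafilter.eventually_not]

theorem Filter.Germ.eval_map_coe {R : Type*} [CommRing R] (Q : (ι → R)[X]) (b : ι → R) :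
    (Q.map (Germ.coeRingHom (φ : Filter ι))).eval (b : Germ (φ : Filter ι) R) =
      ((fun i => (Q.map (Pi.evalRingHom (fun _ => R) i)).eval (b i) : ι → R) : Germ _ R) := by
  have : (fun i => (Q.map (Pi.evalRingHom (fun _ => R) i)).eval (b i)) = Q.eval b := by
    funext i
    exact ((eval_map _ _).trans (eval₂_at_apply (Pi.evalRingHom (fun _ => R) i) b))
  rw [this]
  exact (eval_map _ _).trans (eval₂_at_apply (Germ.coeRingHom (φ : Filter ι)) b)

theorem Filter.Germ.exists_map_eq {R : Type*} [CommRing R] (P : (Germ (φ : Filter ι) R)[X]) :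
    ∃ Q : (ι → R)[X], Q.map (Germ.coeRingHom (φ : Filter ι)) = P :=
  (mem_lifts _).1 ((lifts_iff_coeff_lifts _).2 fun _ => Germ.exists_coe φ _)

theorem Filter.Germ.exists_monic_map_eq {R : Type*} [CommRing R] [Nontrivial R]
    {P : (Germ (φ : Filter ι) R)[X]} (hP : P.Monic) :
    ∃ Q : (ι → R)[X], Q.map (Germ.coeRingHom (φ : Filter ι)) = P ∧ Q.Monic := by
  obtain ⟨Q, hQ, -, hm⟩ := lifts_and_degree_eq_and_monic (f := Germ.coeRingHom (φ : Filter ι))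
    ((mem_lifts P).2 (Germ.exists_map_eq φ P)) hP
  exact ⟨Q, hQ, hm⟩

instance Filter.Germ.instHenselianLocalRing {R : Type*} [CommRing R] [HenselianLocalRing R] :
    HenselianLocalRing (Germ (φ : Filter ι) R) where
  is_henselian P hP a ha hda := by
    obtain ⟨Q, rfl, hQ⟩ := Germ.exists_monic_map_eq φ hP
    obtain ⟨a, rfl⟩ := Germ.exists_coe φ a
    rw [Germ.eval_map_coe, Germ.coe_mem_maximalIdeal_iff] at ha
    rw [derivative_map, Germ.eval_map_coe, Germ.isUnit_coe_iff] at hda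
    have key : ∀ i, ∃ b : R, (Q.map (Pi.evalRingHom (fun _ => R) i)).eval (a i) ∈
        IsLocalRing.maximalIdeal R →
        IsUnit (((derivative Q).map (Pi.evalRingHom (fun _ => R) i)).eval (a i)) →
        (Q.map (Pi.evalRingHom (fun _ => R) i)).eval b = 0 ∧
          b - a i ∈ IsLocalRing.maximalIdeal R := fun i => by
      by_contra! hno
      obtain ⟨h1, h2, -⟩ := hno 0
      rw [← derivative_map] at h2
      obtain ⟨b, hb, hba⟩ := HenselianLocalRing.is_henselian _ (hQ.map _) _ h1 h2
      exact (hno b).2.2 hb hba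
    choose b hb using key
    refine ⟨b, ?_, ?_⟩
    · rw [IsRoot.def, Germ.eval_map_coe, ← Germ.coe_zero, Germ.coe_eq]
      filter_upwards [ha, hda] with i h1 h2 using (hb i h1 h2).1
    · rw [← Germ.coe_sub, Germ.coe_mem_maximalIdeal_iff]
      filter_upwards [ha, hda] with i h1 h2 using (hb i h1 h2).2

instance Filter.Germ.instIsAlgClosedResidueField {R : Type*} [CommRing R] [IsLocalRing R]
    [IsAlgClosed (IsLocalRing.ResidueField R)] :
    IsAlgClosed (IsLocalRing.ResidueField (Germ (φ : Filter ι) R)) := by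
  refine IsAlgClosed.of_exists_root _ fun p hp hirr => ?_
  obtain ⟨q, hqp, hdeg, hq⟩ := lifts_and_natDegree_eq_and_monic
    (f := IsLocalRing.residue (Germ (φ : Filter ι) R))
    ((lifts_iff_coeff_lifts _).2 fun i => IsLocalRing.residue_surjective _) hp
  obtain ⟨Q, rfl, hQ⟩ := Germ.exists_monic_map_eq φ hq
  have key : ∀ i, ∃ b : R, (Q.map (Pi.evalRingHom (fun _ => R) i)).eval b ∈
      IsLocalRing.maximalIdeal R := fun i => by
    have hne : ((Q.map (Pi.evalRingHom (fun _ => R) i)).map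
        (IsLocalRing.residue R)).degree ≠ 0 := by
      rw [((hQ.map _).degree_map _), hQ.degree_map,
        ← hQ.degree_map (Germ.coeRingHom (φ : Filter ι)),
        ← hq.degree_map (IsLocalRing.residue _), hqp]
      exact (degree_pos_of_irreducible hirr).ne'
    obtain ⟨b, hb⟩ := IsAlgClosed.exists_root _ hne
    obtain ⟨b, rfl⟩ := IsLocalRing.residue_surjective b
    refine ⟨b, ?_⟩
    rwa [IsRoot.def, eval_map, eval₂_at_apply, IsLocalRing.residue_eq_zero_iff] at hb
  choose b hb using key
  refine ⟨IsLocalRing.residue _ (b : Germ (φ : Filter ι) R), ?_⟩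
  rw [← hqp, eval_map, eval₂_at_apply, IsLocalRing.residue_eq_zero_iff, Germ.eval_map_coe,
    Germ.coe_mem_maximalIdeal_iff]
  exact Eventually.of_forall hb

theorem Filter.Germ.exists_forall_eventually {X : Type*} (D : ℕ → ℕ → Set X) [Nonempty X]
    (h : ∀ N, ∃ y : ℕ → X, ∀ᶠ i in hyperfilter ℕ, ∀ k < N, y i ∈ D k i) :
    ∃ y : ℕ → X, ∀ k, ∀ᶠ i in hyperfilter ℕ, y i ∈ D k i := by
  classical
  let P : ℕ → ℕ → Prop := fun i N => ∃ z, ∀ k < N, z ∈ D k i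
  have hP (i : ℕ) : P i (Nat.findGreatest (P i) i) :=
    Nat.findGreatest_spec (P := P i) (Nat.zero_le i) ⟨Classical.arbitrary X, by simp⟩
  choose y hy using hP
  refine ⟨y, fun k => ?_⟩
  obtain ⟨z, hz⟩ := h (k + 1)
  have hlarge : ∀ᶠ i in hyperfilter ℕ, k + 1 ≤ i :=
    Nat.hyperfilter_le_atTop (eventually_ge_atTop (k + 1))
  filter_upwards [hz, hlarge] with i h1 h2
  exact hy i k (Nat.lt_of_succ_le (Nat.le_findGreatest h2 ⟨z i, h1⟩))

end Ultrapower

section Transfer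

open Filter Polynomial

theorem IsLocalRing.exists_valuationSubring_integers {O K E : Type*} [CommRing O] [IsLocalRing O]
    [Field K] [Field E] [Algebra O K] [Algebra K E]
    (hinj : Function.Injective (algebraMap O K))
    (hval : ∀ x : K, x ∈ (algebraMap O K).range ∨ x⁻¹ ∈ (algebraMap O K).range) :
    ∃ A : ValuationSubring E, (A.valuation.comap (algebraMap K E)).Integers O := by
  obtain ⟨A, hA, hloc⟩ :=
    IsLocalRing.exists_factor_valuationRing ((algebraMap K E).comp (algebraMap O K))
  have hle (a : O) : A.valuation (algebraMap K E (algebraMap O K a)) ≤ 1 :=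
    (A.valuation_le_one_iff _).2 (hA a)
  refine ⟨A, hinj, hle, fun x hx => ?_⟩
  rcases hval x with h | ⟨a, ha⟩
  · exact h
  by_cases hx0 : x = 0
  · exact ⟨0, by simp [hx0]⟩
  have hmem : algebraMap K E x ∈ A := (A.valuation_le_one_iff _).1 hx
  have hunit :
      IsUnit (((algebraMap K E).comp (algebraMap O K)).codRestrict A.toSubring hA a) := by
    refine IsUnit.of_mul_eq_one (⟨algebraMap K E x, hmem⟩ : A.toSubring) ?_
    apply Subtype.ext
    change algebraMap K E (algebraMap O K a) * algebraMap K E x = 1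
    rw [ha, ← map_mul, inv_mul_cancel₀ hx0, map_one]
  obtain ⟨b, hb⟩ := isUnit_iff_exists_inv.1 (hloc.map_nonunit _ hunit)
  refine ⟨b, ?_⟩
  have := congrArg (algebraMap O K) hb
  rw [map_mul, ha, map_one] at this
  rw [← one_mul (algebraMap O K b), ← mul_inv_cancel₀ hx0, mul_assoc, this, mul_one]

theorem Valuation.le_iff_exists_eq_mul {F Γ : Type*} [Field F]
    [LinearOrderedCommGroupWithZero Γ] (μ : Valuation F Γ) {a b : F} :
    μ a ≤ μ b ↔ ∃ c, μ c ≤ 1 ∧ a = b * c := by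
  constructor
  · intro h
    by_cases hb : b = 0
    · refine ⟨0, by simp, ?_⟩
      rw [hb, map_zero, le_zero_iff, map_eq_zero] at h
      simp [h]
    · refine ⟨a / b, ?_, by field_simp⟩
      rw [map_div₀]
      exact div_le_one_of_le₀ h zero_le
  · rintro ⟨c, hc, rfl⟩
    rw [map_mul]
    exact mul_le_of_le_one_right' hc

variable {ι : Type*} (φ : Ultrafilter ι)

theorem Filter.Germ.valuation_coe_eq_iff {K Γ : Type*} [Field K] (v : ValuationSubring K)
    [LinearOrderedCommGroupWithZero Γ] (μ : Valuation (Germ (φ : Filter ι) K) Γ)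
    (hμ : ∀ f : ι → K, μ (f : Germ (φ : Filter ι) K) ≤ 1 ↔ ∀ᶠ i in φ, f i ∈ v)
    (f g : ι → K) :
    μ (f : Germ (φ : Filter ι) K) = μ (g : Germ (φ : Filter ι) K) ↔
      ∀ᶠ i in φ, v.valuation (f i) = v.valuation (g i) := by
  have key (f g : ι → K) : μ (f : Germ (φ : Filter ι) K) ≤ μ (g : Germ (φ : Filter ι) K) ↔
      ∀ᶠ i in φ, v.valuation (f i) ≤ v.valuation (g i) := by
    rw [μ.le_iff_exists_eq_mul]
    constructor
    · rintro ⟨c, hc, h⟩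
      obtain ⟨c, rfl⟩ := Germ.exists_coe φ c
      rw [← Germ.coe_mul, Germ.coe_eq] at h
      filter_upwards [(hμ c).1 hc, h] with i h1 h2
      exact v.valuation.le_iff_exists_eq_mul.2 ⟨c i, (v.valuation_le_one_iff _).2 h1, h2⟩
    · intro h
      have (i : ι) : ∃ c, v.valuation (f i) ≤ v.valuation (g i) → c ∈ v ∧ f i = g i * c := by
        by_cases hi : v.valuation (f i) ≤ v.valuation (g i)
        · obtain ⟨c, hc, h⟩ := v.valuation.le_iff_exists_eq_mul.1 hi
          exact ⟨c, fun _ => ⟨(v.valuation_le_one_iff _).1 hc, h⟩⟩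
        · exact ⟨0, fun h => absurd h hi⟩
      choose c hc using this
      refine ⟨c, (hμ c).2 (h.mono fun i hi => (hc i hi).1), ?_⟩
      rw [← Germ.coe_mul, Germ.coe_eq]
      exact h.mono fun i hi => (hc i hi).2
  rw [le_antisymm_iff, key, key, ← eventually_and]
  exact eventually_congr (Eventually.of_forall fun i => le_antisymm_iff.symm)

/-- Two embeddings into a valued field, with the same pulled back valuation, can be extended so that
the image of the first one contains a prescribed element. -/
def Valuation.HasEmbeddingExtension {F Γ : Type*} [Field F] [LinearOrderedCommGroupWithZero Γ]
    (μ : Valuation F Γ) : Prop :=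
  ∀ {A : Type} [Field A] [Countable A] {i₁ i₂ : A →+* F} (_ : ∀ a, μ (i₁ a) = μ (i₂ a)) (x : F),
    ∃ (A' : Type) (_ : Field A') (_ : Countable A') (e : A →+* A') (i₁' i₂' : A' →+* F),
      (∀ a, i₁' (e a) = i₁ a) ∧ (∀ a, i₂' (e a) = i₂ a) ∧
        (∀ a, μ (i₁' a) = μ (i₂' a)) ∧ ∃ b, i₁' b = x

theorem ValuationSubring.exists_valuation_germ.{u} {K : Type u} [Field K]
    (v : ValuationSubring K) [HenselianLocalRing v]
    [IsAlgClosed (IsLocalRing.ResidueField v)] [CharZero (IsLocalRing.ResidueField v)] :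
    ∃ (Γ : Type u) (_ : LinearOrderedCommGroupWithZero Γ)
      (μ : Valuation (Germ (hyperfilter ℕ : Filter ℕ) K) Γ),
      (∀ f g : ℕ → K, μ (f : Germ (hyperfilter ℕ : Filter ℕ) K) = μ ↑g ↔
        ∀ᶠ i in hyperfilter ℕ, v.valuation (f i) = v.valuation (g i)) ∧
      μ.HasEmbeddingExtension := by
  let L := Germ (hyperfilter ℕ : Filter ℕ) K
  let O := Germ (hyperfilter ℕ : Filter ℕ) v
  let j : O →+* L :=
    { toFun := Germ.map Subtype.val
      map_one' := rfl
      map_zero' := rfl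
      map_mul' := fun a b => Germ.inductionOn₂ a b fun _ _ => rfl
      map_add' := fun a b => Germ.inductionOn₂ a b fun _ _ => rfl }
  let _ : Algebra O L := j.toAlgebra
  have hrange (f : ℕ → K) : ((f : L) ∈ (algebraMap O L).range) ↔
      ∀ᶠ i in hyperfilter ℕ, f i ∈ v := by
    constructor
    · rintro ⟨a, ha⟩
      obtain ⟨a, rfl⟩ := Germ.exists_coe _ a
      exact (Germ.coe_eq.1 ha).mono fun i hi => hi ▸ (a i).2
    · intro h
      classical
      refine ⟨((fun i => if hi : f i ∈ v then ⟨f i, hi⟩ else 0 : ℕ → v) : O), ?_⟩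
      exact Germ.coe_eq.2 (h.mono fun i hi => by simp [hi])
  have hinj : Function.Injective (algebraMap O L) := fun a b =>
    Germ.inductionOn₂ a b fun a b h =>
      Germ.coe_eq.2 ((Germ.coe_eq.1 h).mono fun i hi => Subtype.ext hi)
  obtain ⟨A, hA⟩ := IsLocalRing.exists_valuationSubring_integers (E := AlgebraicClosure L) hinj
    fun x => by
      obtain ⟨f, rfl⟩ := Germ.exists_coe _ x
      rw [← Germ.coe_inv, hrange, hrange, ← Ultrafilter.eventually_or]
      exact Eventually.of_forall fun i => v.mem_or_inv_mem (f i)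
  have hmem (f : ℕ → K) : A.valuation.comap (algebraMap L (AlgebraicClosure L)) (f : L) ≤ 1 ↔
      ∀ᶠ i in hyperfilter ℕ, f i ∈ v :=
    ⟨fun h => (hrange f).1 (hA.exists_of_le_one h), fun h => by
      obtain ⟨a, ha⟩ := (hrange f).2 h
      exact ha ▸ hA.map_le_one a⟩
  have hnat (n : ℕ) (hn : n ≠ 0) : A.valuation (n : AlgebraicClosure L) = 1 := by
    have hu : IsUnit (n : v) := by
      by_contra hu
      have := (IsLocalRing.residue_eq_zero_iff _).2 ((IsLocalRing.mem_maximalIdeal _).2 hu)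
      rw [map_natCast] at this
      exact hn (Nat.cast_eq_zero.1 this)
    have hu' : IsUnit (n : O) := (Germ.isUnit_coe_iff _).2 (Eventually.of_forall fun _ => hu)
    have := hA.one_of_isUnit hu'
    rwa [map_natCast (algebraMap O L), Valuation.comap_apply, map_natCast] at this
  have : CharZero L := charZero_of_inj_zero fun n hn => by
    by_contra h0
    have := hnat n h0
    rw [← map_natCast (algebraMap L (AlgebraicClosure L)), hn] at this
    simp at this
  have heq := Germ.valuation_coe_eq_iff (hyperfilter ℕ) v _ hmem
  refine ⟨_, _, _, heq, fun {B} _ _ i₁ i₂ h x => ?_⟩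
  refine Valuation.exists_extend_embeddings (O := O) hA hnat (fun p g hN => ?_) h x
  choose Q hQ using fun k => Germ.exists_map_eq _ (p k)
  choose g' hg using fun k => Germ.exists_coe _ (g k)
  have hiff (y : ℕ → K) (k : ℕ) : A.valuation (algebraMap L (AlgebraicClosure L) ((p k).eval ↑y)) =
      A.valuation (algebraMap L (AlgebraicClosure L) (g k)) ↔
      ∀ᶠ i in hyperfilter ℕ, v.valuation (((Q k).map (Pi.evalRingHom (fun _ => K) i)).eval (y i)) =
        v.valuation (g' k i) := by
    rw [← hQ, Germ.eval_map_coe, ← hg]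
    exact heq _ _
  obtain ⟨y, hy⟩ := Germ.exists_forall_eventually (fun k i => {z : K |
    v.valuation (((Q k).map (Pi.evalRingHom (fun _ => K) i)).eval z) = v.valuation (g' k i)})
    fun N => by
      obtain ⟨y, hy⟩ := hN N
      obtain ⟨y, rfl⟩ := Germ.exists_coe _ y
      refine ⟨y, ?_⟩
      have h2 : ∀ᶠ i in hyperfilter ℕ, ∀ k ∈ Finset.range N,
        v.valuation (((Q k).map (Pi.evalRingHom (fun _ => K) i)).eval (y i)) =
          v.valuation (g' k i) :=
        (Filter.eventually_all_finset _).2 fun k hk => (hiff y k).1 (hy k (Finset.mem_range.1 hk))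
      exact h2.mono fun i hi k hk => hi k (Finset.mem_range.2 hk)
  exact ⟨y, fun k => (hiff y k).2 (hy k)⟩

end Transfer

section Formulas

open Filter FirstOrder.Ring

theorem FirstOrder.Ring.realize_comp_ringHom {R S β : Type*} [Ring R] [Ring S]
    [CompatibleRing R] [CompatibleRing S] (f : R →+* S) (t : Language.ring.Term β) (s : β → R) :
    t.realize (fun b => f (s b)) = f (t.realize s) := by
  induction t with
  | var b => rfl
  | func g ts ih =>
    simp only [Language.Term.realize, ih]
    cases g <;> simp [CompatibleRing.funMap_add, CompatibleRing.funMap_mul,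
      CompatibleRing.funMap_neg, CompatibleRing.funMap_zero, CompatibleRing.funMap_one]

theorem FirstOrder.Ring.eventually_realize_eq_iff {K A β : Type*} [Field K] [Field A]
    {i : A →+* Germ (hyperfilter ℕ : Filter ℕ) K} {s : β → A} {x : ℕ → β → K}
    (hx : ∀ b, ((fun m => x m b : ℕ → K) : Germ (hyperfilter ℕ : Filter ℕ) K) = i (s b))
    (t₁ t₂ : Language.ring.Term β) :
    (∀ᶠ m in hyperfilter ℕ, t₁.realize (x m) = t₂.realize (x m)) ↔
      t₁.realize s = t₂.realize s := by
  have key (t : Language.ring.Term β) : ((fun m => t.realize (x m) : ℕ → K) :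
      Germ (hyperfilter ℕ : Filter ℕ) K) = i (t.realize s) := by
    rw [← realize_comp_ringHom i, ← funext hx]
    refine Eq.trans ?_ (realize_comp_ringHom (Germ.coeRingHom (hyperfilter ℕ : Filter ℕ)) t
      fun b m => x m b).symm
    refine congrArg _ (funext fun m => ?_)
    exact realize_comp_ringHom (Pi.evalRingHom (fun _ => K) m) t fun b m => x m b
  rw [← i.injective.eq_iff, ← key, ← key, Germ.coe_eq]
  rfl

theorem Valuation.HasEmbeddingExtension.eventually_realize_iff {K Γ : Type*} [Field K]
    [LinearOrderedCommGroupWithZero Γ] {μ : Valuation (Germ (hyperfilter ℕ : Filter ℕ) K) Γ}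
    (hμ : μ.HasEmbeddingExtension) {α : Type*} {n : ℕ} (ψ : Language.ring.BoundedFormula α n)
    {A : Type} [Field A] [Countable A] {i₁ i₂ : A →+* Germ (hyperfilter ℕ : Filter ℕ) K}
    (h : ∀ a, μ (i₁ a) = μ (i₂ a)) {s : α → A} {t : Fin n → A} {x₁ x₂ : ℕ → α → K}
    {y₁ y₂ : ℕ → Fin n → K}
    (hx₁ : ∀ b, ((fun m => x₁ m b : ℕ → K) : Germ (hyperfilter ℕ : Filter ℕ) K) = i₁ (s b))
    (hx₂ : ∀ b, ((fun m => x₂ m b : ℕ → K) : Germ (hyperfilter ℕ : Filter ℕ) K) = i₂ (s b))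
    (hy₁ : ∀ b, ((fun m => y₁ m b : ℕ → K) : Germ (hyperfilter ℕ : Filter ℕ) K) = i₁ (t b))
    (hy₂ : ∀ b, ((fun m => y₂ m b : ℕ → K) : Germ (hyperfilter ℕ : Filter ℕ) K) = i₂ (t b)) :
    (∀ᶠ m in hyperfilter ℕ, ψ.Realize (x₁ m) (y₁ m)) ↔
      ∀ᶠ m in hyperfilter ℕ, ψ.Realize (x₂ m) (y₂ m) := by
  induction ψ generalizing A x₁ x₂ with
  | falsum => simp [Language.BoundedFormula.Realize]
  | equal t₁ t₂ =>
    have h₁ := eventually_realize_eq_iff (i := i₁) (s := Sum.elim s t)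
      (x := fun m => Sum.elim (x₁ m) (y₁ m)) (Sum.rec hx₁ hy₁) t₁ t₂
    have h₂ := eventually_realize_eq_iff (i := i₂) (s := Sum.elim s t)
      (x := fun m => Sum.elim (x₂ m) (y₂ m)) (Sum.rec hx₂ hy₂) t₁ t₂
    exact h₁.trans h₂.symm
  | rel R => exact isEmptyElim R
  | imp ψ₁ ψ₂ ih₁ ih₂ =>
    simp only [Language.BoundedFormula.realize_imp, Ultrafilter.eventually_imp]
    rw [ih₁ h hx₁ hx₂ hy₁ hy₂, ih₂ h hx₁ hx₂ hy₁ hy₂]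
  | all ψ ih =>
    simp only [Language.BoundedFormula.realize_all]
    have key {i₁ i₂ : A →+* Germ (hyperfilter ℕ : Filter ℕ) K}
        (h : ∀ a, μ (i₁ a) = μ (i₂ a)) {x₁ x₂ : ℕ → α → K} {y₁ y₂ : ℕ → Fin _ → K}
        (hx₁ : ∀ b, ((fun m => x₁ m b : ℕ → K) : Germ (hyperfilter ℕ : Filter ℕ) K) = i₁ (s b))
        (hx₂ : ∀ b, ((fun m => x₂ m b : ℕ → K) : Germ (hyperfilter ℕ : Filter ℕ) K) = i₂ (s b))
        (hy₁ : ∀ b, ((fun m => y₁ m b : ℕ → K) : Germ (hyperfilter ℕ : Filter ℕ) K) = i₁ (t b))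
        (hy₂ : ∀ b, ((fun m => y₂ m b : ℕ → K) : Germ (hyperfilter ℕ : Filter ℕ) K) = i₂ (t b))
        (hall : ∀ᶠ m in hyperfilter ℕ, ∀ a, ψ.Realize (x₁ m) (Fin.snoc (y₁ m) a)) :
        ∀ᶠ m in hyperfilter ℕ, ∀ a, ψ.Realize (x₂ m) (Fin.snoc (y₂ m) a) := by
      have (m : ℕ) : ∃ a, ψ.Realize (x₂ m) (Fin.snoc (y₂ m) a) →
          ∀ a, ψ.Realize (x₂ m) (Fin.snoc (y₂ m) a) := by
        by_contra! hno
        obtain ⟨-, a, ha⟩ := hno 0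
        exact ha (hno a).1
      choose a ha using this
      obtain ⟨A', _, _, e, i₂', i₁', h₂, h₁, h', b, hb⟩ := hμ (fun a => (h a).symm) ↑a
      obtain ⟨c, hc⟩ := Germ.exists_coe _ (i₁' b)
      have hsnoc {i : A →+* Germ (hyperfilter ℕ : Filter ℕ) K}
          {i' : A' →+* Germ (hyperfilter ℕ : Filter ℕ) K} (hi : ∀ a, i' (e a) = i a)
          {y : ℕ → Fin _ → K} {d : ℕ → K}
          (hy : ∀ b, ((fun m => y m b : ℕ → K) : Germ (hyperfilter ℕ : Filter ℕ) K) = i (t b))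
          (hd : (d : Germ (hyperfilter ℕ : Filter ℕ) K) = i' b) (k : Fin (_ + 1)) :
          ((fun m => (Fin.snoc (y m) (d m) : Fin (_ + 1) → K) k : ℕ → K) :
            Germ (hyperfilter ℕ : Filter ℕ) K) =
            i' ((Fin.snoc (fun k => e (t k)) b : Fin (_ + 1) → A') k) := by
        refine Fin.lastCases ?_ (fun k => ?_) k
        · simpa using hd
        · simpa [hi] using hy k
      have := (ih (fun a => (h' a).symm) (s := fun k => e (s k))
        (fun k => (hx₁ k).trans (h₁ _).symm)
        (fun k => (hx₂ k).trans (h₂ _).symm) (hsnoc h₁ hy₁ hc) (hsnoc h₂ hy₂ hb.symm)).1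
        (hall.mono fun m hm => hm (c m))
      exact this.mono fun m hm => ha m hm
    exact ⟨key h hx₁ hx₂ hy₁ hy₂, key (fun a => (h a).symm) hx₂ hx₁ hy₂ hy₁⟩

end Formulas

section GenericElement

open Filter Polynomial

theorem ValuationSubring.valuation_ratCast_eq_one {K : Type*} [Field K] [CharZero K]
    (v : ValuationSubring K) [CharZero (IsLocalRing.ResidueField v)] {r : ℚ} (hr : r ≠ 0) :
    v.valuation (r : K) = 1 := by
  have hnat (n : ℕ) (hn : n ≠ 0) : v.valuation (n : K) = 1 := by
    rw [← not_not (a := _ = _)]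
    intro h
    have hu : ¬ IsUnit (n : v) := fun hu => h (by simpa using v.valuation_unit hu.unit)
    have := (IsLocalRing.residue_eq_zero_iff _).2 ((IsLocalRing.mem_maximalIdeal _).2 hu)
    rw [map_natCast] at this
    exact hn (Nat.cast_eq_zero.1 this)
  have h_int : v.valuation (r.num : K) = 1 := by
    rcases Int.natAbs_eq r.num with h | h <;> rw [h]
    · simpa using hnat _ (Int.natAbs_ne_zero.2 (Rat.num_ne_zero.2 hr))
    · simpa using hnat _ (Int.natAbs_ne_zero.2 (Rat.num_ne_zero.2 hr))
  rw [Rat.cast_def, map_div₀, h_int, hnat _ r.den_ne_zero, div_one]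

theorem ValuationSubring.valuation_sub_pow_eq_one {K : Type*} [Field K] {v w : ValuationSubring K}
    (hw : w < v) {u : K} (hu : u ∈ v) (huw : u ∉ w) {m n : ℕ} (hmn : m ≠ n) :
    v.valuation (u ^ m - u ^ n) = 1 := by
  have hu1 : v.valuation u = 1 := by
    refine le_antisymm ((v.valuation_le_one_iff u).2 hu) ?_
    have := (v.valuation_le_one_iff _).2 (hw.le ((w.mem_or_inv_mem u).resolve_left huw))
    rw [map_inv₀] at this
    by_contra! h
    have hu0 : v.valuation u ≠ 0 := (Valuation.ne_zero_iff _).2 fun h => huw (h ▸ w.zero_mem)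
    exact absurd this (not_le.2 ((one_lt_inv₀ (zero_lt_iff.2 hu0)).2 h))
  wlog h : m < n generalizing m n
  · rw [Valuation.map_sub_swap]
    exact this hmn.symm (lt_of_le_of_ne (not_lt.1 h) hmn.symm)
  obtain ⟨k, rfl⟩ := Nat.exists_eq_add_of_lt h
  have : u ^ m - u ^ (m + k + 1) = u ^ m * (1 - u ^ (k + 1)) := by ring
  rw [this, map_mul, map_pow, hu1, one_pow, one_mul]
  refine le_antisymm ?_ ?_
  · exact (v.valuation_le_one_iff _).2 (v.sub_mem v.one_mem (v.pow_mem hu _))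
  · by_contra! hlt
    have hmem : 1 - u ^ (k + 1) ∈ w := by
      by_contra hnot
      have := (v.valuation_le_one_iff _).2 (hw.le ((w.mem_or_inv_mem _).resolve_left hnot))
      rw [map_inv₀] at this
      have h0 : v.valuation (1 - u ^ (k + 1)) ≠ 0 :=
        (Valuation.ne_zero_iff _).2 fun h => hnot (h ▸ w.zero_mem)
      exact absurd this (not_le.2 ((one_lt_inv₀ (zero_lt_iff.2 h0)).2 hlt))
    have hpow : u ^ (k + 1) ∈ w := by simpa using w.sub_mem w.one_mem hmem
    rw [← w.valuation_le_one_iff, map_pow, pow_le_one_iff k.succ_ne_zero,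
      w.valuation_le_one_iff] at hpow
    exact huw hpow

theorem ValuationSubring.exists_transcendental_notMem {K : Type*} [Field K] [CharZero K]
    {v w : ValuationSubring K} [CharZero (IsLocalRing.ResidueField v)] (hw : w < v) :
    ∃ y : ℕ → K, (∀ᶠ i in hyperfilter ℕ, y i ∉ w) ∧ ∀ p : ℚ[X], p ≠ 0 →
      ∀ᶠ i in hyperfilter ℕ, v.valuation (p.eval₂ (algebraMap ℚ K) (y i)) = 1 := by
  obtain ⟨u, huv, huw⟩ := SetLike.exists_of_lt hw
  have hcoeff (p : ℚ[X]) (i : ℕ) : v.valuation ((p.map (algebraMap ℚ K)).coeff i) ≤ 1 := by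
    by_cases h : p.coeff i = 0
    · simp [coeff_map, h]
    · simpa [coeff_map] using (v.valuation_ratCast_eq_one h).le
  have hfin (p : ℚ[X]) (hp : p ≠ 0) :
      {m : ℕ | v.valuation (p.eval₂ (algebraMap ℚ K) (u ^ (m + 1))) ≠ 1}.Finite := by
    simp only [← eval_map]
    refine Valuation.finite_eval_lt_one _ (hcoeff p) ⟨p.natDegree, ?_⟩
      (c := fun m => u ^ (m + 1)) (fun m => ?_) fun m n hmn => ?_
    · simpa [coeff_map] using v.valuation_ratCast_eq_one (leadingCoeff_ne_zero.2 hp)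
    · exact (v.valuation_le_one_iff _).2 (v.pow_mem huv _)
    · exact valuation_sub_pow_eq_one hw huv huw (by simpa using hmn)
  have := countable_of_countable ℚ
  obtain ⟨e, he⟩ := exists_surjective_nat ℚ[X]
  obtain ⟨y, hy⟩ := Germ.exists_forall_eventually (fun k _ => {z : K | z ∉ w ∧
      (e k ≠ 0 → v.valuation ((e k).eval₂ (algebraMap ℚ K) z) = 1)}) fun N => by
    have : (⋃ k ∈ {k ∈ Finset.range N | e k ≠ 0},
        {m : ℕ | v.valuation ((e k).eval₂ (algebraMap ℚ K) (u ^ (m + 1))) ≠ 1}).Finite :=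
      Set.Finite.biUnion (Finset.finite_toSet _) fun k hk =>
        hfin _ (Finset.mem_filter.1 hk).2
    obtain ⟨m, hm⟩ := this.exists_notMem
    refine ⟨fun _ => u ^ (m + 1), Eventually.of_forall fun _ k hk => ⟨?_, fun h0 => ?_⟩⟩
    · rwa [← w.valuation_le_one_iff, map_pow, pow_le_one_iff m.succ_ne_zero,
        w.valuation_le_one_iff]
    · by_contra hne
      exact hm (Set.mem_biUnion (Finset.mem_filter.2 ⟨Finset.mem_range.2 hk, h0⟩) hne)
  refine ⟨y, (hy 0).mono fun i hi => hi.1, fun p hp => ?_⟩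
  obtain ⟨k, rfl⟩ := he p
  exact (hy k).mono fun i hi => hi.2 hp

theorem ValuationSubring.exists_valuation_eval₂_eq_one {K Γ : Type*} [Field K] [CharZero K]
    {v w : ValuationSubring K} [CharZero (IsLocalRing.ResidueField v)] (hw : w < v)
    [LinearOrderedCommGroupWithZero Γ] {μ : Valuation (Germ (hyperfilter ℕ : Filter ℕ) K) Γ}
    (hμ : ∀ f g : ℕ → K, μ (f : Germ (hyperfilter ℕ : Filter ℕ) K) = μ ↑g ↔
        ∀ᶠ i in hyperfilter ℕ, v.valuation (f i) = v.valuation (g i)) :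
    ∃ (y : ℕ → K) (i : ℚ →+* Germ (hyperfilter ℕ : Filter ℕ) K),
      (∀ᶠ m in hyperfilter ℕ, y m ∉ w) ∧ ∀ p : ℚ[X], p ≠ 0 → μ (p.eval₂ i ↑y) = 1 := by
  obtain ⟨y, hyw, hy⟩ := exists_transcendental_notMem hw
  refine ⟨y, (Germ.coeRingHom _).comp ((Pi.constRingHom ℕ K).comp (algebraMap ℚ K)), hyw,
    fun p hp => ?_⟩
  rw [← map_one μ, ← Germ.coe_one]
  have : p.eval₂ ((Germ.coeRingHom (hyperfilter ℕ : Filter ℕ)).comp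
      ((Pi.constRingHom ℕ K).comp (algebraMap ℚ K))) ↑y =
      ((fun m => p.eval₂ (algebraMap ℚ K) (y m) : ℕ → K) : Germ _ K) := by
    refine (hom_eval₂ p _ (Germ.coeRingHom (hyperfilter ℕ : Filter ℕ)) y).symm.trans
      (congrArg _ (funext fun m => ?_))
    exact hom_eval₂ p _ (Pi.evalRingHom (fun _ => K) m) y
  rw [this, hμ]
  exact (hy p hp).mono fun m hm => by simpa using hm

end GenericElement

/-- let `K` be a field of characteristic zero whose canonical henselian
valuation `v` belongs to `H₂(K)`: `v` is henselian with separably closed residue field of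
characteristic zero, and `v` is the coarsest such valuation (every henselian valuation with
separably closed residue field refines `v`).  Then no proper refinement of `v` is
`∅`-definable in the language of rings. -/
theorem no_definable_proper_refinement_of_canonical_H2
    {K : Type*} [Field K] [CharZero K]
    (v : ValuationSubring K) [HenselianLocalRing v]
    (hsep : IsSepClosed (IsLocalRing.ResidueField v))
    (hchar : CharZero (IsLocalRing.ResidueField v))
    (hcoarsest : ∀ w : ValuationSubring K, HenselianLocalRing w →
      IsSepClosed (IsLocalRing.ResidueField w) → w ≤ v)
    (w : ValuationSubring K) (hw : w < v) :
    ¬ Set.Definable₁ (∅ : Set K) Language.ring {x : K | x ∈ w} := by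
  intro hdef
  obtain ⟨ψ, hψ⟩ := Set.empty_definable_iff.1 hdef
  have hψ' (z : K) : z ∈ w ↔ Language.BoundedFormula.Realize ψ (fun _ => z) default :=
    Set.ext_iff.1 hψ fun _ => z
  obtain ⟨Γ, _, μ, hμ, hext⟩ := v.exists_valuation_germ
  obtain ⟨y, i, hyw, hy⟩ := ValuationSubring.exists_valuation_eval₂_eq_one hw hμ
  have hμy : μ (y : Filter.Germ (Filter.hyperfilter ℕ : Filter ℕ) K) = 1 := by
    simpa using hy Polynomial.X Polynomial.X_ne_zero
  have hy0 : (y : Filter.Germ (Filter.hyperfilter ℕ : Filter ℕ) K)⁻¹ ≠ 0 := by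
    refine inv_ne_zero ?_
    rw [← μ.ne_zero_iff, hμy]
    exact one_ne_zero
  obtain ⟨A, _, _, -, i₁, i₂, -, -, h, b, hb₁, hb₂⟩ :=
    μ.exists_adjoin_transcendental (i₁ := i) (i₂ := i) (x := (y : Filter.Germ _ K))
      (y := (y : Filter.Germ _ K)⁻¹)
      (fun p hp h0 => by simpa [h0] using hy p hp) fun p => by
        by_cases hp : p = 0
        · simp [hp]
        have := invertibleOfNonzero hy0
        rw [← Polynomial.eval₂_reverse_mul_pow i
          (y : Filter.Germ (Filter.hyperfilter ℕ : Filter ℕ) K)⁻¹ p, map_mul, map_pow, map_inv₀, hμy, invOf_eq_inv, inv_inv, hy p hp, hy _ (by simpa using hp)]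
        simp
  have key := (hext.eventually_realize_iff ψ h (s := fun _ => b) (t := default)
    (x₁ := fun m _ => y m) (x₂ := fun m _ => (y m)⁻¹) (y₁ := default) (y₂ := default)
    (fun _ => hb₁.symm) (fun _ => hb₂.symm) (fun k => k.elim0) (fun k => k.elim0)).2
    (hyw.mono fun m hm => (hψ' _).1 ((w.mem_or_inv_mem _).resolve_left hm))
  obtain ⟨m, h₁, h₂⟩ := (key.and hyw).exists
  exact h₂ ((hψ' _).2 h₁)
end
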